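/- Let T be a recursively enumerable extension of PA_□. (1) If T contains PA(K4), T is consistent, and T has the modal disjunction property (MDP), then T is ΣB-sound. (2) If T is ΣB-sound, then T has the modal existence property (MEP). Consequently, for consistent recursively enumerable extensions of PA(K4), MDP is equivalent to ΣB-soundness. -/

import Mathlib

namespace ModalArith

/-- Terms of the language of arithmetic L_A = {0, S, +, ×, ≤, =}. -/
inductive Term : Type
  | var : ℕ → Term
  | zero : Term
  | succ : Term → Term
  | add : Term → Term → Term
  | mul : Term → Term → Term
  deriving DecidableEq

namespace Term

/-- Free variables of a term. -/
def fv : Term → Finset ℕ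
  | var x => {x}
  | zero => ∅
  | succ t => fv t
  | add t u => fv t ∪ fv u
  | mul t u => fv t ∪ fv u

/-- Simultaneous substitution of terms for variables. -/
def substAll : Term → (ℕ → Term) → Term
  | var x, v => v x
  | zero, _ => zero
  | succ t, v => succ (substAll t v)
  | add t u, v => add (substAll t v) (substAll u v)
  | mul t u, v => mul (substAll t v) (substAll u v)

/-- Substitution of the term `s` for the variable `x`. -/
def subst (x : ℕ) (s : Term) (t : Term) : Term :=
  substAll t (Function.update Term.var x s)

/-- The numeral `n̄`. -/
def numeral : ℕ → Term
  | 0 => zero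
  | n + 1 => succ (numeral n)

/-- Value of a term in the standard model under a valuation. -/
def val : Term → (ℕ → ℕ) → ℕ
  | var x, v => v x
  | zero, _ => 0
  | succ t, v => val t v + 1
  | add t u, v => val t v + val u v
  | mul t u, v => val t v * val u v

/-- A Gödel numbering of terms. -/
def code : Term → ℕ
  | var x => Nat.pair 0 x
  | zero => Nat.pair 1 0
  | succ t => Nat.pair 2 (code t)
  | add t u => Nat.pair 3 (Nat.pair (code t) (code u))
  | mul t u => Nat.pair 4 (Nat.pair (code t) (code u))

end Term

/-- Formulas of the language L_□ of modal arithmetic. -/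
inductive Formula : Type
  | falsum : Formula
  | eq : Term → Term → Formula
  | le : Term → Term → Formula
  | and : Formula → Formula → Formula
  | or : Formula → Formula → Formula
  | imp : Formula → Formula → Formula
  | neg : Formula → Formula
  | all : ℕ → Formula → Formula
  | ex : ℕ → Formula → Formula
  | box : Formula → Formula
  deriving DecidableEq

namespace Formula

/-- Free variables of a formula. -/
def fv : Formula → Finset ℕ
  | falsum => ∅
  | eq t u => t.fv ∪ u.fv
  | le t u => t.fv ∪ u.fv
  | and φ ψ => fv φ ∪ fv ψ
  | or φ ψ => fv φ ∪ fv ψ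
  | imp φ ψ => fv φ ∪ fv ψ
  | neg φ => fv φ
  | all x φ => (fv φ).erase x
  | ex x φ => (fv φ).erase x
  | box φ => fv φ

/-- Simultaneous substitution of terms for the free variables of a formula. -/
def substAll : Formula → (ℕ → Term) → Formula
  | falsum, _ => falsum
  | eq t u, v => eq (t.substAll v) (u.substAll v)
  | le t u, v => le (t.substAll v) (u.substAll v)
  | and φ ψ, v => and (substAll φ v) (substAll ψ v)
  | or φ ψ, v => or (substAll φ v) (substAll ψ v)
  | imp φ ψ, v => imp (substAll φ v) (substAll ψ v)
  | neg φ, v => neg (substAll φ v)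
  | all x φ, v => all x (substAll φ (Function.update v x (Term.var x)))
  | ex x φ, v => ex x (substAll φ (Function.update v x (Term.var x)))
  | box φ, v => box (substAll φ v)

/-- Substitution of the term `s` for the free occurrences of the variable `x`. -/
def subst (x : ℕ) (s : Term) (φ : Formula) : Formula :=
  substAll φ (Function.update Term.var x s)

/-- The term `s` is substitutable (free) for the variable `x` in the formula. -/
def freeFor (s : Term) (x : ℕ) : Formula → Prop
  | falsum => True
  | eq _ _ => True
  | le _ _ => True
  | and φ ψ => freeFor s x φ ∧ freeFor s x ψ
  | or φ ψ => freeFor s x φ ∧ freeFor s x ψ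
  | imp φ ψ => freeFor s x φ ∧ freeFor s x ψ
  | neg φ => freeFor s x φ
  | all y φ => x = y ∨ x ∉ fv φ ∨ (y ∉ s.fv ∧ freeFor s x φ)
  | ex y φ => x = y ∨ x ∉ fv φ ∨ (y ∉ s.fv ∧ freeFor s x φ)
  | box φ => freeFor s x φ

/-- The formula is an L_A-formula (contains no □). -/
def noBox : Formula → Prop
  | falsum => True
  | eq _ _ => True
  | le _ _ => True
  | and φ ψ => noBox φ ∧ noBox ψ
  | or φ ψ => noBox φ ∧ noBox ψ
  | imp φ ψ => noBox φ ∧ noBox ψ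
  | neg φ => noBox φ
  | all _ φ => noBox φ
  | ex _ φ => noBox φ
  | box _ => False

/-- Truth in the standard model ℕ under a valuation (meaningful for L_A-formulas;
boxed formulas are given the dummy value `False`). -/
def val : Formula → (ℕ → ℕ) → Prop
  | falsum, _ => False
  | eq t u, v => t.val v = u.val v
  | le t u, v => t.val v ≤ u.val v
  | and φ ψ, v => val φ v ∧ val ψ v
  | or φ ψ, v => val φ v ∨ val ψ v
  | imp φ ψ, v => val φ v → val ψ v
  | neg φ, v => ¬ val φ v
  | all x φ, v => ∀ n : ℕ, val φ (Function.update v x n)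
  | ex x φ, v => ∃ n : ℕ, val φ (Function.update v x n)
  | box _, _ => False

/-- Biconditional, as an abbreviation. -/
def iff (φ ψ : Formula) : Formula := (φ.imp ψ).and (ψ.imp φ)

/-- `t < u` abbreviates `S t ≤ u`. -/
def lt (t u : Term) : Formula := le (Term.succ t) u

/-- Bounded universal quantification `∀ x < t, φ`. -/
def ball (x : ℕ) (t : Term) (φ : Formula) : Formula :=
  all x ((lt (Term.var x) t).imp φ)

/-- Bounded existential quantification `∃ x < t, φ`. -/
def bex (x : ℕ) (t : Term) (φ : Formula) : Formula :=
  ex x ((lt (Term.var x) t).and φ)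

/-- A Gödel numbering of formulas. -/
def code : Formula → ℕ
  | falsum => Nat.pair 0 0
  | eq t u => Nat.pair 1 (Nat.pair t.code u.code)
  | le t u => Nat.pair 2 (Nat.pair t.code u.code)
  | and φ ψ => Nat.pair 3 (Nat.pair (code φ) (code ψ))
  | or φ ψ => Nat.pair 4 (Nat.pair (code φ) (code ψ))
  | imp φ ψ => Nat.pair 5 (Nat.pair (code φ) (code ψ))
  | neg φ => Nat.pair 6 (code φ)
  | all x φ => Nat.pair 7 (Nat.pair x (code φ))
  | ex x φ => Nat.pair 8 (Nat.pair x (code φ))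
  | box φ => Nat.pair 9 (code φ)

end Formula

/-- A sentence is a formula with no free variables. -/
def Sentence (φ : Formula) : Prop := φ.fv = ∅

/-- Truth in the standard model ℕ (for sentences; any fixed valuation will do). -/
def StdTrue (φ : Formula) : Prop := φ.val fun _ => 0

/-- The logical axioms of classical first-order logic with equality for L_□,
with the identity axioms only for atomic formulas. -/
inductive LogicalAxiom : Formula → Prop
  | imp1 (φ ψ : Formula) : LogicalAxiom (φ.imp (ψ.imp φ))
  | imp2 (φ ψ χ : Formula) :
      LogicalAxiom ((φ.imp (ψ.imp χ)).imp ((φ.imp ψ).imp (φ.imp χ)))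
  | dne (φ : Formula) : LogicalAxiom (φ.neg.neg.imp φ)
  | negI (φ ψ : Formula) : LogicalAxiom ((φ.imp ψ).imp ((φ.imp ψ.neg).imp φ.neg))
  | negE (φ ψ : Formula) : LogicalAxiom (φ.neg.imp (φ.imp ψ))
  | falsumE (φ : Formula) : LogicalAxiom (Formula.falsum.imp φ)
  | negIntro (φ : Formula) : LogicalAxiom ((φ.imp Formula.falsum).imp φ.neg)
  | negElimFalsum (φ : Formula) : LogicalAxiom (φ.neg.imp (φ.imp Formula.falsum))
  | andI (φ ψ : Formula) : LogicalAxiom (φ.imp (ψ.imp (φ.and ψ)))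
  | andE1 (φ ψ : Formula) : LogicalAxiom ((φ.and ψ).imp φ)
  | andE2 (φ ψ : Formula) : LogicalAxiom ((φ.and ψ).imp ψ)
  | orI1 (φ ψ : Formula) : LogicalAxiom (φ.imp (φ.or ψ))
  | orI2 (φ ψ : Formula) : LogicalAxiom (ψ.imp (φ.or ψ))
  | orE (φ ψ χ : Formula) :
      LogicalAxiom ((φ.imp χ).imp ((ψ.imp χ).imp ((φ.or ψ).imp χ)))
  | allE (x : ℕ) (t : Term) (φ : Formula) :
      φ.freeFor t x → LogicalAxiom ((Formula.all x φ).imp (φ.subst x t))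
  | allImp (x : ℕ) (φ ψ : Formula) :
      x ∉ φ.fv → LogicalAxiom ((Formula.all x (φ.imp ψ)).imp (φ.imp (Formula.all x ψ)))
  | exI (x : ℕ) (t : Term) (φ : Formula) :
      φ.freeFor t x → LogicalAxiom ((φ.subst x t).imp (Formula.ex x φ))
  | exE (x : ℕ) (φ ψ : Formula) :
      x ∉ ψ.fv → LogicalAxiom ((Formula.all x (φ.imp ψ)).imp ((Formula.ex x φ).imp ψ))
  | eqRefl (t : Term) : LogicalAxiom (Formula.eq t t)
  | eqSymm (t u : Term) : LogicalAxiom ((Formula.eq t u).imp (Formula.eq u t))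
  | eqTrans (t u w : Term) :
      LogicalAxiom ((Formula.eq t u).imp ((Formula.eq u w).imp (Formula.eq t w)))
  | eqSucc (t u : Term) :
      LogicalAxiom ((Formula.eq t u).imp (Formula.eq t.succ u.succ))
  | eqAdd (t₁ t₂ u₁ u₂ : Term) :
      LogicalAxiom ((Formula.eq t₁ t₂).imp ((Formula.eq u₁ u₂).imp
        (Formula.eq (t₁.add u₁) (t₂.add u₂))))
  | eqMul (t₁ t₂ u₁ u₂ : Term) :
      LogicalAxiom ((Formula.eq t₁ t₂).imp ((Formula.eq u₁ u₂).imp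
        (Formula.eq (t₁.mul u₁) (t₂.mul u₂))))
  | eqLe (t₁ t₂ u₁ u₂ : Term) :
      LogicalAxiom ((Formula.eq t₁ t₂).imp ((Formula.eq u₁ u₂).imp
        ((Formula.le t₁ u₁).imp (Formula.le t₂ u₂))))

/-- Provability in an L_□-theory: logical axioms, the axioms of the theory, and the
rules modus ponens, generalization, and necessitation. -/
inductive Provable (T : Set Formula) : Formula → Prop
  | ax {φ : Formula} : φ ∈ T → Provable T φ
  | logic {φ : Formula} : LogicalAxiom φ → Provable T φ
  | mp {φ ψ : Formula} : Provable T (φ.imp ψ) → Provable T φ → Provable T ψ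
  | gen {φ : Formula} (x : ℕ) : Provable T φ → Provable T (Formula.all x φ)
  | nec {φ : Formula} : Provable T φ → Provable T (Formula.box φ)

/-- First-order provability (no necessitation rule); used for the non-modal theory PA. -/
inductive FOProvable (T : Set Formula) : Formula → Prop
  | ax {φ : Formula} : φ ∈ T → FOProvable T φ
  | logic {φ : Formula} : LogicalAxiom φ → FOProvable T φ
  | mp {φ ψ : Formula} : FOProvable T (φ.imp ψ) → FOProvable T φ → FOProvable T ψ
  | gen {φ : Formula} (x : ℕ) : FOProvable T φ → FOProvable T (Formula.all x φ)

/-- Basic (Robinson-style) axioms of arithmetic. -/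
def succNeZero : Formula := (Formula.eq (Term.succ (Term.var 0)) Term.zero).neg
def succInj : Formula :=
  (Formula.eq (Term.succ (Term.var 0)) (Term.succ (Term.var 1))).imp
    (Formula.eq (Term.var 0) (Term.var 1))
def addZero : Formula := Formula.eq (Term.add (Term.var 0) Term.zero) (Term.var 0)
def addSucc : Formula :=
  Formula.eq (Term.add (Term.var 0) (Term.succ (Term.var 1)))
    (Term.succ (Term.add (Term.var 0) (Term.var 1)))
def mulZero : Formula := Formula.eq (Term.mul (Term.var 0) Term.zero) Term.zero
def mulSucc : Formula :=
  Formula.eq (Term.mul (Term.var 0) (Term.succ (Term.var 1)))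
    (Term.add (Term.mul (Term.var 0) (Term.var 1)) (Term.var 0))
def leDef : Formula :=
  (Formula.le (Term.var 0) (Term.var 1)).iff
    (Formula.ex 2 (Formula.eq (Term.add (Term.var 0) (Term.var 2)) (Term.var 1)))

def baseAxioms : Set Formula :=
  {succNeZero, succInj, addZero, addSucc, mulZero, mulSucc, leDef}

/-- The induction axiom for the formula `φ` and the variable `x`. -/
def inductionAx (x : ℕ) (φ : Formula) : Formula :=
  ((φ.subst x Term.zero).and
    (Formula.all x (φ.imp (φ.subst x (Term.succ (Term.var x)))))).imp
      (Formula.all x φ)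

/-- Peano arithmetic PA: basic axioms plus induction for L_A-formulas. -/
def PA : Set Formula :=
  baseAxioms ∪ {χ | ∃ (x : ℕ) (φ : Formula), φ.noBox ∧ χ = inductionAx x φ}

/-- PA_□ : basic axioms plus induction for all L_□-formulas. -/
def PABox : Set Formula :=
  baseAxioms ∪ {χ | ∃ (x : ℕ) (φ : Formula), χ = inductionAx x φ}

/-- The distribution axiom K. -/
def axK (φ ψ : Formula) : Formula :=
  (Formula.box (φ.imp ψ)).imp ((Formula.box φ).imp (Formula.box ψ))

/-- PA(K). -/
def PAK : Set Formula := PABox ∪ {χ | ∃ φ ψ : Formula, χ = axK φ ψ}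

/-- The axiom 4. -/
def ax4 (φ : Formula) : Formula := (Formula.box φ).imp (Formula.box (Formula.box φ))

/-- PA(K4). -/
def PAK4 : Set Formula := PAK ∪ {χ | ∃ φ : Formula, χ = ax4 φ}

/-- The axiom of Triv. -/
def axTriv (φ : Formula) : Formula := (Formula.box φ).iff φ

/-- PA(Triv). -/
def PATriv : Set Formula := PAK ∪ {χ | ∃ φ : Formula, χ = axTriv φ}

/-- PA(Ver). -/
def PAVer : Set Formula := PAK ∪ {Formula.box Formula.falsum}

/-- `T` extends `U`: every axiom of `U` is provable in `T`. -/
def Extends (T U : Set Formula) : Prop := ∀ φ ∈ U, Provable T φ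

/-- Consistency. -/
def Consistent (T : Set Formula) : Prop := ¬ Provable T Formula.falsum

/-- The class Δ₀ of bounded L_A-formulas. -/
inductive IsDelta0 : Formula → Prop
  | falsum : IsDelta0 Formula.falsum
  | eq (t u : Term) : IsDelta0 (Formula.eq t u)
  | le (t u : Term) : IsDelta0 (Formula.le t u)
  | and {φ ψ : Formula} : IsDelta0 φ → IsDelta0 ψ → IsDelta0 (φ.and ψ)
  | or {φ ψ : Formula} : IsDelta0 φ → IsDelta0 ψ → IsDelta0 (φ.or ψ)
  | imp {φ ψ : Formula} : IsDelta0 φ → IsDelta0 ψ → IsDelta0 (φ.imp ψ)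
  | neg {φ : Formula} : IsDelta0 φ → IsDelta0 φ.neg
  | ball {x : ℕ} {t : Term} {φ : Formula} :
      x ∉ t.fv → IsDelta0 φ → IsDelta0 (Formula.ball x t φ)
  | bex {x : ℕ} {t : Term} {φ : Formula} :
      x ∉ t.fv → IsDelta0 φ → IsDelta0 (Formula.bex x t φ)

/-- The class Σ₁ of L_A-formulas. -/
inductive IsSigma1 : Formula → Prop
  | delta0 {φ : Formula} : IsDelta0 φ → IsSigma1 φ
  | and {φ ψ : Formula} : IsSigma1 φ → IsSigma1 ψ → IsSigma1 (φ.and ψ)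
  | or {φ ψ : Formula} : IsSigma1 φ → IsSigma1 ψ → IsSigma1 (φ.or ψ)
  | ex {x : ℕ} {φ : Formula} : IsSigma1 φ → IsSigma1 (Formula.ex x φ)
  | ball {x : ℕ} {t : Term} {φ : Formula} :
      x ∉ t.fv → IsSigma1 φ → IsSigma1 (Formula.ball x t φ)

/-- The class B of boxed formulas. -/
def IsB (φ : Formula) : Prop := ∃ ψ : Formula, φ = Formula.box ψ

/-- The class ΔB. -/
inductive IsDeltaB : Formula → Prop
  | delta0 {φ : Formula} : IsDelta0 φ → IsDeltaB φ
  | b (ψ : Formula) : IsDeltaB (Formula.box ψ)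
  | and {φ ψ : Formula} : IsDeltaB φ → IsDeltaB ψ → IsDeltaB (φ.and ψ)
  | or {φ ψ : Formula} : IsDeltaB φ → IsDeltaB ψ → IsDeltaB (φ.or ψ)
  | ball {x : ℕ} {t : Term} {φ : Formula} :
      x ∉ t.fv → IsDeltaB φ → IsDeltaB (Formula.ball x t φ)
  | bex {x : ℕ} {t : Term} {φ : Formula} :
      x ∉ t.fv → IsDeltaB φ → IsDeltaB (Formula.bex x t φ)

/-- The class ΣB. -/
inductive IsSigmaB : Formula → Prop
  | sigma1 {φ : Formula} : IsSigma1 φ → IsSigmaB φ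
  | b (ψ : Formula) : IsSigmaB (Formula.box ψ)
  | and {φ ψ : Formula} : IsSigmaB φ → IsSigmaB ψ → IsSigmaB (φ.and ψ)
  | or {φ ψ : Formula} : IsSigmaB φ → IsSigmaB ψ → IsSigmaB (φ.or ψ)
  | ex {x : ℕ} {φ : Formula} : IsSigmaB φ → IsSigmaB (Formula.ex x φ)
  | ball {x : ℕ} {t : Term} {φ : Formula} :
      x ∉ t.fv → IsSigmaB φ → IsSigmaB (Formula.ball x t φ)

/-- Iterated disjunction (the empty disjunction is ⊥). -/
def disj : List Formula → Formula
  | [] => Formula.falsum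
  | [φ] => φ
  | φ :: ψ :: l => φ.or (disj (ψ :: l))

/-- Iterated conjunction (the empty conjunction is ⊤). -/
def conj : List Formula → Formula
  | [] => Formula.falsum.neg
  | [φ] => φ
  | φ :: ψ :: l => φ.and (conj (ψ :: l))

/-- Γ-disjunction property. -/
def HasDP (T : Set Formula) (Γ : Formula → Prop) : Prop :=
  ∀ φ ψ : Formula, Γ φ → Γ ψ → Sentence φ → Sentence ψ →
    Provable T (φ.or ψ) → Provable T φ ∨ Provable T ψ

/-- (Γ, Θ)-disjunction property. -/
def HasDP2 (T : Set Formula) (Γ Θ : Formula → Prop) : Prop :=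
  ∀ φ ψ : Formula, Γ φ → Θ ψ → Sentence φ → Sentence ψ →
    Provable T (φ.or ψ) → Provable T φ ∨ Provable T ψ

/-- Γ-existence property. -/
def HasEP (T : Set Formula) (Γ : Formula → Prop) : Prop :=
  ∀ (x : ℕ) (φ : Formula), Γ φ → φ.fv ⊆ {x} →
    Provable T (Formula.ex x φ) → ∃ n : ℕ, Provable T (φ.subst x (Term.numeral n))

/-- Modal disjunction property. -/
def HasMDP (T : Set Formula) : Prop :=
  ∀ φ ψ : Formula, Sentence φ → Sentence ψ →
    Provable T ((Formula.box φ).or (Formula.box ψ)) → Provable T φ ∨ Provable T ψ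

/-- Modal existence property. -/
def HasMEP (T : Set Formula) : Prop :=
  ∀ (x : ℕ) (φ : Formula), φ.fv ⊆ {x} →
    Provable T (Formula.ex x (Formula.box φ)) →
      ∃ n : ℕ, Provable T (φ.subst x (Term.numeral n))

/-- n-fold B-disjunction property. -/
def HasBnDP (T : Set Formula) (n : ℕ) : Prop :=
  ∀ φ : Fin n → Formula, (∀ i, Sentence (φ i)) →
    Provable T (disj (List.ofFn fun i => Formula.box (φ i))) →
    ∃ i, Provable T (Formula.box (φ i))

/-- Σ₁-soundness. -/
def Sigma1Sound (T : Set Formula) : Prop :=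
  ∀ φ : Formula, IsSigma1 φ → Sentence φ → Provable T φ → StdTrue φ

/-- L_A-soundness. -/
def LASound (T : Set Formula) : Prop :=
  ∀ φ : Formula, φ.noBox → Sentence φ → Provable T φ → StdTrue φ

/-- `T` is recursively enumerable (via the Gödel numbering of formulas). -/
def RE (T : Set Formula) : Prop :=
  Nat.Partrec fun n => Part.assert (∃ φ ∈ T, Formula.code φ = n) fun _ => Part.some 0

/-- A fixed natural Σ₁ provability predicate `Pr_T(x)` for the theory `T`:
a Σ₁ L_A-formula with only the free variable `0` which numerates provability in `T`
in the standard model and satisfies the standard derivability conditions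
(provably in PA). -/
structure ProvPred (T : Set Formula) where
  pr : Formula
  noBox : pr.noBox
  sigma1 : IsSigma1 pr
  fvSub : pr.fv ⊆ {0}
  numerates : ∀ φ : Formula,
    StdTrue (pr.subst 0 (Term.numeral φ.code)) ↔ Provable T φ
  d1 : ∀ φ : Formula, Provable T φ → FOProvable PA (pr.subst 0 (Term.numeral φ.code))
  d2 : ∀ φ ψ : Formula,
    FOProvable PA ((pr.subst 0 (Term.numeral (φ.imp ψ).code)).imp
      ((pr.subst 0 (Term.numeral φ.code)).imp (pr.subst 0 (Term.numeral ψ.code))))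
  necClosed : ∀ φ : Formula,
    FOProvable PA ((pr.subst 0 (Term.numeral φ.code)).imp
      (pr.subst 0 (Term.numeral (Formula.box φ).code)))

/-- `Pr_T(⌜φ⌝)`. -/
def ProvPred.app {T : Set Formula} (P : ProvPred T) (φ : Formula) : Formula :=
  P.pr.subst 0 (Term.numeral φ.code)

/-- Γ-disjunctive correctness (Γ-DC). -/
def DC (T : Set Formula) (P : ProvPred T) (Γ : Formula → Prop) : Prop :=
  ∀ φ : Formula, Γ φ → Sentence φ → Provable T (φ.or (P.app φ)) → Provable T φ

/-- The substitution replacing each variable by the numeral of its value. -/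
def numeralSubst (v : ℕ → ℕ) : ℕ → Term := fun x => Term.numeral (v x)

/-- Standard-model satisfaction of the ρ_T-translation: `ρ_T` is the identity on
L_A-formulas, commutes with connectives and quantifiers, and sends `□φ(x⃗)` to
`Pr_T(⌜□φ(ẋ⃗)⌝)`, whose truth in ℕ (for a natural provability predicate) amounts to
provability in `T` of `□φ(n̄⃗)`. -/
def RhoSat (T : Set Formula) : Formula → (ℕ → ℕ) → Prop
  | .falsum, _ => False
  | .eq t u, v => t.val v = u.val v
  | .le t u, v => t.val v ≤ u.val v
  | .and φ ψ, v => RhoSat T φ v ∧ RhoSat T ψ v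
  | .or φ ψ, v => RhoSat T φ v ∨ RhoSat T ψ v
  | .imp φ ψ, v => RhoSat T φ v → RhoSat T ψ v
  | .neg φ, v => ¬ RhoSat T φ v
  | .all x φ, v => ∀ n : ℕ, RhoSat T φ (Function.update v x n)
  | .ex x φ, v => ∃ n : ℕ, RhoSat T φ (Function.update v x n)
  | .box φ, v => Provable T (Formula.box (φ.substAll (numeralSubst v)))

/-- Standard-model satisfaction of the π_T-translation: `π_T` is the identity on
L_A-formulas, commutes with connectives and quantifiers, and sends `□φ(x⃗)` to
`Pr_T(⌜φ(ẋ⃗)⌝)`, whose truth in ℕ (for a natural provability predicate) amounts to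
provability in `T` of `φ(n̄⃗)`. -/
def PiSat (T : Set Formula) : Formula → (ℕ → ℕ) → Prop
  | .falsum, _ => False
  | .eq t u, v => t.val v = u.val v
  | .le t u, v => t.val v ≤ u.val v
  | .and φ ψ, v => PiSat T φ v ∧ PiSat T ψ v
  | .or φ ψ, v => PiSat T φ v ∨ PiSat T ψ v
  | .imp φ ψ, v => PiSat T φ v → PiSat T ψ v
  | .neg φ, v => ¬ PiSat T φ v
  | .all x φ, v => ∀ n : ℕ, PiSat T φ (Function.update v x n)
  | .ex x φ, v => ∃ n : ℕ, PiSat T φ (Function.update v x n)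
  | .box φ, v => Provable T (φ.substAll (numeralSubst v))

/-- Weak ΣB-soundness: every provable ΣB sentence is true in ℕ under ρ_T. -/
def WeaklySigmaBSound (T : Set Formula) : Prop :=
  ∀ φ : Formula, IsSigmaB φ → Sentence φ → Provable T φ → RhoSat T φ fun _ => 0

/-- ΣB-soundness: every provable ΣB sentence is true in ℕ under π_T. -/
def SigmaBSound (T : Set Formula) : Prop :=
  ∀ φ : Formula, IsSigmaB φ → Sentence φ → Provable T φ → PiSat T φ fun _ => 0

end ModalArith

namespace ModalArith

open Function

/-! ### Syntactic lemmas -/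

namespace Term

theorem substAll_congr {t : Term} {σ τ : ℕ → Term} (h : ∀ x ∈ t.fv, σ x = τ x) :
    t.substAll σ = t.substAll τ := by
  induction t with
  | var x => exact h x (by simp [fv])
  | zero => rfl
  | succ t ih => simp only [substAll]; rw [ih h]
  | add t u iht ihu =>
    simp only [substAll]
    rw [iht fun x hx => h x (by simp [fv, hx]), ihu fun x hx => h x (by simp [fv, hx])]
  | mul t u iht ihu =>
    simp only [substAll]
    rw [iht fun x hx => h x (by simp [fv, hx]), ihu fun x hx => h x (by simp [fv, hx])]

@[simp] theorem substAll_var (t : Term) : t.substAll var = t := by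
  induction t <;> simp_all [substAll]

theorem substAll_id {t : Term} {σ : ℕ → Term} (h : ∀ x ∈ t.fv, σ x = var x) :
    t.substAll σ = t := by
  rw [substAll_congr h, substAll_var]

theorem substAll_comp (t : Term) (σ τ : ℕ → Term) :
    (t.substAll σ).substAll τ = t.substAll fun x => (σ x).substAll τ := by
  induction t <;> simp_all [substAll]

theorem val_congr {t : Term} {v w : ℕ → ℕ} (h : ∀ x ∈ t.fv, v x = w x) :
    t.val v = t.val w := by
  induction t with
  | var x => exact h x (by simp [fv])
  | zero => rfl
  | succ t ih => simp only [val]; rw [ih h]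
  | add t u iht ihu =>
    simp only [val]
    rw [iht fun x hx => h x (by simp [fv, hx]), ihu fun x hx => h x (by simp [fv, hx])]
  | mul t u iht ihu =>
    simp only [val]
    rw [iht fun x hx => h x (by simp [fv, hx]), ihu fun x hx => h x (by simp [fv, hx])]

theorem val_substAll (t : Term) (σ : ℕ → Term) (v : ℕ → ℕ) :
    (t.substAll σ).val v = t.val fun x => (σ x).val v := by
  induction t <;> simp_all [substAll, val]

@[simp] theorem fv_numeral (n : ℕ) : (numeral n).fv = ∅ := by
  induction n <;> simp_all [numeral, fv]

@[simp] theorem substAll_numeral (n : ℕ) (σ : ℕ → Term) :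
    (numeral n).substAll σ = numeral n := substAll_id (by simp)

@[simp] theorem val_numeral (n : ℕ) (v : ℕ → ℕ) : (numeral n).val v = n := by
  induction n <;> simp_all [numeral, val]

theorem mem_fv_substAll {t : Term} {σ : ℕ → Term} {y : ℕ} :
    y ∈ (t.substAll σ).fv ↔ ∃ x ∈ t.fv, y ∈ (σ x).fv := by
  induction t with
  | var x => simp [substAll, fv]
  | zero => simp [substAll, fv]
  | succ t ih => simpa [substAll, fv] using ih
  | add t u iht ihu =>
    simp only [substAll, fv, Finset.mem_union, iht, ihu]
    constructor
    · rintro (⟨x, h, h'⟩ | ⟨x, h, h'⟩)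
      exacts [⟨x, .inl h, h'⟩, ⟨x, .inr h, h'⟩]
    · rintro ⟨x, h | h, h'⟩
      exacts [.inl ⟨x, h, h'⟩, .inr ⟨x, h, h'⟩]
  | mul t u iht ihu =>
    simp only [substAll, fv, Finset.mem_union, iht, ihu]
    constructor
    · rintro (⟨x, h, h'⟩ | ⟨x, h, h'⟩)
      exacts [⟨x, .inl h, h'⟩, ⟨x, .inr h, h'⟩]
    · rintro ⟨x, h | h, h'⟩
      exacts [.inl ⟨x, h, h'⟩, .inr ⟨x, h, h'⟩]

theorem code_inj : ∀ {t u : Term}, t.code = u.code → t = u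
  | var _, u, h => by cases u <;> simp_all [code, Nat.pair_eq_pair]
  | zero, u, h => by cases u <;> simp_all [code, Nat.pair_eq_pair]
  | succ t, u, h => by
    cases u <;> simp only [code, Nat.pair_eq_pair] at h <;> try omega
    rw [code_inj h.2]
  | add t u, w, h => by
    cases w <;> simp only [code, Nat.pair_eq_pair] at h <;> try omega
    rw [code_inj h.2.1, code_inj h.2.2]
  | mul t u, w, h => by
    cases w <;> simp only [code, Nat.pair_eq_pair] at h <;> try omega
    rw [code_inj h.2.1, code_inj h.2.2]

end Term

/-- A substitution is safe if no variable can be captured. -/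
def Safe (σ : ℕ → Term) : Prop := ∀ x, (σ x).fv ⊆ {x}

theorem safe_var : Safe Term.var := fun x => by simp [Term.fv]

theorem safe_numeralSubst (v : ℕ → ℕ) : Safe (numeralSubst v) := fun x => by
  simp [numeralSubst]

theorem Safe.update {σ : ℕ → Term} (h : Safe σ) (x : ℕ) : Safe (update σ x (Term.var x)) := by
  intro y
  by_cases hy : y = x
  · subst hy; simp [Term.fv]
  · simpa [hy] using h y

theorem Safe.update_closed {σ : ℕ → Term} (h : Safe σ) (x n : ℕ) :
    Safe (Function.update σ x (Term.numeral n)) := by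
  intro y
  by_cases hy : y = x
  · subst hy; simp
  · simpa [hy] using h y

namespace Formula

theorem substAll_congr {φ : Formula} : ∀ {σ τ : ℕ → Term}, (∀ x ∈ φ.fv, σ x = τ x) →
    φ.substAll σ = φ.substAll τ := by
  induction φ with
  | falsum => intros; rfl
  | eq t u =>
    intro σ τ h
    simp only [substAll]
    rw [Term.substAll_congr fun x hx => h x (by simp [fv, hx]),
      Term.substAll_congr fun x hx => h x (by simp [fv, hx])]
  | le t u =>
    intro σ τ h
    simp only [substAll]
    rw [Term.substAll_congr fun x hx => h x (by simp [fv, hx]),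
      Term.substAll_congr fun x hx => h x (by simp [fv, hx])]
  | and φ ψ ih1 ih2 | or φ ψ ih1 ih2 | imp φ ψ ih1 ih2 =>
    intro σ τ h
    simp only [substAll]
    rw [ih1 fun x hx => h x (by simp [fv, hx]), ih2 fun x hx => h x (by simp [fv, hx])]
  | neg φ ih | box φ ih => intro σ τ h; simp only [substAll]; rw [ih h]
  | all y φ ih | ex y φ ih =>
    intro σ τ h
    simp only [substAll]
    rw [ih]
    intro x hx
    by_cases hxy : x = y
    · subst hxy; simp
    · simpa [hxy] using h x (by simp [fv, hx, hxy])

@[simp] theorem substAll_var (φ : Formula) : φ.substAll Term.var = φ := by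
  induction φ <;> simp_all [substAll]

theorem substAll_id {φ : Formula} {σ : ℕ → Term} (h : ∀ x ∈ φ.fv, σ x = Term.var x) :
    φ.substAll σ = φ := by
  rw [substAll_congr h, substAll_var]

theorem subst_of_not_mem {φ : Formula} {x : ℕ} {s : Term} (h : x ∉ φ.fv) :
    φ.subst x s = φ := by
  apply substAll_id
  intro y hy
  rw [Function.update_of_ne]
  rintro rfl
  exact h hy

@[simp] theorem subst_self (φ : Formula) (x : ℕ) : φ.subst x (Term.var x) = φ := by
  simp [subst]

theorem subst_all_self (x : ℕ) (s : Term) (φ : Formula) :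
    (all x φ).subst x s = all x φ := subst_of_not_mem (by simp [fv])

theorem subst_ex_self (x : ℕ) (s : Term) (φ : Formula) :
    (ex x φ).subst x s = ex x φ := subst_of_not_mem (by simp [fv])

theorem update_swap {x y : ℕ} (h : y ≠ x) (s : Term) :
    update (update Term.var x s) y (Term.var y) = update Term.var x s := by
  funext z
  by_cases hz : z = y
  · subst hz; simp [h]
  · simp [hz]

theorem subst_all_ne {x y : ℕ} (h : y ≠ x) (s : Term) (φ : Formula) :
    (all y φ).subst x s = all y (φ.subst x s) := by
  simp only [subst, substAll, update_swap h]

theorem subst_ex_ne {x y : ℕ} (h : y ≠ x) (s : Term) (φ : Formula) :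
    (ex y φ).subst x s = ex y (φ.subst x s) := by
  simp only [subst, substAll, update_swap h]

theorem substAll_comp {φ : Formula} : ∀ {σ : ℕ → Term} (τ : ℕ → Term), Safe σ →
    (φ.substAll σ).substAll τ = φ.substAll fun x => (σ x).substAll τ := by
  have key : ∀ {σ : ℕ → Term} (τ : ℕ → Term) (y : ℕ), Safe σ →
      (fun x => (update σ y (Term.var y) x).substAll (update τ y (Term.var y))) =
      update (fun x => (σ x).substAll τ) y (Term.var y) := by
    intro σ τ y hσ
    funext x
    by_cases hx : x = y
    · subst hx; simp [Term.substAll]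
    · simp only [ne_eq, hx, not_false_eq_true, Function.update_of_ne]
      apply Term.substAll_congr
      intro z hz
      have := hσ x hz
      simp only [Finset.mem_singleton] at this
      subst this
      simp [hx]
  induction φ with
  | falsum => intros; rfl
  | eq t u => intros; simp [substAll, Term.substAll_comp]
  | le t u => intros; simp [substAll, Term.substAll_comp]
  | and φ ψ ih1 ih2 | or φ ψ ih1 ih2 | imp φ ψ ih1 ih2 =>
    intro σ τ h; simp only [substAll]; rw [ih1 τ h, ih2 τ h]
  | neg φ ih | box φ ih => intro σ τ h; simp only [substAll]; rw [ih τ h]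
  | all y φ ih | ex y φ ih =>
    intro σ τ h
    simp only [substAll]
    rw [ih _ (h.update y), key τ y h]

theorem substAll_numeral_update {φ : Formula} (v : ℕ → ℕ) (x n : ℕ) :
    (φ.substAll (update (numeralSubst v) x (Term.var x))).subst x (Term.numeral n) =
      φ.substAll (numeralSubst (update v x n)) := by
  rw [subst, substAll_comp _ ((safe_numeralSubst v).update x)]
  congr 1
  funext y
  by_cases hy : y = x
  · subst hy; simp [Term.substAll, numeralSubst]
  · simp [hy, numeralSubst]

theorem fv_substAll {φ : Formula} : ∀ {σ : ℕ → Term} {y : ℕ}, Safe σ →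
    (y ∈ (φ.substAll σ).fv ↔ y ∈ φ.fv ∧ y ∈ (σ y).fv) := by
  have term : ∀ {t : Term} {σ : ℕ → Term} {y : ℕ}, Safe σ →
      (y ∈ (t.substAll σ).fv ↔ y ∈ t.fv ∧ y ∈ (σ y).fv) := by
    intro t σ y h
    rw [Term.mem_fv_substAll]
    constructor
    · rintro ⟨x, hx, hy⟩
      have := h x hy
      simp only [Finset.mem_singleton] at this
      subst this
      exact ⟨hx, hy⟩
    · rintro ⟨hx, hy⟩; exact ⟨y, hx, hy⟩
  induction φ with
  | falsum => intros; simp [substAll, fv]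
  | eq t u => intro σ y h; simp only [substAll, fv, Finset.mem_union, term h]; tauto
  | le t u => intro σ y h; simp only [substAll, fv, Finset.mem_union, term h]; tauto
  | and φ ψ ih1 ih2 | or φ ψ ih1 ih2 | imp φ ψ ih1 ih2 =>
    intro σ y h; simp only [substAll, fv, Finset.mem_union, ih1 h, ih2 h]; tauto
  | neg φ ih | box φ ih => intro σ y h; simp only [substAll, fv, ih h]
  | all z φ ih | ex z φ ih =>
    intro σ y h
    simp only [substAll, fv, Finset.mem_erase, ih (h.update z)]
    by_cases hy : y = z
    · simp [hy]
    · simp [hy]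

theorem sentence_numeralSubst (φ : Formula) (v : ℕ → ℕ) :
    Sentence (φ.substAll (numeralSubst v)) := by
  rw [Sentence, Finset.eq_empty_iff_forall_notMem]
  intro y hy
  rw [fv_substAll (safe_numeralSubst v)] at hy
  simp [numeralSubst] at hy

theorem safe_update_var (x n : ℕ) : Safe (update Term.var x (Term.numeral n)) :=
  safe_var.update_closed x n

theorem fv_subst_numeral (φ : Formula) (x n : ℕ) :
    (φ.subst x (Term.numeral n)).fv = φ.fv.erase x := by
  ext y
  rw [subst, fv_substAll (safe_update_var x n)]
  by_cases h : y = x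
  · subst h; simp
  · simp [h, Term.fv]

theorem val_congr {φ : Formula} : ∀ {v w : ℕ → ℕ}, (∀ x ∈ φ.fv, v x = w x) →
    (φ.val v ↔ φ.val w) := by
  have key : ∀ {φ : Formula} {v w : ℕ → ℕ} (y n : ℕ), (∀ x ∈ φ.fv.erase y, v x = w x) →
      ∀ x ∈ φ.fv, update v y n x = update w y n x := by
    intro φ v w y n h x hx
    by_cases hxy : x = y
    · subst hxy; simp
    · simpa [hxy] using h x (by simp [hx, hxy])
  induction φ with
  | falsum => intros; rfl
  | eq t u =>
    intro σ τ h
    simp only [val]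
    rw [Term.val_congr fun x hx => h x (by simp [fv, hx]),
      Term.val_congr fun x hx => h x (by simp [fv, hx])]
  | le t u =>
    intro σ τ h
    simp only [val]
    rw [Term.val_congr fun x hx => h x (by simp [fv, hx]),
      Term.val_congr fun x hx => h x (by simp [fv, hx])]
  | and φ ψ ih1 ih2 | or φ ψ ih1 ih2 | imp φ ψ ih1 ih2 =>
    intro σ τ h
    simp only [val]
    rw [ih1 fun x hx => h x (by simp [fv, hx]), ih2 fun x hx => h x (by simp [fv, hx])]
  | neg φ ih => intro σ τ h; simp only [val]; rw [ih h]
  | box φ ih => intros; rfl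
  | all y φ ih => intro σ τ h; exact forall_congr' fun n => ih (key y n h)
  | ex y φ ih => intro σ τ h; exact exists_congr fun n => ih (key y n h)

theorem val_substAll {φ : Formula} : ∀ {σ : ℕ → Term} {v : ℕ → ℕ}, Safe σ →
    ((φ.substAll σ).val v ↔ φ.val fun x => (σ x).val v) := by
  have key : ∀ {σ : ℕ → Term} (v : ℕ → ℕ) (y n : ℕ), Safe σ →
      (fun x => (update σ y (Term.var y) x).val (update v y n)) =
      update (fun x => (σ x).val v) y n := by
    intro σ v y n hσ
    funext x
    by_cases hx : x = y
    · subst hx; simp [Term.val]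
    · simp only [ne_eq, hx, not_false_eq_true, Function.update_of_ne]
      apply Term.val_congr
      intro z hz
      have := hσ x hz
      simp only [Finset.mem_singleton] at this
      subst this
      simp [hx]
  induction φ with
  | falsum => intros; rfl
  | eq t u => intros; simp [substAll, val, Term.val_substAll]
  | le t u => intros; simp [substAll, val, Term.val_substAll]
  | and φ ψ ih1 ih2 | or φ ψ ih1 ih2 | imp φ ψ ih1 ih2 =>
    intro σ τ h; simp only [substAll, val]; rw [ih1 h, ih2 h]
  | neg φ ih => intro σ τ h; simp only [substAll, val]; rw [ih h]
  | box φ ih => intros; rfl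
  | all y φ ih =>
    intro σ v h
    simp only [substAll, val]
    exact forall_congr' fun n => by rw [ih (h.update y), key v y n h]
  | ex y φ ih =>
    intro σ v h
    simp only [substAll, val]
    exact exists_congr fun n => by rw [ih (h.update y), key v y n h]

theorem val_subst_numeral (φ : Formula) (x n : ℕ) (v : ℕ → ℕ) :
    (φ.subst x (Term.numeral n)).val v ↔ φ.val (update v x n) := by
  rw [subst, val_substAll (safe_update_var x n)]
  have : (fun y => (update Term.var x (Term.numeral n) y).val v) = update v x n := by
    funext y
    by_cases h : y = x
    · subst h; simp
    · simp [h, Term.val]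
  rw [this]

theorem freeFor_of_not_mem {s : Term} {x : ℕ} {φ : Formula} (h : x ∉ φ.fv) :
    φ.freeFor s x := by
  induction φ with
  | falsum | eq | le => trivial
  | and φ ψ ih1 ih2 | or φ ψ ih1 ih2 | imp φ ψ ih1 ih2 =>
    simp only [fv, Finset.mem_union, not_or] at h
    exact ⟨ih1 h.1, ih2 h.2⟩
  | neg φ ih | box φ ih => exact ih h
  | all y φ ih | ex y φ ih =>
    simp only [fv, Finset.mem_erase, not_and, ne_eq] at h
    simp only [freeFor]
    tauto

/-- If `s` only contains the variable `x`, it is free for `x` everywhere. -/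
theorem freeFor_of_fv {s : Term} {x : ℕ} (h : s.fv ⊆ {x}) (φ : Formula) :
    φ.freeFor s x := by
  induction φ with
  | falsum | eq | le => trivial
  | and φ ψ ih1 ih2 | or φ ψ ih1 ih2 | imp φ ψ ih1 ih2 => exact ⟨ih1, ih2⟩
  | neg φ ih | box φ ih => exact ih
  | all y φ ih | ex y φ ih =>
    simp only [freeFor]
    by_cases hy : x = y
    · exact .inl hy
    · refine .inr (.inr ⟨fun hh => hy ?_, ih⟩)
      have := h hh
      simp at this
      exact this.symm

/-- All variables of a formula, free or bound. -/
def vars : Formula → Finset ℕ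
  | falsum => ∅
  | eq t u => t.fv ∪ u.fv
  | le t u => t.fv ∪ u.fv
  | and φ ψ => vars φ ∪ vars ψ
  | or φ ψ => vars φ ∪ vars ψ
  | imp φ ψ => vars φ ∪ vars ψ
  | neg φ => vars φ
  | all x φ => insert x (vars φ)
  | ex x φ => insert x (vars φ)
  | box φ => vars φ

theorem fv_subset_vars (φ : Formula) : φ.fv ⊆ φ.vars := by
  induction φ with
  | falsum | eq | le => simp [fv, vars]
  | and φ ψ ih1 ih2 | or φ ψ ih1 ih2 | imp φ ψ ih1 ih2 =>
    exact Finset.union_subset_union ih1 ih2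
  | neg φ ih | box φ ih => exact ih
  | all y φ ih | ex y φ ih =>
    intro z hz
    simp only [fv, Finset.mem_erase] at hz
    simp [vars, ih hz.2]

theorem freeFor_var_of_not_mem_vars {x y : ℕ} {φ : Formula} (h : y ∉ φ.vars) :
    φ.freeFor (Term.var y) x := by
  induction φ with
  | falsum | eq | le => trivial
  | and φ ψ ih1 ih2 | or φ ψ ih1 ih2 | imp φ ψ ih1 ih2 =>
    simp only [vars, Finset.mem_union, not_or] at h
    exact ⟨ih1 h.1, ih2 h.2⟩
  | neg φ ih | box φ ih => exact ih h
  | all z φ ih | ex z φ ih =>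
    simp only [vars, Finset.mem_insert, not_or] at h
    refine .inr (.inr ⟨?_, ih h.2⟩)
    simp only [Term.fv, Finset.mem_singleton]
    exact fun hh => h.1 hh.symm

theorem code_inj : ∀ {φ ψ : Formula}, φ.code = ψ.code → φ = ψ
  | falsum, w, h => by cases w <;> simp_all [code, Nat.pair_eq_pair]
  | eq t u, w, h => by
    cases w <;> simp only [code, Nat.pair_eq_pair] at h <;> try omega
    rw [Term.code_inj h.2.1, Term.code_inj h.2.2]
  | le t u, w, h => by
    cases w <;> simp only [code, Nat.pair_eq_pair] at h <;> try omega
    rw [Term.code_inj h.2.1, Term.code_inj h.2.2]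
  | and t u, w, h => by
    cases w <;> simp only [code, Nat.pair_eq_pair] at h <;> try omega
    rw [code_inj h.2.1, code_inj h.2.2]
  | or t u, w, h => by
    cases w <;> simp only [code, Nat.pair_eq_pair] at h <;> try omega
    rw [code_inj h.2.1, code_inj h.2.2]
  | imp t u, w, h => by
    cases w <;> simp only [code, Nat.pair_eq_pair] at h <;> try omega
    rw [code_inj h.2.1, code_inj h.2.2]
  | neg t, w, h => by
    cases w <;> simp only [code, Nat.pair_eq_pair] at h <;> try omega
    rw [code_inj h.2]
  | box t, w, h => by
    cases w <;> simp only [code, Nat.pair_eq_pair] at h <;> try omega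
    rw [code_inj h.2]
  | all x t, w, h => by
    cases w <;> simp only [code, Nat.pair_eq_pair] at h <;> try omega
    rw [h.2.1, code_inj h.2.2]
  | ex x t, w, h => by
    cases w <;> simp only [code, Nat.pair_eq_pair] at h <;> try omega
    rw [h.2.1, code_inj h.2.2]

end Formula

end ModalArith


namespace ModalArith

open Function Formula

/-! ### Propositional completeness and derived rules -/

/-- Boolean valuations of formulas making all theorems of `T` true. -/
structure IsVal (T : Set Formula) (b : Formula → Prop) : Prop where
  thm : ∀ {φ}, Provable T φ → b φ
  falsum : b falsum ↔ False
  imp : ∀ φ ψ, b (φ.imp ψ) ↔ (b φ → b ψ)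
  and : ∀ φ ψ, b (φ.and ψ) ↔ (b φ ∧ b ψ)
  or : ∀ φ ψ, b (φ.or ψ) ↔ (b φ ∨ b ψ)
  neg : ∀ φ, b φ.neg ↔ ¬ b φ
  iff : ∀ φ ψ, b (φ.iff ψ) ↔ (b φ ↔ b ψ)

theorem Provable.taut {T : Set Formula} {φ : Formula}
    (h : ∀ b : Formula → Prop, IsVal T b → b φ) : Provable T φ := by
  by_contra hφ
  let C : Set (Set Formula) := {X | (∀ ψ, Provable T ψ → ψ ∈ X) ∧
    (∀ ψ χ, ψ.imp χ ∈ X → ψ ∈ X → χ ∈ X) ∧ φ ∉ X}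
  have hC0 : {ψ | Provable T ψ} ∈ C := ⟨fun _ h => h, fun _ _ h1 h2 => h1.mp h2, hφ⟩
  obtain ⟨X, -, hX⟩ := zorn_subset_nonempty C (by
    intro c hc hchain hne
    refine ⟨⋃₀ c, ⟨?_, ?_, ?_⟩, fun s hs => Set.subset_sUnion_of_mem hs⟩
    · intro ψ hψ
      obtain ⟨s, hs⟩ := hne
      exact ⟨s, hs, (hc hs).1 ψ hψ⟩
    · rintro ψ χ ⟨s, hs, h1⟩ ⟨s', hs', h2⟩
      rcases hchain.total hs hs' with hss | hss
      · exact ⟨s', hs', (hc hs').2.1 _ _ (hss h1) h2⟩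
      · exact ⟨s, hs, (hc hs).2.1 _ _ h1 (hss h2)⟩
    · rintro ⟨s, hs, h1⟩
      exact (hc hs).2.2 h1) _ hC0
  obtain ⟨⟨hthm, hmp, hnot⟩, hmax⟩ := hX
  have lg : ∀ {ψ}, LogicalAxiom ψ → ψ ∈ X := fun h => hthm _ (.logic h)
  have tr : ∀ {a b c : Formula}, a.imp b ∈ X → b.imp c ∈ X → a.imp c ∈ X := by
    intro a b c h1 h2
    exact hmp _ _ (hmp _ _ (lg (.imp2 a b c)) (hmp _ _ (lg (.imp1 _ _)) h2)) h1
  have key : ∀ ψ : Formula, ψ ∉ X → ψ.imp φ ∈ X := by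
    intro ψ hψ
    by_contra hcon
    apply hψ
    have hY : {χ | ψ.imp χ ∈ X} ∈ C := by
      refine ⟨?_, ?_, hcon⟩
      · intro χ hχ
        exact hmp _ _ (lg (.imp1 _ _)) (hthm _ hχ)
      · intro χ χ' h1 h2
        exact hmp _ _ (hmp _ _ (lg (.imp2 _ _ _)) h1) h2
    have hsub : X ⊆ {χ | ψ.imp χ ∈ X} := fun χ hχ => hmp _ _ (lg (.imp1 _ _)) hχ
    apply hmax hY hsub
    exact hmp _ _ (hmp _ _ (lg (.imp2 ψ (ψ.imp ψ) ψ)) (lg (.imp1 _ _))) (lg (.imp1 _ _))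
  have contra : ∀ ψ : Formula, ψ.imp φ ∈ X → φ.neg.imp ψ.neg ∈ X := by
    intro ψ h1
    exact tr (lg (.imp1 φ.neg ψ)) (hmp _ _ (lg (.negI ψ φ)) h1)
  have hneg : ∀ ψ : Formula, ψ.neg ∈ X ↔ ψ ∉ X := by
    intro ψ
    constructor
    · intro h1 h2
      exact hnot (hmp _ _ (hmp _ _ (lg (.negE ψ φ)) h1) h2)
    · intro h1
      by_contra h2
      have h3 := contra _ (key _ h1)
      have h4 := contra _ (key _ h2)
      exact hnot (hmp _ _ (lg (.dne φ)) (hmp _ _ (hmp _ _ (lg (.negI _ _)) h3) h4))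
  have himp : ∀ ψ χ : Formula, ψ.imp χ ∈ X ↔ (ψ ∈ X → χ ∈ X) := by
    intro ψ χ
    constructor
    · exact hmp ψ χ
    · intro h1
      by_cases h2 : ψ ∈ X
      · exact hmp _ _ (lg (.imp1 _ _)) (h1 h2)
      · exact hmp _ _ (lg (.negE _ _)) ((hneg _).2 h2)
  have hand : ∀ ψ χ : Formula, ψ.and χ ∈ X ↔ (ψ ∈ X ∧ χ ∈ X) := by
    intro ψ χ
    constructor
    · intro h1
      exact ⟨hmp _ _ (lg (.andE1 _ _)) h1, hmp _ _ (lg (.andE2 _ _)) h1⟩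
    · rintro ⟨h1, h2⟩
      exact hmp _ _ (hmp _ _ (lg (.andI _ _)) h1) h2
  have hval : IsVal T (· ∈ X) := by
    refine ⟨fun {ψ} => hthm ψ, ?_, himp, hand, ?_, hneg, ?_⟩
    · simp only [iff_false]
      intro h1
      exact hnot (hmp _ _ (lg (.falsumE _)) h1)
    · intro ψ χ
      constructor
      · intro h1
        by_contra h2
        push Not at h2
        have := hmp _ _ (hmp _ _ (hmp _ _ (lg (.orE ψ χ φ)) (key _ h2.1)) (key _ h2.2)) h1
        exact hnot this
      · rintro (h1 | h1)
        · exact hmp _ _ (lg (.orI1 _ _)) h1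
        · exact hmp _ _ (lg (.orI2 _ _)) h1
    · intro ψ χ
      simp only [Formula.iff, hand, himp]
      tauto
  exact hnot (h _ hval)

section
variable {T : Set Formula}

theorem Provable.inst {φ : Formula} (h : Provable T φ) (x : ℕ) (t : Term)
    (hf : φ.freeFor t x) : Provable T (φ.subst x t) :=
  (Provable.logic (.allE x t φ hf)).mp (h.gen x)

theorem Provable.inst_numeral {φ : Formula} (h : Provable T φ) (x n : ℕ) :
    Provable T (φ.subst x (Term.numeral n)) :=
  h.inst x _ (freeFor_of_fv (by simp) φ)

theorem Provable.gen_imp {φ ψ : Formula} (x : ℕ) (hx : x ∉ φ.fv)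
    (h : Provable T (φ.imp ψ)) : Provable T (φ.imp (all x ψ)) :=
  (Provable.logic (.allImp x φ ψ hx)).mp (h.gen x)

theorem Provable.ex_elim {φ ψ : Formula} (x : ℕ) (hx : x ∉ ψ.fv)
    (h : Provable T (φ.imp ψ)) : Provable T ((ex x φ).imp ψ) :=
  (Provable.logic (.exE x φ ψ hx)).mp (h.gen x)

theorem Provable.all_self (x : ℕ) (φ : Formula) : Provable T ((all x φ).imp φ) := by
  have := Provable.logic (T := T) (.allE x (Term.var x) φ (freeFor_of_fv (by simp [Term.fv]) φ))
  rwa [subst_self] at this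

theorem Provable.ex_self (x : ℕ) (φ : Formula) : Provable T (φ.imp (ex x φ)) := by
  have := Provable.logic (T := T) (.exI x (Term.var x) φ (freeFor_of_fv (by simp [Term.fv]) φ))
  rwa [subst_self] at this

theorem Provable.ex_numeral (x n : ℕ) (φ : Formula) :
    Provable T ((φ.subst x (Term.numeral n)).imp (ex x φ)) :=
  .logic (.exI x _ φ (freeFor_of_fv (by simp) φ))

/-! ### Quantifier-free formulas and simultaneous substitution -/

/-- Quantifier-free (but possibly modal) formulas. -/
def qf : Formula → Prop
  | .falsum => True
  | .eq _ _ => True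
  | .le _ _ => True
  | .and φ ψ => qf φ ∧ qf ψ
  | .or φ ψ => qf φ ∧ qf ψ
  | .imp φ ψ => qf φ ∧ qf ψ
  | .neg φ => qf φ
  | .all _ _ => False
  | .ex _ _ => False
  | .box φ => qf φ

theorem qf_freeFor {φ : Formula} (h : qf φ) (s : Term) (x : ℕ) : φ.freeFor s x := by
  induction φ with
  | falsum | eq | le => trivial
  | and φ ψ ih1 ih2 | or φ ψ ih1 ih2 | imp φ ψ ih1 ih2 => exact ⟨ih1 h.1, ih2 h.2⟩
  | neg φ ih | box φ ih => exact ih h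
  | all y φ ih | ex y φ ih => exact h.elim

theorem qf_substAll {φ : Formula} (h : qf φ) (σ : ℕ → Term) : qf (φ.substAll σ) := by
  induction φ with
  | falsum | eq | le => trivial
  | and φ ψ ih1 ih2 | or φ ψ ih1 ih2 | imp φ ψ ih1 ih2 => exact ⟨ih1 h.1, ih2 h.2⟩
  | neg φ ih | box φ ih => exact ih h
  | all y φ ih | ex y φ ih => exact h.elim

theorem qf_comp {φ : Formula} (h : qf φ) (σ τ : ℕ → Term) :
    (φ.substAll σ).substAll τ = φ.substAll fun x => (σ x).substAll τ := by
  induction φ with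
  | falsum => rfl
  | eq | le => simp [substAll, Term.substAll_comp]
  | and φ ψ ih1 ih2 | or φ ψ ih1 ih2 | imp φ ψ ih1 ih2 =>
    simp only [substAll]; rw [ih1 h.1, ih2 h.2]
  | neg φ ih | box φ ih => simp only [substAll]; rw [ih h]
  | all y φ ih | ex y φ ih => exact h.elim

theorem exists_bound (s : Finset ℕ) : ∃ N, ∀ x ∈ s, x < N :=
  ⟨s.sup id + 1, fun _ hx => Nat.lt_succ_of_le (Finset.le_sup (f := id) hx)⟩

theorem Provable.subst_qf {φ : Formula} (h : Provable T φ) (hq : qf φ) (σ : ℕ → Term) :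
    Provable T (φ.substAll σ) := by
  obtain ⟨N, hN⟩ := exists_bound φ.fv
  obtain ⟨M, hM⟩ := exists_bound (φ.fv.biUnion (fun x => (σ x).fv) ∪ Finset.range N)
  have hNM : ∀ x < N, x < M := fun x hx => hM x (by simp [hx])
  have hσ : ∀ x ∈ φ.fv, ∀ y ∈ (σ x).fv, y < M := fun x hx y hy =>
    hM y (Finset.mem_union_left _ (Finset.mem_biUnion.2 ⟨x, hx, hy⟩))
  have s1 : ∀ k ≤ N, Provable T
      (φ.substAll fun x => if x < k then Term.var (x + M) else Term.var x) := by
    intro k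
    induction k with
    | zero => intro; simpa using h
    | succ k ih =>
      intro hk
      have := (ih (by omega)).inst k (Term.var (k + M)) (qf_freeFor (qf_substAll hq _) _ _)
      rw [subst, qf_comp hq] at this
      convert this using 1
      apply substAll_congr
      intro x hx
      have h1 := hNM x (hN x hx)
      have h3 := hNM k hk
      rcases lt_trichotomy x k with h2 | h2 | h2
      · rw [if_pos (by omega), if_pos h2]
        simp only [Term.substAll]
        rw [update_of_ne (by omega)]
      · subst h2; simp [Term.substAll]
      · rw [if_neg (by omega), if_neg (by omega)]
        simp only [Term.substAll]
        rw [update_of_ne (by omega)]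
  have s2 : ∀ k ≤ N, Provable T
      (φ.substAll fun x => if x < k then σ x else Term.var (x + M)) := by
    intro k
    induction k with
    | zero =>
      intro
      convert s1 N le_rfl using 1
      apply substAll_congr
      intro x hx
      simp [hN x hx]
    | succ k ih =>
      intro hk
      have := (ih (by omega)).inst (k + M) (σ k) (qf_freeFor (qf_substAll hq _) _ _)
      rw [subst, qf_comp hq] at this
      convert this using 1
      apply substAll_congr
      intro x hx
      rcases lt_trichotomy x k with h2 | h2 | h2
      · rw [if_pos (by omega), if_pos h2]
        symm
        apply Term.substAll_id
        intro y hy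
        have := hσ x hx y hy
        rw [update_of_ne (by omega)]
      · subst h2; simp [Term.substAll]
      · rw [if_neg (by omega), if_neg (by omega)]
        simp only [Term.substAll]
        rw [update_of_ne (by omega)]
  convert s2 N le_rfl using 1
  apply substAll_congr
  intro x hx
  simp [hN x hx]

end

end ModalArith


namespace ModalArith

open Function Formula

/-! ### Arithmetic inside theories extending PA -/

namespace IsVal
variable {T : Set Formula} {b : Formula → Prop}

theorem mp (hb : IsVal T b) {φ ψ : Formula} (h : Provable T (φ.imp ψ)) : b φ → b ψ :=
  (hb.imp _ _).1 (hb.thm h)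

theorem refl (hb : IsVal T b) (t : Term) : b (.eq t t) := hb.thm (.logic (.eqRefl t))

theorem symm (hb : IsVal T b) {t u : Term} : b (.eq t u) → b (.eq u t) :=
  hb.mp (.logic (.eqSymm t u))

theorem trans (hb : IsVal T b) {t u w : Term} (h1 : b (.eq t u)) (h2 : b (.eq u w)) :
    b (.eq t w) :=
  (hb.imp _ _).1 (hb.mp (.logic (.eqTrans t u w)) h1) h2

theorem succ (hb : IsVal T b) {t u : Term} : b (.eq t u) → b (.eq t.succ u.succ) :=
  hb.mp (.logic (.eqSucc t u))

theorem add (hb : IsVal T b) {t t' u u' : Term} (h1 : b (.eq t t')) (h2 : b (.eq u u')) :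
    b (.eq (t.add u) (t'.add u')) :=
  (hb.imp _ _).1 (hb.mp (.logic (.eqAdd t t' u u')) h1) h2

theorem mul (hb : IsVal T b) {t t' u u' : Term} (h1 : b (.eq t t')) (h2 : b (.eq u u')) :
    b (.eq (t.mul u) (t'.mul u')) :=
  (hb.imp _ _).1 (hb.mp (.logic (.eqMul t t' u u')) h1) h2

theorem le (hb : IsVal T b) {t t' u u' : Term} (h1 : b (.eq t t')) (h2 : b (.eq u u'))
    (h3 : b (.le t u)) : b (.le t' u') :=
  (hb.imp _ _).1 ((hb.imp _ _).1 (hb.mp (.logic (.eqLe t t' u u')) h1) h2) h3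

end IsVal

/-- A tuple of terms as a substitution. -/
def tup (a b c d : Term) : ℕ → Term
  | 0 => a
  | 1 => b
  | 2 => c
  | 3 => d
  | n => Term.var n

section
variable {T : Set Formula}

theorem ind (hT : Extends T PABox) (x : ℕ) (φ : Formula) (h0 : Provable T (φ.subst x .zero))
    (hs : Provable T (φ.imp (φ.subst x (.succ (.var x))))) : Provable T φ := by
  have h := hT (inductionAx x φ) (Or.inr ⟨x, φ, rfl⟩)
  refine (Provable.all_self x φ).mp (h.mp (Provable.taut fun b hb => ?_))
  rw [hb.and]
  exact ⟨hb.thm h0, hb.thm (hs.gen x)⟩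

theorem Provable.tup_inst {φ : Formula} (h : Provable T φ) (hq : qf φ) (a b c d : Term) :
    Provable T (φ.substAll (tup a b c d)) := h.subst_qf hq _

theorem pa_succ_ne (hT : Extends T PABox) (a : Term) :
    Provable T (Formula.eq (.succ a) .zero).neg :=
  (hT succNeZero (Or.inl (by simp [baseAxioms]))).tup_inst trivial a a a a

theorem pa_succ_inj (hT : Extends T PABox) (a b : Term) :
    Provable T ((Formula.eq (.succ a) (.succ b)).imp (.eq a b)) :=
  (hT succInj (Or.inl (by simp [baseAxioms]))).tup_inst (by simp [qf, succInj]) a b a a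

theorem pa_add_zero (hT : Extends T PABox) (a : Term) :
    Provable T (.eq (a.add .zero) a) :=
  (hT addZero (Or.inl (by simp [baseAxioms]))).tup_inst trivial a a a a

theorem pa_add_succ (hT : Extends T PABox) (a b : Term) :
    Provable T (.eq (a.add b.succ) (a.add b).succ) :=
  (hT addSucc (Or.inl (by simp [baseAxioms]))).tup_inst trivial a b a a

theorem pa_mul_zero (hT : Extends T PABox) (a : Term) :
    Provable T (.eq (a.mul .zero) .zero) :=
  (hT mulZero (Or.inl (by simp [baseAxioms]))).tup_inst trivial a a a a

theorem pa_mul_succ (hT : Extends T PABox) (a b : Term) :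
    Provable T (.eq (a.mul b.succ) ((a.mul b).add a)) :=
  (hT mulSucc (Or.inl (by simp [baseAxioms]))).tup_inst trivial a b a a

theorem pa_leI (hT : Extends T PABox) (a b c : Term) :
    Provable T ((Formula.eq (a.add c) b).imp (.le a b)) := by
  have h : Provable T leDef := hT leDef (Or.inl (by simp [baseAxioms]))
  have h2 : Provable T ((Formula.eq ((Term.var 0).add (.var 2)) (.var 1)).imp
      (.le (.var 0) (.var 1))) := Provable.taut fun b hb => by
    have h1 := hb.thm h
    have h2 := hb.thm (Provable.ex_self (T := T) 2
      (.eq ((Term.var 0).add (.var 2)) (.var 1)))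
    rw [leDef, hb.iff] at h1
    rw [hb.imp] at *
    tauto
  exact h2.tup_inst (by simp [qf]) a b c a

theorem pa_leE (hT : Extends T PABox) {χ : Formula} (hχ : 2 ∉ χ.fv)
    (h : Provable T ((Formula.eq ((Term.var 0).add (.var 2)) (.var 1)).imp χ)) :
    Provable T ((Formula.le (.var 0) (.var 1)).imp χ) := by
  have h1 : Provable T leDef := hT leDef (Or.inl (by simp [baseAxioms]))
  exact Provable.taut fun b hb => by
    have h1 := hb.thm h1
    have h2 := hb.thm (h.ex_elim 2 hχ)
    rw [leDef, hb.iff] at h1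
    rw [hb.imp] at *
    tauto

theorem pa_zero_add (hT : Extends T PABox) (a : Term) :
    Provable T (.eq (Term.zero.add a) a) := by
  have h : Provable T (.eq (Term.zero.add (.var 0)) (.var 0)) := by
    refine ind hT 0 _ (pa_add_zero hT .zero) ?_
    refine Provable.taut fun b hb => ?_
    rw [hb.imp]
    intro h
    exact hb.trans (hb.thm (pa_add_succ hT _ _)) (hb.succ h)
  exact h.tup_inst trivial a a a a

theorem pa_succ_add (hT : Extends T PABox) (a c : Term) :
    Provable T (.eq (a.succ.add c) (a.add c).succ) := by
  have h : Provable T (.eq ((Term.var 0).succ.add (.var 1)) ((Term.var 0).add (.var 1)).succ) := by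
    refine ind hT 1 _ ?_ ?_
    · refine Provable.taut fun b hb => ?_
      exact hb.trans (hb.thm (pa_add_zero hT _)) (hb.symm (hb.succ (hb.thm (pa_add_zero hT _))))
    · refine Provable.taut fun b hb => ?_
      rw [hb.imp]
      intro h
      exact hb.trans (hb.thm (pa_add_succ hT _ _)) (hb.trans (hb.succ h)
        (hb.symm (hb.succ (hb.thm (pa_add_succ hT _ _)))))
  exact h.tup_inst trivial a c a a

theorem pa_le_refl (hT : Extends T PABox) (a : Term) : Provable T (.le a a) :=
  (pa_leI hT a a .zero).mp (pa_add_zero hT a)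

theorem pa_zero_le (hT : Extends T PABox) (a : Term) : Provable T (.le .zero a) :=
  (pa_leI hT .zero a a).mp (pa_zero_add hT a)

theorem pa_not_succ_le_zero (hT : Extends T PABox) (a : Term) :
    Provable T (Formula.le a.succ .zero).neg := by
  have h : Provable T ((Formula.le (.var 0) (.var 1)).imp
      ((Formula.eq (.var 1) .zero).imp (Formula.eq (.var 0) .zero))) := by
    refine pa_leE hT (by simp [fv, Term.fv]) ?_
    refine ind hT 2 _ ?_ ?_
    · refine Provable.taut fun b hb => ?_
      change b (((Formula.eq ((Term.var 0).add .zero) (.var 1)).imp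
        ((Formula.eq (.var 1) .zero).imp (Formula.eq (.var 0) .zero))))
      simp only [hb.imp]
      intro h1 h2
      exact hb.trans (hb.symm (hb.thm (pa_add_zero hT _))) (hb.trans h1 h2)
    · refine Provable.taut fun b hb => ?_
      rw [hb.imp]
      intro _
      change b (((Formula.eq ((Term.var 0).add (Term.var 2).succ) (.var 1)).imp
        ((Formula.eq (.var 1) .zero).imp (Formula.eq (.var 0) .zero))))
      simp only [hb.imp]
      intro h1 h2
      have := hb.thm (pa_succ_ne hT ((Term.var 0).add (.var 2)))
      rw [hb.neg] at this
      exact (this (hb.trans (hb.symm (hb.thm (pa_add_succ hT _ _))) (hb.trans h1 h2))).elim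
  have h2 := h.tup_inst (by simp [qf]) a.succ .zero .zero .zero
  refine Provable.taut fun b hb => ?_
  have h3 := hb.mp h2
  have h4 := hb.thm (pa_succ_ne hT a)
  rw [hb.neg] at *
  intro h5
  exact h4 ((hb.imp _ _).1 (h3 h5) (hb.refl _))

theorem pa_succ_le_succ (hT : Extends T PABox) (a c : Term) :
    Provable T ((Formula.le a c).imp (.le a.succ c.succ)) := by
  have h : Provable T ((Formula.le (.var 0) (.var 1)).imp
      (.le (Term.var 0).succ (Term.var 1).succ)) := by
    refine pa_leE hT (by simp [fv, Term.fv]) ?_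
    refine Provable.taut fun b hb => ?_
    rw [hb.imp]
    intro h
    exact hb.mp (pa_leI hT _ _ (.var 2)) (hb.trans (hb.thm (pa_succ_add hT _ _)) (hb.succ h))
  exact h.tup_inst (by simp [qf]) a c a a

theorem pa_le_of_succ (hT : Extends T PABox) (a c : Term) :
    Provable T ((Formula.le a.succ c.succ).imp (.le a c)) := by
  have h : Provable T ((Formula.le (.var 0) (.var 1)).imp
      ((Formula.eq (.var 0) (Term.var 3).succ).imp ((Formula.eq (.var 1) (Term.var 4).succ).imp
      (.le (Term.var 3) (Term.var 4))))) := by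
    refine pa_leE hT (by simp [fv, Term.fv]) ?_
    refine Provable.taut fun b hb => ?_
    simp only [hb.imp]
    intro h h1 h2
    refine hb.mp (pa_leI hT _ _ (.var 2)) (hb.mp (pa_succ_inj hT _ _) ?_)
    exact hb.trans (hb.symm (hb.thm (pa_succ_add hT _ _)))
      (hb.trans (hb.add (hb.symm h1) (hb.refl _)) (hb.trans h h2))
  have h2 := h.subst_qf (by simp [qf]) (fun n => match n with
    | 0 => a.succ
    | 1 => c.succ
    | 3 => a
    | 4 => c
    | n => .var n)
  refine Provable.taut fun b hb => ?_
  rw [hb.imp]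
  intro h3
  exact (hb.imp _ _).1 ((hb.imp _ _).1 (hb.mp h2 h3) (hb.refl _)) (hb.refl _)

theorem pa_le_succ_right (hT : Extends T PABox) (a c : Term) :
    Provable T ((Formula.le a c).imp (.le a c.succ)) := by
  have h : Provable T ((Formula.le (.var 0) (.var 1)).imp
      (.le (Term.var 0) (Term.var 1).succ)) := by
    refine pa_leE hT (by simp [fv, Term.fv]) ?_
    refine Provable.taut fun b hb => ?_
    rw [hb.imp]
    intro h
    exact hb.mp (pa_leI hT _ _ (Term.var 2).succ)
      (hb.trans (hb.thm (pa_add_succ hT _ _)) (hb.succ h))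
  exact h.tup_inst (by simp [qf]) a c a a

theorem pa_le_cases (hT : Extends T PABox) (a c : Term) :
    Provable T ((Formula.le a c).imp ((Formula.le a.succ c).or (.eq a c))) := by
  have h : Provable T ((Formula.le (.var 0) (.var 1)).imp
      ((Formula.le (Term.var 0).succ (Term.var 1)).or (.eq (.var 0) (.var 1)))) := by
    refine pa_leE hT (by simp [fv, Term.fv]) ?_
    refine ind hT 2 _ ?_ ?_
    · refine Provable.taut fun b hb => ?_
      change b (((Formula.eq ((Term.var 0).add .zero) (.var 1)).imp
        ((Formula.le (Term.var 0).succ (Term.var 1)).or (.eq (.var 0) (.var 1)))))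
      simp only [hb.imp, hb.or]
      intro h1
      exact Or.inr (hb.trans (hb.symm (hb.thm (pa_add_zero hT _))) h1)
    · refine Provable.taut fun b hb => ?_
      rw [hb.imp]
      intro _
      change b (((Formula.eq ((Term.var 0).add (Term.var 2).succ) (.var 1)).imp
        ((Formula.le (Term.var 0).succ (Term.var 1)).or (.eq (.var 0) (.var 1)))))
      simp only [hb.imp, hb.or]
      intro h1
      refine Or.inl (hb.mp (pa_leI hT _ _ (Term.var 2)) ?_)
      exact hb.trans (hb.thm (pa_succ_add hT _ _))
        (hb.trans (hb.symm (hb.thm (pa_add_succ hT _ _))) h1)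
  exact h.tup_inst (by simp [qf]) a c a a

theorem pa_le_total (hT : Extends T PABox) (a c : Term) :
    Provable T ((Formula.le a c).or (.le c.succ a)) := by
  have h : Provable T ((Formula.le (.var 0) (.var 1)).or
      (.le (Term.var 1).succ (Term.var 0))) := by
    refine ind hT 0 _ ?_ ?_
    · refine Provable.taut fun b hb => ?_
      exact (hb.or _ _).2 (Or.inl (hb.thm (pa_zero_le hT _)))
    · refine Provable.taut fun b hb => ?_
      change b (((Formula.le (.var 0) (.var 1)).or (.le (Term.var 1).succ (Term.var 0))).imp
        ((Formula.le (Term.var 0).succ (.var 1)).or (.le (Term.var 1).succ (Term.var 0).succ)))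
      simp only [hb.imp, hb.or]
      rintro (h1 | h1)
      · have h2 := hb.mp (pa_le_cases hT _ _) h1
        rw [hb.or] at h2
        rcases h2 with h2 | h2
        · exact Or.inl h2
        · exact Or.inr (hb.le (hb.refl _) (hb.succ (hb.symm h2)) (hb.thm (pa_le_refl hT _)))
      · exact Or.inr (hb.mp (pa_le_succ_right hT _ _) h1)
  exact h.tup_inst (by simp [qf]) a c a a

theorem pa_le_trans (hT : Extends T PABox) (a c d : Term) :
    Provable T ((Formula.le a c).imp ((Formula.le c d).imp (.le a d))) := by
  have h0 : Provable T ((Formula.le (.var 3) (.var 0)).imp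
      (.le (.var 3) ((Term.var 0).add (.var 2)))) := by
    refine ind hT 2 _ ?_ ?_
    · refine Provable.taut fun b hb => ?_
      change b ((Formula.le (.var 3) (.var 0)).imp (.le (.var 3) ((Term.var 0).add .zero)))
      rw [hb.imp]
      exact hb.le (hb.refl _) (hb.symm (hb.thm (pa_add_zero hT _)))
    · refine Provable.taut fun b hb => ?_
      change b (((Formula.le (.var 3) (.var 0)).imp
          (.le (.var 3) ((Term.var 0).add (.var 2)))).imp
        ((Formula.le (.var 3) (.var 0)).imp (.le (.var 3) ((Term.var 0).add (Term.var 2).succ))))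
      simp only [hb.imp]
      intro h1 h2
      exact hb.le (hb.refl _) (hb.symm (hb.thm (pa_add_succ hT _ _)))
        (hb.mp (pa_le_succ_right hT _ _) (h1 h2))
  have h : Provable T ((Formula.le (.var 0) (.var 1)).imp
      ((Formula.le (.var 3) (.var 0)).imp (.le (.var 3) (.var 1)))) := by
    refine pa_leE hT (by simp [fv, Term.fv]) ?_
    refine Provable.taut fun b hb => ?_
    simp only [hb.imp]
    intro h1 h2
    exact hb.le (hb.refl _) h1 (hb.mp h0 h2)
  have h2 := h.tup_inst (by simp [qf]) c d c a
  refine Provable.taut fun b hb => ?_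
  simp only [hb.imp]
  intro h3 h4
  exact (hb.imp _ _).1 (hb.mp h2 h4) h3

theorem pa_lt_irrefl (hT : Extends T PABox) (a : Term) :
    Provable T (Formula.le a.succ a).neg := by
  have h : Provable T (Formula.le (Term.var 0).succ (.var 0)).neg := by
    refine ind hT 0 _ (pa_not_succ_le_zero hT _) ?_
    refine Provable.taut fun b hb => ?_
    change b ((Formula.le (Term.var 0).succ (.var 0)).neg.imp
      (Formula.le (Term.var 0).succ.succ (Term.var 0).succ).neg)
    simp only [hb.imp, hb.neg]
    exact mt (hb.mp (pa_le_of_succ hT _ _))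
  exact h.tup_inst trivial a a a a

variable {b : Formula → Prop}

theorem IsVal.le_trans (hb : IsVal T b) (hT : Extends T PABox) {a c d : Term}
    (h1 : b (.le a c)) (h2 : b (.le c d)) : b (.le a d) :=
  (hb.imp _ _).1 (hb.mp (pa_le_trans hT a c d) h1) h2

theorem IsVal.not_le (hb : IsVal T b) (hT : Extends T PABox) {a c : Term} :
    ¬ b (.le a c) ↔ b (.le c.succ a) := by
  have h := hb.thm (pa_le_total hT a c)
  rw [hb.or] at h
  constructor
  · tauto
  · intro h1 h2
    have := hb.thm (pa_lt_irrefl hT c)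
    rw [hb.neg] at this
    exact this (hb.le_trans hT h1 h2)

theorem IsVal.succ_le_succ (hb : IsVal T b) (hT : Extends T PABox) {a c : Term} :
    b (.le a.succ c.succ) ↔ b (.le a c) :=
  ⟨hb.mp (pa_le_of_succ hT a c), hb.mp (pa_succ_le_succ hT a c)⟩

theorem IsVal.le_cases (hb : IsVal T b) (hT : Extends T PABox) {a c : Term}
    (h : b (.le a c)) : b (.le a.succ c) ∨ b (.eq a c) :=
  (hb.or _ _).1 (hb.mp (pa_le_cases hT a c) h)

theorem IsVal.lt_cases (hb : IsVal T b) (hT : Extends T PABox) {a c : Term}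
    (h : b (.lt a c.succ)) : b (.lt a c) ∨ b (.eq a c) :=
  hb.le_cases hT ((hb.succ_le_succ hT).1 h)

theorem IsVal.le_of_eq (hb : IsVal T b) (hT : Extends T PABox) {a c : Term}
    (h : b (.eq a c)) : b (.le a c) :=
  hb.le (hb.refl _) h (hb.thm (pa_le_refl hT a))

theorem IsVal.le_of_lt (hb : IsVal T b) (hT : Extends T PABox) {a c : Term}
    (h : b (.lt a c)) : b (.le a c) :=
  hb.le_trans hT (hb.mp (pa_le_succ_right hT _ _) (hb.thm (pa_le_refl hT a))) h

theorem IsVal.lt_irrefl (hb : IsVal T b) (hT : Extends T PABox) {a : Term} :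
    ¬ b (.lt a a) := (hb.neg _).1 (hb.thm (pa_lt_irrefl hT a))

theorem IsVal.not_lt_zero (hb : IsVal T b) (hT : Extends T PABox) {a : Term} :
    ¬ b (.lt a .zero) := (hb.neg _).1 (hb.thm (pa_not_succ_le_zero hT a))

/-- Negated equality is equivalent to a strict inequality. -/
theorem IsVal.ne_iff (hb : IsVal T b) (hT : Extends T PABox) {a c : Term} :
    ¬ b (.eq a c) ↔ b (.le a.succ c) ∨ b (.le c.succ a) := by
  constructor
  · intro h
    by_cases h1 : b (.le a c)
    · exact Or.inl ((hb.le_cases hT h1).resolve_right h)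
    · exact Or.inr ((hb.not_le hT).1 h1)
  · rintro (h | h) h1
    · exact hb.lt_irrefl hT (hb.le (hb.succ h1) (hb.refl _) h)
    · exact hb.lt_irrefl hT (hb.le (hb.refl _) h1 h)

end

end ModalArith


namespace ModalArith

open Function Formula

/-! ### Provable completeness for ΣB formulas in extensions of PA(K4) -/

section
variable {T : Set Formula}

theorem Extends.paBox (h : Extends T PAK4) : Extends T PABox :=
  fun φ hφ => h φ (Or.inl (Or.inl hφ))

variable {b : Formula → Prop}

theorem IsVal.box_mp (hb : IsVal T b) (h4 : Extends T PAK4) {φ ψ : Formula}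
    (h : Provable T (φ.imp ψ)) (h1 : b (.box φ)) : b (.box ψ) :=
  (hb.imp _ _).1 (hb.mp (h4 (axK φ ψ) (Or.inl (Or.inr ⟨φ, ψ, rfl⟩))) (hb.thm h.nec)) h1

theorem IsVal.box_mp2 (hb : IsVal T b) (h4 : Extends T PAK4) {φ ψ χ : Formula}
    (h : Provable T (φ.imp (ψ.imp χ))) (h1 : b (.box φ)) (h2 : b (.box ψ)) : b (.box χ) :=
  (hb.imp _ _).1 (hb.mp (h4 (axK ψ χ) (Or.inl (Or.inr ⟨ψ, χ, rfl⟩))) (hb.box_mp h4 h h1)) h2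

theorem IsVal.box_box (hb : IsVal T b) (h4 : Extends T PAK4) {φ : Formula}
    (h1 : b (.box φ)) : b (.box (.box φ)) :=
  hb.mp (h4 (ax4 φ) (Or.inr ⟨φ, rfl⟩)) h1

theorem box_eq (h4 : Extends T PAK4) (s t : Term) :
    Provable T ((Formula.eq s t).imp (.box (.eq s t))) := by
  have hT := h4.paBox
  let E (s t : Term) : Formula := (Formula.eq s t).imp (.box (.eq s t))
  have h : Provable T (all 1 (E (.var 0) (.var 1))) := by
    refine ind hT 0 _ ?_ ?_
    · change Provable T (all 1 (E .zero (.var 1)))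
      refine Provable.gen _ (ind hT 1 _ ?_ ?_)
      · change Provable T (E .zero .zero)
        exact Provable.taut fun b hb => (hb.imp _ _).2 fun _ =>
          hb.thm (Provable.logic (.eqRefl _)).nec
      · change Provable T ((E .zero (.var 1)).imp (E .zero (Term.var 1).succ))
        refine Provable.taut fun b hb => ?_
        have := hb.thm (pa_succ_ne hT (.var 1))
        simp only [E, hb.imp, hb.neg] at *
        intro _ h
        exact absurd (hb.symm h) this
    · change Provable T ((all 1 (E (.var 0) (.var 1))).imp (all 1 (E (Term.var 0).succ (.var 1))))
      refine Provable.gen_imp 1 (by simp [fv]) ?_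
      refine ind hT 1 _ ?_ ?_
      · change Provable T ((all 1 (E (.var 0) (.var 1))).imp (E (Term.var 0).succ .zero))
        refine Provable.taut fun b hb => ?_
        have := hb.thm (pa_succ_ne hT (.var 0))
        simp only [E, hb.imp, hb.neg] at *
        intro _ h
        exact absurd h this
      · change Provable T (((all 1 (E (.var 0) (.var 1))).imp (E (Term.var 0).succ (.var 1))).imp
          ((all 1 (E (.var 0) (.var 1))).imp (E (Term.var 0).succ (Term.var 1).succ)))
        refine Provable.taut fun b hb => ?_
        simp only [hb.imp, E]
        intro _ h1 h2
        have h3 := hb.mp (Provable.all_self 1 _) h1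
        rw [hb.imp] at h3
        exact hb.box_mp h4 (.logic (.eqSucc _ _)) (h3 (hb.mp (pa_succ_inj hT _ _) h2))
  exact ((Provable.all_self 1 _).mp h).tup_inst (by simp [qf, E]) s t s t

theorem box_le (h4 : Extends T PAK4) (s t : Term) :
    Provable T ((Formula.le s t).imp (.box (.le s t))) := by
  have hT := h4.paBox
  have h : Provable T ((Formula.le (.var 0) (.var 1)).imp (.box (.le (.var 0) (.var 1)))) := by
    refine pa_leE hT (by simp [fv, Term.fv]) ?_
    refine Provable.taut fun b hb => ?_
    rw [hb.imp]
    intro h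
    exact hb.box_mp h4 (pa_leI hT _ _ _) (hb.mp (box_eq h4 _ _) h)
  exact h.tup_inst (by simp [qf]) s t s t

theorem box_not_le (h4 : Extends T PAK4) (s t : Term) :
    Provable T ((Formula.le s t).neg.imp (.box (Formula.le s t).neg)) := by
  have hT := h4.paBox
  refine Provable.taut fun b hb => ?_
  rw [hb.imp, hb.neg, hb.not_le hT]
  intro h
  refine hb.box_mp h4 ?_ (hb.mp (box_le h4 _ _) h)
  refine Provable.taut fun b hb => ?_
  rw [hb.imp, hb.neg, hb.not_le hT]
  exact id

theorem box_not_eq (h4 : Extends T PAK4) (s t : Term) :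
    Provable T ((Formula.eq s t).neg.imp (.box (Formula.eq s t).neg)) := by
  have hT := h4.paBox
  refine Provable.taut fun b hb => ?_
  rw [hb.imp, hb.neg, hb.ne_iff hT]
  rintro (h | h)
  · refine hb.box_mp h4 ?_ (hb.mp (box_le h4 _ _) h)
    refine Provable.taut fun b hb => ?_
    rw [hb.imp, hb.neg, hb.ne_iff hT]
    exact Or.inl
  · refine hb.box_mp h4 ?_ (hb.mp (box_le h4 _ _) h)
    refine Provable.taut fun b hb => ?_
    rw [hb.imp, hb.neg, hb.ne_iff hT]
    exact Or.inr

/-! ### Leibniz law -/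

theorem IsVal.leibniz_term (hb : IsVal T b) {x : ℕ} {s : Term} (h : b (.eq (.var x) s)) (t : Term) :
    b (.eq t (t.substAll (update Term.var x s))) := by
  induction t with
  | var y =>
    by_cases hy : y = x
    · subst hy
      simpa [Term.substAll] using h
    · simpa [Term.substAll, hy] using hb.refl _
  | zero => exact hb.refl _
  | succ t ih => exact hb.succ ih
  | add t u ih1 ih2 => exact hb.add ih1 ih2
  | mul t u ih1 ih2 => exact hb.mul ih1 ih2

theorem leibniz (h4 : Extends T PAK4) {x : ℕ} {s : Term} : ∀ {φ : Formula}, φ.freeFor s x →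
    Provable T ((Formula.eq (.var x) s).imp (φ.iff (φ.subst x s))) := by
  intro φ
  have triv : ∀ ψ : Formula, Provable T ((Formula.eq (.var x) s).imp (ψ.iff ψ)) := fun ψ =>
    Provable.taut fun b hb => by rw [hb.imp, hb.iff]; tauto
  induction φ with
  | falsum => intro _; exact triv _
  | eq t u =>
    intro _
    refine Provable.taut fun b hb => ?_
    rw [hb.imp, hb.iff]
    intro h
    exact ⟨fun h1 => hb.trans (hb.symm (hb.leibniz_term h t)) (hb.trans h1 (hb.leibniz_term h u)),
      fun h1 => hb.trans (hb.leibniz_term h t) (hb.trans h1 (hb.symm (hb.leibniz_term h u)))⟩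
  | le t u =>
    intro _
    refine Provable.taut fun b hb => ?_
    rw [hb.imp, hb.iff]
    intro h
    exact ⟨hb.le (hb.leibniz_term h t) (hb.leibniz_term h u),
      hb.le (hb.symm (hb.leibniz_term h t)) (hb.symm (hb.leibniz_term h u))⟩
  | and φ ψ ih1 ih2 | or φ ψ ih1 ih2 | imp φ ψ ih1 ih2 =>
    intro hf
    refine Provable.taut fun b hb => ?_
    have h1 := hb.thm (ih1 hf.1)
    have h2 := hb.thm (ih2 hf.2)
    simp only [subst, substAll, hb.imp, hb.iff, hb.and, hb.or] at *
    tauto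
  | neg φ ih =>
    intro hf
    refine Provable.taut fun b hb => ?_
    have h1 := hb.thm (ih hf)
    simp only [subst, substAll, hb.imp, hb.iff, hb.neg] at *
    tauto
  | box φ ih =>
    intro hf
    refine Provable.taut fun b hb => ?_
    have h1 := ih hf
    change b (Formula.imp _ (Formula.iff _ (.box (φ.subst x s))))
    rw [hb.imp, hb.iff]
    intro h
    have h2 := hb.mp (box_eq h4 _ _) h
    constructor
    · refine hb.box_mp2 h4 (Provable.taut fun b hb => ?_) h2
      have := hb.thm h1
      simp only [hb.imp, hb.iff] at *
      tauto
    · refine hb.box_mp2 h4 (Provable.taut fun b hb => ?_) h2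
      have := hb.thm h1
      simp only [hb.imp, hb.iff] at *
      tauto
  | all y φ ih =>
    intro hf
    by_cases hxy : x = y
    · subst hxy; rw [subst_all_self]; exact triv _
    by_cases hx : x ∈ φ.fv
    swap
    · rw [subst_of_not_mem (by simp [fv, hx])]; exact triv _
    obtain ⟨hy, hf⟩ : y ∉ s.fv ∧ φ.freeFor s x := by
      rcases hf with h | h | h
      · exact absurd h hxy
      · exact absurd hx h
      · exact h
    rw [subst_all_ne (Ne.symm hxy)]
    have hE : y ∉ (Formula.eq (.var x) s).fv := by simp [fv, Term.fv, hy, Ne.symm hxy]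
    have ih := ih hf
    have d1 : Provable T (((Formula.eq (.var x) s).and (all y φ)).imp (all y (φ.subst x s))) := by
      refine Provable.gen_imp y (by simp [fv] at hE ⊢; exact hE) ?_
      refine Provable.taut fun b hb => ?_
      have h1 := hb.thm ih
      have h2 := hb.thm (Provable.all_self (T := T) y φ)
      simp only [hb.imp, hb.and, hb.iff] at *
      tauto
    have d2 : Provable T (((Formula.eq (.var x) s).and (all y (φ.subst x s))).imp (all y φ)) := by
      refine Provable.gen_imp y (by simp [fv] at hE ⊢; exact hE) ?_
      refine Provable.taut fun b hb => ?_
      have h1 := hb.thm ih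
      have h2 := hb.thm (Provable.all_self (T := T) y (φ.subst x s))
      simp only [hb.imp, hb.and, hb.iff] at *
      tauto
    refine Provable.taut fun b hb => ?_
    have h1 := hb.thm d1
    have h2 := hb.thm d2
    simp only [hb.imp, hb.and, hb.iff] at *
    tauto
  | ex y φ ih =>
    intro hf
    by_cases hxy : x = y
    · subst hxy; rw [subst_ex_self]; exact triv _
    by_cases hx : x ∈ φ.fv
    swap
    · rw [subst_of_not_mem (by simp [fv, hx])]; exact triv _
    obtain ⟨hy, hf⟩ : y ∉ s.fv ∧ φ.freeFor s x := by
      rcases hf with h | h | h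
      · exact absurd h hxy
      · exact absurd hx h
      · exact h
    rw [subst_ex_ne (Ne.symm hxy)]
    have hE : y ∉ (Formula.eq (.var x) s).fv := by simp [fv, Term.fv, hy, Ne.symm hxy]
    have ih := ih hf
    have d1 : Provable T ((ex y φ).imp ((Formula.eq (.var x) s).imp (ex y (φ.subst x s)))) := by
      refine Provable.ex_elim y (by simp [fv] at hE ⊢; exact hE) ?_
      refine Provable.taut fun b hb => ?_
      have h1 := hb.thm ih
      have h2 := hb.thm (Provable.ex_self (T := T) y (φ.subst x s))
      simp only [hb.imp, hb.and, hb.iff] at *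
      tauto
    have d2 : Provable T ((ex y (φ.subst x s)).imp ((Formula.eq (.var x) s).imp (ex y φ))) := by
      refine Provable.ex_elim y (by simp [fv] at hE ⊢; exact hE) ?_
      refine Provable.taut fun b hb => ?_
      have h1 := hb.thm ih
      have h2 := hb.thm (Provable.ex_self (T := T) y φ)
      simp only [hb.imp, hb.and, hb.iff] at *
      tauto
    refine Provable.taut fun b hb => ?_
    have h1 := hb.thm d1
    have h2 := hb.thm d2
    simp only [hb.imp, hb.and, hb.iff] at *
    tauto

/-! ### ΣB-completeness -/

theorem fv_substAll_sub {φ : Formula} : ∀ {σ : ℕ → Term} {y : ℕ},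
    y ∈ (φ.substAll σ).fv → ∃ z ∈ φ.fv, y ∈ (σ z).fv := by
  induction φ with
  | falsum => intro σ y h; simp [substAll, fv] at h
  | eq t u | le t u =>
    intro σ y h
    simp only [substAll, fv, Finset.mem_union, Term.mem_fv_substAll] at h ⊢
    rcases h with ⟨z, h1, h2⟩ | ⟨z, h1, h2⟩
    · exact ⟨z, Or.inl h1, h2⟩
    · exact ⟨z, Or.inr h1, h2⟩
  | and φ ψ ih1 ih2 | or φ ψ ih1 ih2 | imp φ ψ ih1 ih2 =>
    intro σ y h
    simp only [substAll, fv, Finset.mem_union] at h ⊢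
    rcases h with h | h
    · obtain ⟨z, h1, h2⟩ := ih1 h
      exact ⟨z, Or.inl h1, h2⟩
    · obtain ⟨z, h1, h2⟩ := ih2 h
      exact ⟨z, Or.inr h1, h2⟩
  | neg φ ih | box φ ih =>
    intro σ y h
    exact ih h
  | all w φ ih | ex w φ ih =>
    intro σ y h
    simp only [substAll, fv, Finset.mem_erase] at h ⊢
    obtain ⟨z, h1, h2⟩ := ih h.2
    by_cases hz : z = w
    · subst hz
      simp [Term.fv] at h2
      exact absurd h2 h.1
    · rw [update_of_ne hz] at h2
      exact ⟨z, ⟨hz, h1⟩, h2⟩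

theorem not_mem_fv_subst_var {φ : Formula} {x y : ℕ} (h : y ≠ x) :
    x ∉ (φ.subst x (.var y)).fv := by
  intro hx
  obtain ⟨z, -, h2⟩ := fv_substAll_sub hx
  by_cases hz : z = x
  · subst hz
    simp [Term.fv] at h2
    exact h h2.symm
  · rw [update_of_ne hz] at h2
    simp [Term.fv] at h2
    exact hz h2.symm

theorem ball_subst {φ : Formula} {x y : ℕ} (h : x ≠ y) (hy : y ∉ φ.fv) (s : Term) :
    (ball x (.var y) φ).subst y s = ball x s φ := by
  rw [ball, subst_all_ne h]
  have : φ.subst y s = φ := subst_of_not_mem hy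
  simp only [ball, lt, subst, substAll, Term.substAll] at *
  rw [this]
  simp [h]

theorem box_ex (h4 : Extends T PAK4) (x : ℕ) {φ : Formula} (h : Provable T (φ.imp (.box φ))) :
    Provable T ((ex x φ).imp (.box (ex x φ))) := by
  refine Provable.ex_elim x (by simp [fv]) (Provable.taut fun b hb => ?_)
  rw [hb.imp]
  exact fun h1 => hb.box_mp h4 (Provable.ex_self x φ) (hb.mp h h1)

/-- `∀ x < y` step. -/
theorem ball_succ (h4 : Extends T PAK4) {x y : ℕ} {φ : Formula} (hxy : y ≠ x) (hy : y ∉ φ.vars) :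
    Provable T ((ball x (Term.succ (.var y)) φ).iff
      ((ball x (.var y) φ).and (φ.subst x (.var y)))) := by
  have hT := h4.paBox
  have hf : φ.freeFor (.var y) x := freeFor_var_of_not_mem_vars hy
  have d1 : Provable T ((ball x (Term.succ (.var y)) φ).imp (ball x (.var y) φ)) := by
    refine Provable.gen_imp x (by simp [ball, fv]) (Provable.taut fun b hb => ?_)
    have h1 := hb.thm (Provable.all_self (T := T) x ((lt (.var x) (Term.succ (.var y))).imp φ))
    rw [← ball] at h1
    simp only [hb.imp] at *
    exact fun h2 h3 => h1 h2 (hb.mp (pa_le_succ_right hT _ _) h3)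
  have d2 : Provable T ((ball x (Term.succ (.var y)) φ).imp (φ.subst x (.var y))) := by
    refine Provable.taut fun b hb => ?_
    have h1 := hb.thm (Provable.logic (T := T) (.allE x (.var y)
      ((lt (.var x) (Term.succ (.var y))).imp φ) ⟨trivial, hf⟩))
    rw [← ball] at h1
    have e : ((lt (.var x) (Term.succ (.var y))).imp φ).subst x (.var y) =
        (lt (.var y) (Term.succ (.var y))).imp (φ.subst x (.var y)) := by
      simp [subst, substAll, lt, Term.substAll, hxy]
    rw [e] at h1
    simp only [hb.imp] at *
    exact fun h2 => h1 h2 (hb.thm (pa_le_refl hT _))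
  have d3 : Provable T (((ball x (.var y) φ).and (φ.subst x (.var y))).imp
      (ball x (Term.succ (.var y)) φ)) := by
    refine Provable.gen_imp x ?_ (Provable.taut fun b hb => ?_)
    · have := not_mem_fv_subst_var (φ := φ) hxy
      simp [ball, fv, this]
    have h1 := hb.thm (Provable.all_self (T := T) x ((lt (.var x) (.var y)).imp φ))
    rw [← ball] at h1
    have h2 := hb.thm (leibniz h4 hf)
    simp only [hb.imp, hb.and, hb.iff] at *
    rintro ⟨h3, h5⟩ h6
    rcases hb.lt_cases hT h6 with h7 | h7
    · exact h1 h3 h7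
    · exact (h2 h7).2 h5
  refine Provable.taut fun b hb => ?_
  have h1 := hb.thm d1
  have h2 := hb.thm d2
  have h3 := hb.thm d3
  simp only [hb.imp, hb.and, hb.iff] at *
  tauto

theorem ball_zero (hT : Extends T PABox) (x : ℕ) (φ : Formula) :
    Provable T (ball x .zero φ) := by
  refine Provable.gen x (Provable.taut fun b hb => ?_)
  rw [hb.imp]
  exact fun h => (hb.not_lt_zero hT h).elim

theorem box_ball (h4 : Extends T PAK4) {x : ℕ} {t : Term} (hx : x ∉ t.fv) {φ : Formula}
    (h : Provable T (φ.imp (.box φ))) :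
    Provable T ((ball x t φ).imp (.box (ball x t φ))) := by
  have hT := h4.paBox
  obtain ⟨y, hy⟩ := exists_bound (insert x φ.vars)
  have hyx : y ≠ x := fun h => absurd (hy x (by simp)) (by omega)
  have hyv : y ∉ φ.vars := fun h => absurd (hy y (by simp [h])) (by omega)
  have hyf : y ∉ φ.fv := fun h => hyv (fv_subset_vars φ h)
  have hs : ∀ s, ((ball x (.var y) φ).imp (.box (ball x (.var y) φ))).subst y s =
      (ball x s φ).imp (.box (ball x s φ)) := by
    intro s
    have := ball_subst (Ne.symm hyx) hyf s
    simp only [subst, substAll] at *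
    rw [this]
  have hG : Provable T ((ball x (.var y) φ).imp (.box (ball x (.var y) φ))) := by
    refine ind hT y _ ?_ ?_
    · rw [hs]
      refine Provable.taut fun b hb => ?_
      rw [hb.imp]
      exact fun _ => hb.thm (ball_zero hT x φ).nec
    · rw [hs]
      refine Provable.taut fun b hb => ?_
      have h1 := ball_succ h4 hyx hyv
      have h2 := h.inst x (.var y) ⟨freeFor_var_of_not_mem_vars hyv,
        freeFor_var_of_not_mem_vars (φ := φ) hyv⟩
      have h3 := hb.thm h1
      have h5 := hb.mp h2
      simp only [hb.imp, hb.iff, hb.and] at *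
      intro h6 h7
      refine hb.box_mp2 h4 ?_ (h6 (h3.1 h7).1) (h5 (h3.1 h7).2)
      refine Provable.taut fun b hb => ?_
      have h3 := hb.thm h1
      simp only [hb.imp, hb.iff, hb.and] at *
      tauto
  have hf : (ball x (.var y) φ).freeFor t y :=
    Or.inr (Or.inr ⟨hx, trivial, freeFor_of_not_mem hyf⟩)
  rw [← hs]
  exact hG.inst y t ⟨hf, hf⟩

theorem not_ball (x : ℕ) (t : Term) (φ : Formula) :
    Provable T ((ball x t φ).neg.iff (bex x t φ.neg)) := by
  have d1 : Provable T ((bex x t φ.neg).neg.imp (ball x t φ)) := by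
    refine Provable.gen_imp x (by simp [bex, fv]) (Provable.taut fun b hb => ?_)
    have h1 := hb.thm (Provable.ex_self (T := T) x ((lt (.var x) t).and φ.neg))
    rw [← bex] at h1
    simp only [hb.imp, hb.and, hb.neg] at *
    tauto
  have d2 : Provable T ((bex x t φ.neg).imp (ball x t φ).neg) := by
    refine Provable.ex_elim x (by simp [ball, fv]) (Provable.taut fun b hb => ?_)
    have h1 := hb.thm (Provable.all_self (T := T) x ((lt (.var x) t).imp φ))
    rw [← ball] at h1
    simp only [hb.imp, hb.and, hb.neg] at *
    tauto
  refine Provable.taut fun b hb => ?_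
  have h1 := hb.thm d1
  have h2 := hb.thm d2
  simp only [hb.imp, hb.iff, hb.neg] at *
  tauto

theorem not_bex (x : ℕ) (t : Term) (φ : Formula) :
    Provable T ((bex x t φ).neg.iff (ball x t φ.neg)) := by
  have d1 : Provable T ((bex x t φ).neg.imp (ball x t φ.neg)) := by
    refine Provable.gen_imp x (by simp [bex, fv]) (Provable.taut fun b hb => ?_)
    have h1 := hb.thm (Provable.ex_self (T := T) x ((lt (.var x) t).and φ))
    rw [← bex] at h1
    simp only [hb.imp, hb.and, hb.neg] at *
    tauto
  have d2 : Provable T ((bex x t φ).imp (ball x t φ.neg).neg) := by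
    refine Provable.ex_elim x (by simp [ball, fv]) (Provable.taut fun b hb => ?_)
    have h1 := hb.thm (Provable.all_self (T := T) x ((lt (.var x) t).imp φ.neg))
    rw [← ball] at h1
    simp only [hb.imp, hb.and, hb.neg] at *
    tauto
  refine Provable.taut fun b hb => ?_
  have h1 := hb.thm d1
  have h2 := hb.thm d2
  simp only [hb.imp, hb.iff, hb.neg] at *
  tauto

theorem box_and (h4 : Extends T PAK4) {φ ψ : Formula} (h1 : Provable T (φ.imp (.box φ)))
    (h2 : Provable T (ψ.imp (.box ψ))) : Provable T ((φ.and ψ).imp (.box (φ.and ψ))) := by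
  refine Provable.taut fun b hb => ?_
  rw [hb.imp, hb.and]
  rintro ⟨h3, h5⟩
  exact hb.box_mp2 h4 (.logic (.andI _ _)) (hb.mp h1 h3) (hb.mp h2 h5)

theorem box_or (h4 : Extends T PAK4) {φ ψ : Formula} (h1 : Provable T (φ.imp (.box φ)))
    (h2 : Provable T (ψ.imp (.box ψ))) : Provable T ((φ.or ψ).imp (.box (φ.or ψ))) := by
  refine Provable.taut fun b hb => ?_
  rw [hb.imp, hb.or]
  rintro (h3 | h3)
  · exact hb.box_mp h4 (.logic (.orI1 _ _)) (hb.mp h1 h3)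
  · exact hb.box_mp h4 (.logic (.orI2 _ _)) (hb.mp h2 h3)

theorem box_congr (h4 : Extends T PAK4) {φ ψ : Formula} (h : Provable T (φ.iff ψ))
    (h1 : Provable T (ψ.imp (.box ψ))) : Provable T (φ.imp (.box φ)) := by
  refine Provable.taut fun b hb => ?_
  have h2 := hb.thm h
  have h3 := hb.thm h1
  simp only [hb.imp, hb.iff] at *
  intro h5
  refine hb.box_mp h4 (Provable.taut fun b hb => ?_) (h3 (h2.1 h5))
  have h2 := hb.thm h
  simp only [hb.imp, hb.iff] at *
  tauto

theorem box_delta0 (h4 : Extends T PAK4) {φ : Formula} (h : IsDelta0 φ) :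
    Provable T (φ.imp (.box φ)) ∧ Provable T (φ.neg.imp (.box φ.neg)) := by
  induction h with
  | falsum =>
    refine ⟨.logic (.falsumE _), Provable.taut fun b hb => ?_⟩
    rw [hb.imp]
    exact fun _ => hb.thm (Provable.taut fun b hb => by rw [hb.neg, hb.falsum]; exact id).nec
  | eq t u => exact ⟨box_eq h4 t u, box_not_eq h4 t u⟩
  | le t u => exact ⟨box_le h4 t u, box_not_le h4 t u⟩
  | @and φ ψ _ _ ih1 ih2 =>
    refine ⟨box_and h4 ih1.1 ih2.1, box_congr h4 (ψ := φ.neg.or ψ.neg) ?_ (box_or h4 ih1.2 ih2.2)⟩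
    exact Provable.taut fun b hb => by simp only [hb.iff, hb.and, hb.or, hb.neg]; tauto
  | @or φ ψ _ _ ih1 ih2 =>
    refine ⟨box_or h4 ih1.1 ih2.1, box_congr h4 (ψ := φ.neg.and ψ.neg) ?_ (box_and h4 ih1.2 ih2.2)⟩
    exact Provable.taut fun b hb => by simp only [hb.iff, hb.and, hb.or, hb.neg]; tauto
  | @imp φ ψ _ _ ih1 ih2 =>
    refine ⟨box_congr h4 (ψ := φ.neg.or ψ) ?_ (box_or h4 ih1.2 ih2.1),
      box_congr h4 (ψ := φ.and ψ.neg) ?_ (box_and h4 ih1.1 ih2.2)⟩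
    · exact Provable.taut fun b hb => by simp only [hb.iff, hb.imp, hb.or, hb.neg]; tauto
    · exact Provable.taut fun b hb => by simp only [hb.iff, hb.imp, hb.and, hb.neg]; tauto
  | @neg φ _ ih =>
    refine ⟨ih.2, box_congr h4 (ψ := φ) ?_ ih.1⟩
    exact Provable.taut fun b hb => by simp only [hb.iff, hb.neg]; tauto
  | ball hx _ ih =>
    exact ⟨box_ball h4 hx ih.1, box_congr h4 (not_ball _ _ _)
      (box_ex h4 _ (box_and h4 (box_le h4 _ _) ih.2))⟩
  | bex hx _ ih =>
    exact ⟨box_ex h4 _ (box_and h4 (box_le h4 _ _) ih.1),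
      box_congr h4 (not_bex _ _ _) (box_ball h4 hx ih.2)⟩

/-- The class ΣB, presented over Δ₀. -/
inductive IsSB : Formula → Prop
  | delta0 {φ : Formula} : IsDelta0 φ → IsSB φ
  | b (ψ : Formula) : IsSB (Formula.box ψ)
  | and {φ ψ : Formula} : IsSB φ → IsSB ψ → IsSB (φ.and ψ)
  | or {φ ψ : Formula} : IsSB φ → IsSB ψ → IsSB (φ.or ψ)
  | ex {x : ℕ} {φ : Formula} : IsSB φ → IsSB (Formula.ex x φ)
  | ball {x : ℕ} {t : Term} {φ : Formula} : x ∉ t.fv → IsSB φ → IsSB (Formula.ball x t φ)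

theorem IsSigma1.isSB {φ : Formula} (h : IsSigma1 φ) : IsSB φ := by
  induction h with
  | delta0 h => exact .delta0 h
  | and _ _ h1 h2 => exact .and h1 h2
  | or _ _ h1 h2 => exact .or h1 h2
  | ex _ h => exact .ex h
  | ball hx _ h => exact .ball hx h

theorem IsSigmaB.isSB {φ : Formula} (h : IsSigmaB φ) : IsSB φ := by
  induction h with
  | sigma1 h => exact h.isSB
  | b ψ => exact .b ψ
  | and _ _ h1 h2 => exact .and h1 h2
  | or _ _ h1 h2 => exact .or h1 h2
  | ex _ h => exact .ex h
  | ball hx _ h => exact .ball hx h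

theorem box_sigmaB (h4 : Extends T PAK4) {φ : Formula} (h : IsSB φ) :
    Provable T (φ.imp (.box φ)) := by
  induction h with
  | delta0 h => exact (box_delta0 h4 h).1
  | b ψ => exact h4 (ax4 ψ) (Or.inr ⟨ψ, rfl⟩)
  | and _ _ h1 h2 => exact box_and h4 h1 h2
  | or _ _ h1 h2 => exact box_or h4 h1 h2
  | ex _ h => exact box_ex h4 _ h
  | ball hx _ h => exact box_ball h4 hx h

end

/-! Safe substitutions preserve the classes. -/

theorem not_mem_safe {σ : ℕ → Term} (hσ : Safe σ) {x : ℕ} {t : Term} (hx : x ∉ t.fv) :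
    x ∉ (t.substAll σ).fv := by
  rw [Term.mem_fv_substAll]
  rintro ⟨z, h1, h2⟩
  have := hσ z h2
  simp at this
  exact hx (this ▸ h1)

theorem ball_substAll {σ : ℕ → Term} {x : ℕ} {t : Term} (hx : x ∉ t.fv) (φ : Formula) :
    (ball x t φ).substAll σ = ball x (t.substAll σ) (φ.substAll (update σ x (.var x))) := by
  simp only [ball, lt, substAll, Term.substAll, update_self]
  rw [Term.substAll_congr (t := t) (τ := σ)]
  intro y hy
  rw [update_of_ne]
  rintro rfl
  exact hx hy

theorem bex_substAll {σ : ℕ → Term} {x : ℕ} {t : Term} (hx : x ∉ t.fv) (φ : Formula) :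
    (bex x t φ).substAll σ = bex x (t.substAll σ) (φ.substAll (update σ x (.var x))) := by
  simp only [bex, lt, substAll, Term.substAll, update_self]
  rw [Term.substAll_congr (t := t) (τ := σ)]
  intro y hy
  rw [update_of_ne]
  rintro rfl
  exact hx hy

theorem IsDelta0.substAll {φ : Formula} (h : IsDelta0 φ) : ∀ {σ : ℕ → Term}, Safe σ →
    IsDelta0 (φ.substAll σ) := by
  induction h with
  | falsum => intro σ _; exact .falsum
  | eq t u => intro σ _; exact .eq _ _
  | le t u => intro σ _; exact .le _ _
  | and _ _ h1 h2 => intro σ hσ; exact .and (h1 hσ) (h2 hσ)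
  | or _ _ h1 h2 => intro σ hσ; exact .or (h1 hσ) (h2 hσ)
  | imp _ _ h1 h2 => intro σ hσ; exact .imp (h1 hσ) (h2 hσ)
  | neg _ h => intro σ hσ; exact .neg (h hσ)
  | ball hx _ h =>
    intro σ hσ
    rw [ball_substAll hx]
    exact .ball (not_mem_safe hσ hx) (h (hσ.update _))
  | bex hx _ h =>
    intro σ hσ
    rw [bex_substAll hx]
    exact .bex (not_mem_safe hσ hx) (h (hσ.update _))

theorem IsSB.substAll {φ : Formula} (h : IsSB φ) : ∀ {σ : ℕ → Term}, Safe σ →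
    IsSB (φ.substAll σ) := by
  induction h with
  | delta0 h => intro σ hσ; exact .delta0 (h.substAll hσ)
  | b ψ => intro σ hσ; exact .b _
  | and _ _ h1 h2 => intro σ hσ; exact .and (h1 hσ) (h2 hσ)
  | or _ _ h1 h2 => intro σ hσ; exact .or (h1 hσ) (h2 hσ)
  | ex _ h => intro σ hσ; exact .ex (h (hσ.update _))
  | ball hx _ h =>
    intro σ hσ
    rw [ball_substAll hx]
    exact .ball (not_mem_safe hσ hx) (h (hσ.update _))

end ModalArith


namespace ModalArith

open Function Formula

/-! ### Numeralwise completeness for Δ₀ formulas -/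

section
variable {T : Set Formula}

theorem num_add (hT : Extends T PABox) (n m : ℕ) :
    Provable T (.eq ((Term.numeral n).add (Term.numeral m)) (Term.numeral (n + m))) := by
  induction m with
  | zero => exact pa_add_zero hT _
  | succ m ih =>
    exact Provable.taut fun b hb => hb.trans (hb.thm (pa_add_succ hT _ _)) (hb.succ (hb.thm ih))

theorem num_mul (hT : Extends T PABox) (n m : ℕ) :
    Provable T (.eq ((Term.numeral n).mul (Term.numeral m)) (Term.numeral (n * m))) := by
  induction m with
  | zero => exact pa_mul_zero hT _
  | succ m ih =>
    exact Provable.taut fun b hb => hb.trans (hb.thm (pa_mul_succ hT _ _))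
      (hb.trans (hb.add (hb.thm ih) (hb.refl _)) (hb.thm (num_add hT _ _)))

theorem num_le (hT : Extends T PABox) {n m : ℕ} (h : n ≤ m) :
    Provable T (.le (Term.numeral n) (Term.numeral m)) := by
  obtain ⟨k, rfl⟩ := Nat.exists_eq_add_of_le h
  exact (pa_leI hT _ _ (Term.numeral k)).mp (num_add hT n k)

theorem num_lt (hT : Extends T PABox) {n m : ℕ} (h : n < m) :
    Provable T (.lt (Term.numeral n) (Term.numeral m)) :=
  num_le hT (n := n + 1) h

theorem num_not_le (hT : Extends T PABox) {n m : ℕ} (h : ¬ n ≤ m) :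
    Provable T (Formula.le (Term.numeral n) (Term.numeral m)).neg :=
  Provable.taut fun b hb => by
    rw [hb.neg, hb.not_le hT]
    exact hb.thm (num_lt hT (by omega))

theorem num_ne (hT : Extends T PABox) {n m : ℕ} (h : n ≠ m) :
    Provable T (Formula.eq (Term.numeral n) (Term.numeral m)).neg :=
  Provable.taut fun b hb => by
    rw [hb.neg, hb.ne_iff hT]
    rcases lt_or_gt_of_ne h with h | h
    · exact Or.inl (hb.thm (num_lt hT h))
    · exact Or.inr (hb.thm (num_lt hT h))

theorem term_eval (hT : Extends T PABox) (t : Term) (v : ℕ → ℕ) :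
    Provable T (.eq (t.substAll (numeralSubst v)) (Term.numeral (t.val v))) := by
  induction t with
  | var x => exact .logic (.eqRefl _)
  | zero => exact .logic (.eqRefl _)
  | succ t ih => exact (Provable.logic (.eqSucc _ _)).mp ih
  | add t u ih1 ih2 =>
    exact Provable.taut fun b hb => hb.trans (hb.add (hb.thm ih1) (hb.thm ih2))
      (hb.thm (num_add hT _ _))
  | mul t u ih1 ih2 =>
    exact Provable.taut fun b hb => hb.trans (hb.mul (hb.thm ih1) (hb.thm ih2))
      (hb.thm (num_mul hT _ _))

theorem bounded_all (h4 : Extends T PAK4) {x n : ℕ} {φ : Formula}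
    (h : ∀ k < n, Provable T (φ.subst x (Term.numeral k))) :
    Provable T ((lt (.var x) (Term.numeral n)).imp φ) := by
  have hT := h4.paBox
  induction n with
  | zero =>
    refine Provable.taut fun b hb => ?_
    rw [hb.imp]
    exact fun h => (hb.not_lt_zero hT h).elim
  | succ n ih =>
    have ih := ih fun k hk => h k (by omega)
    refine Provable.taut fun b hb => ?_
    rw [hb.imp]
    intro h1
    rcases hb.lt_cases hT h1 with h2 | h2
    · exact hb.mp ih h2
    · have h3 := hb.mp (leibniz h4 (freeFor_of_fv (s := Term.numeral n) (by simp) φ)) h2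
      rw [hb.iff] at h3
      exact h3.2 (hb.thm (h n (by omega)))

theorem bounded_ex (h4 : Extends T PAK4) {x n : ℕ} {φ : Formula}
    (h : ∀ k < n, Provable T (φ.subst x (Term.numeral k)).neg) :
    Provable T (φ.imp (.le (Term.numeral n) (.var x))) := by
  have := bounded_all h4 (x := x) (n := n) (φ := φ.neg) h
  refine Provable.taut fun b hb => ?_
  have h1 := hb.thm this
  have h2 := hb.not_le h4.paBox (a := Term.numeral n) (c := .var x)
  simp only [hb.imp, hb.neg, lt] at *
  tauto

theorem ball_inst {x : ℕ} {t : Term} (hx : x ∉ t.fv) (φ : Formula) (k : ℕ) :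
    Provable T ((ball x t φ).imp ((lt (Term.numeral k) t).imp (φ.subst x (Term.numeral k)))) := by
  have := Provable.logic (T := T) (.allE x (Term.numeral k) ((lt (.var x) t).imp φ)
    (freeFor_of_fv (by simp) _))
  have h1 : t.substAll (update Term.var x (Term.numeral k)) = t := Term.substAll_id (by
    intro y hy
    rw [update_of_ne]
    rintro rfl
    exact hx hy)
  simpa [ball, subst, substAll, lt, Term.substAll, h1] using this

theorem bex_inst {x : ℕ} {t : Term} (hx : x ∉ t.fv) (φ : Formula) (k : ℕ) :
    Provable T ((lt (Term.numeral k) t).imp ((φ.subst x (Term.numeral k)).imp (bex x t φ))) := by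
  have := ball_inst (T := T) hx φ.neg k
  have h2 := not_bex (T := T) x t φ
  refine Provable.taut fun b hb => ?_
  have h1 := hb.thm this
  have h2 := hb.thm h2
  change b (Formula.imp _ (Formula.imp _ (φ.subst x (Term.numeral k)).neg)) at h1
  simp only [hb.imp, hb.neg, hb.iff] at *
  tauto

theorem delta0_complete (h4 : Extends T PAK4) {δ : Formula} (h : IsDelta0 δ) : ∀ v : ℕ → ℕ,
    (δ.val v → Provable T (δ.substAll (numeralSubst v))) ∧
    (¬ δ.val v → Provable T (δ.substAll (numeralSubst v)).neg) := by
  have hT := h4.paBox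
  have closed : ∀ (t : Term) (v : ℕ → ℕ) (x : ℕ), x ∉ (t.substAll (numeralSubst v)).fv := by
    intro t v x
    rw [Term.mem_fv_substAll]
    rintro ⟨z, -, h2⟩
    simp [numeralSubst] at h2
  have key : ∀ (x : ℕ) (t : Term) (φ : Formula) (v : ℕ → ℕ),
      (∀ k < t.val v, Provable T (φ.substAll (numeralSubst (update v x k)))) →
      Provable T (ball x (t.substAll (numeralSubst v))
        (φ.substAll (update (numeralSubst v) x (.var x)))) := by
    intro x t φ v h
    refine Provable.gen x ?_
    have h1 := bounded_all h4 (x := x) (n := t.val v)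
      (φ := φ.substAll (update (numeralSubst v) x (.var x)))
      (fun k hk => by rw [substAll_numeral_update]; exact h k hk)
    refine Provable.taut fun b hb => ?_
    rw [hb.imp]
    exact fun h2 => hb.mp h1 (hb.le (hb.refl _) (hb.thm (term_eval hT t v)) h2)
  have lt_eval : ∀ (t : Term) (v : ℕ → ℕ) (k : ℕ), k < t.val v →
      Provable T (lt (Term.numeral k) (t.substAll (numeralSubst v))) := by
    intro t v k hk
    exact Provable.taut fun b hb => hb.le (hb.refl _) (hb.symm (hb.thm (term_eval hT t v)))
      (hb.thm (num_lt hT hk))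
  induction h with
  | falsum =>
    intro v
    exact ⟨fun h => h.elim, fun _ => Provable.taut fun b hb => by
      change b (Formula.falsum.neg)
      rw [hb.neg, hb.falsum]; exact id⟩
  | eq t u =>
    intro v
    refine ⟨fun h => Provable.taut fun b hb => ?_, fun h => Provable.taut fun b hb => ?_⟩
    · have h1 := hb.thm (term_eval hT t v)
      have h2 := hb.thm (term_eval hT u v)
      simp only [val] at h
      rw [h] at h1
      exact hb.trans h1 (hb.symm h2)
    · have h1 := hb.thm (term_eval hT t v)
      have h2 := hb.thm (term_eval hT u v)
      have h3 := hb.thm (num_ne hT h)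
      rw [hb.neg] at *
      intro h5
      exact h3 (hb.trans (hb.symm h1) (hb.trans h5 h2))
  | le t u =>
    intro v
    refine ⟨fun h => Provable.taut fun b hb => ?_, fun h => Provable.taut fun b hb => ?_⟩
    · have h1 := hb.thm (term_eval hT t v)
      have h2 := hb.thm (term_eval hT u v)
      exact hb.le (hb.symm h1) (hb.symm h2) (hb.thm (num_le hT h))
    · have h1 := hb.thm (term_eval hT t v)
      have h2 := hb.thm (term_eval hT u v)
      have h3 := hb.thm (num_not_le hT h)
      rw [hb.neg] at *
      intro h5
      exact h3 (hb.le h1 h2 h5)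
  | @and φ ψ _ _ ih1 ih2 =>
    intro v
    have h1 := ih1 v
    have h2 := ih2 v
    constructor
    · rintro ⟨h3, h5⟩
      exact ((Provable.logic (.andI _ _)).mp (h1.1 h3)).mp (h2.1 h5)
    · intro h3
      change ¬ (φ.val v ∧ ψ.val v) at h3
      change Provable T ((φ.substAll (numeralSubst v)).and (ψ.substAll (numeralSubst v))).neg
      by_cases h5 : φ.val v
      · have := h2.2 (fun h => h3 ⟨h5, h⟩)
        exact Provable.taut fun b hb => by
          have := hb.thm this
          simp only [hb.neg, hb.and] at *; tauto
      · have := h1.2 h5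
        exact Provable.taut fun b hb => by
          have := hb.thm this
          simp only [hb.neg, hb.and] at *; tauto
  | @or φ ψ _ _ ih1 ih2 =>
    intro v
    have h1 := ih1 v
    have h2 := ih2 v
    constructor
    · rintro (h3 | h3)
      · exact (Provable.logic (.orI1 _ _)).mp (h1.1 h3)
      · exact (Provable.logic (.orI2 _ _)).mp (h2.1 h3)
    · intro h3
      change ¬ (φ.val v ∨ ψ.val v) at h3
      change Provable T ((φ.substAll (numeralSubst v)).or (ψ.substAll (numeralSubst v))).neg
      have h5 := h1.2 (fun h => h3 (Or.inl h))
      have h6 := h2.2 (fun h => h3 (Or.inr h))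
      exact Provable.taut fun b hb => by
        have := hb.thm h5
        have := hb.thm h6
        simp only [hb.neg, hb.or] at *; tauto
  | @imp φ ψ _ _ ih1 ih2 =>
    intro v
    have h1 := ih1 v
    have h2 := ih2 v
    change (((φ.val v → ψ.val v)) → Provable T ((φ.substAll (numeralSubst v)).imp
        (ψ.substAll (numeralSubst v)))) ∧ (¬ (φ.val v → ψ.val v) →
        Provable T ((φ.substAll (numeralSubst v)).imp (ψ.substAll (numeralSubst v))).neg)
    by_cases h3 : φ.val v
    · by_cases h5 : ψ.val v
      · exact ⟨fun _ => (Provable.logic (.imp1 _ _)).mp (h2.1 h5), fun h => (h fun _ => h5).elim⟩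
      · refine ⟨fun h => (h5 (h h3)).elim, fun _ => ?_⟩
        exact Provable.taut fun b hb => by
          have := hb.thm (h1.1 h3)
          have := hb.thm (h2.2 h5)
          simp only [hb.neg, hb.imp] at *; tauto
    · exact ⟨fun _ => (Provable.logic (.negE _ _)).mp (h1.2 h3),
        fun h => (h fun h => (h3 h).elim).elim⟩
  | @neg φ _ ih =>
    intro v
    refine ⟨fun h => (ih v).2 h, fun h => ?_⟩
    have h1 := (ih v).1 (not_not.1 h)
    change Provable T (φ.substAll (numeralSubst v)).neg.neg
    exact Provable.taut fun b hb => by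
      have := hb.thm h1
      simp only [hb.neg] at *; tauto
  | @ball x t φ hx _ ih =>
    intro v
    rw [ball_substAll hx]
    have hval : (ball x t φ).val v ↔ ∀ k < t.val v, φ.val (update v x k) := by
      simp only [ball, lt, val, Term.val, update_self]
      refine forall_congr' fun k => ?_
      rw [Term.val_congr (w := v)]
      · rfl
      · intro y hy
        rw [update_of_ne]
        rintro rfl
        exact hx hy
    rw [hval]
    constructor
    · intro h
      exact key x t φ v fun k hk => (ih _).1 (h k hk)
    · intro h
      push Not at h
      obtain ⟨k, hk, h1⟩ := h
      have h2 := (ih _).2 h1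
      have h3 := ball_inst (T := T) (closed t v x)
        (φ.substAll (update (numeralSubst v) x (.var x))) k
      rw [substAll_numeral_update] at h3
      refine Provable.taut fun b hb => ?_
      have h2 := hb.thm h2
      have h3 := hb.thm h3
      have h5 := hb.thm (lt_eval t v k hk)
      simp only [hb.neg, hb.imp] at *
      tauto
  | @bex x t φ hx _ ih =>
    intro v
    rw [bex_substAll hx]
    have hval : (bex x t φ).val v ↔ ∃ k < t.val v, φ.val (update v x k) := by
      simp only [bex, lt, val, Term.val, update_self]
      refine exists_congr fun k => ?_
      rw [Term.val_congr (w := v)]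
      · rfl
      · intro y hy
        rw [update_of_ne]
        rintro rfl
        exact hx hy
    rw [hval]
    constructor
    · rintro ⟨k, hk, h1⟩
      have h2 := (ih _).1 h1
      have h3 := bex_inst (T := T) (closed t v x)
        (φ.substAll (update (numeralSubst v) x (.var x))) k
      rw [substAll_numeral_update] at h3
      exact (h3.mp (lt_eval t v k hk)).mp h2
    · intro h
      push Not at h
      have h1 := key x t φ.neg v fun k hk => (ih _).2 (h k hk)
      have h2 := not_bex (T := T) x (t.substAll (numeralSubst v))
        (φ.substAll (update (numeralSubst v) x (.var x)))
      refine Provable.taut fun b hb => ?_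
      have h1 := hb.thm h1
      have h2 := hb.thm h2
      change b (ball x _ (φ.substAll (update (numeralSubst v) x (.var x))).neg) at h1
      rw [hb.iff] at h2
      exact h2.2 h1

/-- Δ₀ formulas have their standard truth value under `PiSat`. -/
theorem PiSat_delta0 {δ : Formula} (h : IsDelta0 δ) : ∀ v : ℕ → ℕ, PiSat T δ v ↔ δ.val v := by
  induction h with
  | falsum | eq | le => intro v; exact Iff.rfl
  | and _ _ h1 h2 => intro v; exact and_congr (h1 v) (h2 v)
  | or _ _ h1 h2 => intro v; exact or_congr (h1 v) (h2 v)
  | imp _ _ h1 h2 => intro v; exact imp_congr (h1 v) (h2 v)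
  | neg _ h => intro v; exact not_congr (h v)
  | ball _ _ h => intro v; exact forall_congr' fun k => imp_congr Iff.rfl (h _)
  | bex _ _ h => intro v; exact exists_congr fun k => and_congr Iff.rfl (h _)

end

end ModalArith


namespace ModalArith

open Function Formula

/-! ### Horn programs and their Σ₁ definability -/

/-- Expressions in Horn clauses. -/
inductive Ex : Type
  | v : ℕ → Ex
  | c : ℕ → Ex
  | s : Ex → Ex
  | p : Ex → Ex → Ex

/-- Value of an expression. -/
def Ex.eval (v : ℕ → ℕ) : Ex → ℕ
  | .v i => v i
  | .c n => n
  | .s e => e.eval v + 1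
  | .p e f => Nat.pair (e.eval v) (f.eval v)

/-- Bound on the variables of an expression. -/
def Ex.bd : Ex → ℕ
  | .v i => i + 1
  | .c _ => 0
  | .s e => e.bd
  | .p e f => max e.bd f.bd

/-- `X` is closed under the clause instance. -/
def Imps (X : ℕ → Prop) (v : ℕ → ℕ) : List Ex → Ex → Prop
  | [], c => X (c.eval v)
  | p :: ps, c => X (p.eval v) → Imps X v ps c

/-- `X` is closed under the program. -/
def Holds (X : ℕ → Prop) : List (List Ex × Ex) → Prop
  | [] => True
  | r :: L => (∀ v : ℕ → ℕ, Imps X v r.1 r.2) ∧ Holds X L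

theorem imps_iff {X : ℕ → Prop} {v : ℕ → ℕ} {ps : List Ex} {c : Ex} :
    Imps X v ps c ↔ ((∀ p ∈ ps, X (p.eval v)) → X (c.eval v)) := by
  induction ps with
  | nil => simp [Imps]
  | cons p ps ih => simp [Imps, ih]

theorem holds_iff {X : ℕ → Prop} {L : List (List Ex × Ex)} :
    Holds X L ↔ ∀ r ∈ L, ∀ v : ℕ → ℕ, (∀ p ∈ r.1, X (p.eval v)) → X (r.2.eval v) := by
  induction L with
  | nil => simp [Holds]
  | cons r L ih => rw [Holds, ih, List.forall_mem_cons]; simp only [imps_iff]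

theorem holds_append {X : ℕ → Prop} {L M : List (List Ex × Ex)} :
    Holds X (L ++ M) ↔ Holds X L ∧ Holds X M := by
  simp only [holds_iff, List.mem_append]
  exact ⟨fun h => ⟨fun r hr => h r (Or.inl hr), fun r hr => h r (Or.inr hr)⟩,
    fun h r hr => hr.elim (h.1 r) (h.2 r)⟩

/-- Derivability by a Horn program. -/
inductive Dv (R : List (List Ex × Ex)) : ℕ → Prop
  | mk (r : List Ex × Ex) (hr : r ∈ R) (v : ℕ → ℕ) (h : ∀ p ∈ r.1, Dv R (p.eval v)) :
      Dv R (r.2.eval v)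

theorem Dv.holds (R : List (List Ex × Ex)) : Holds (Dv R) R :=
  holds_iff.2 fun r hr v h => .mk r hr v h

theorem Dv.sound {R : List (List Ex × Ex)} {X : ℕ → Prop} (hX : Holds X R) {n : ℕ}
    (h : Dv R n) : X n := by
  induction h with
  | mk r hr v _ ih => exact holds_iff.1 hX r hr v ih

/-- Lists witnessing derivability. -/
def GoodL (R : List (List Ex × Ex)) (L : List ℕ) : Prop :=
  ∀ i (_ : i < L.length), ∃ r ∈ R, ∃ v : ℕ → ℕ, L[i] = r.2.eval v ∧
    ∀ p ∈ r.1, ∃ j, ∃ _ : j < L.length, j < i ∧ L[j] = p.eval v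

theorem GoodL.append {R : List (List Ex × Ex)} {L M : List ℕ} (hL : GoodL R L) (hM : GoodL R M) :
    GoodL R (L ++ M) := by
  intro i hi
  by_cases h : i < L.length
  · obtain ⟨r, hr, v, h1, h2⟩ := hL i h
    refine ⟨r, hr, v, by rw [List.getElem_append_left h, h1], fun p hp => ?_⟩
    obtain ⟨j, hj, h3, h4⟩ := h2 p hp
    exact ⟨j, by simp; omega, h3, by rw [List.getElem_append_left hj, h4]⟩
  · simp at hi
    obtain ⟨r, hr, v, h1, h2⟩ := hM (i - L.length) (by omega)
    refine ⟨r, hr, v, by rw [List.getElem_append_right (by omega), h1], fun p hp => ?_⟩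
    obtain ⟨j, hj, h3, h4⟩ := h2 p hp
    refine ⟨j + L.length, by simp; omega, by omega, ?_⟩
    rw [List.getElem_append_right (by omega)]
    simp [h4]

theorem Dv.exists_good {R : List (List Ex × Ex)} {n : ℕ} (h : Dv R n) :
    ∃ L, GoodL R L ∧ n ∈ L := by
  induction h with
  | mk r hr v _ ih =>
    have key : ∀ ps : List Ex, (∀ p ∈ ps, p ∈ r.1) →
        ∃ L, GoodL R L ∧ ∀ p ∈ ps, p.eval v ∈ L := by
      intro ps
      induction ps with
      | nil => intro _; exact ⟨[], fun i hi => absurd hi (by simp), by simp⟩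
      | cons p ps ih2 =>
        intro hps
        obtain ⟨L, h1, h2⟩ := ih2 fun q hq => hps q (by simp [hq])
        obtain ⟨M, h3, h4⟩ := ih p (hps p (by simp))
        refine ⟨L ++ M, h1.append h3, ?_⟩
        intro q hq
        rcases List.mem_cons.1 hq with rfl | hq
        · simp [h4]
        · simp [h2 q hq]
    obtain ⟨L, h1, h2⟩ := key r.1 fun _ h => h
    refine ⟨L ++ [r.2.eval v], ?_, by simp⟩
    intro i hi
    by_cases h : i < L.length
    · obtain ⟨r, hr, v, h1, h2⟩ := h1 i h
      refine ⟨r, hr, v, by rw [List.getElem_append_left h, h1], fun p hp => ?_⟩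
      obtain ⟨j, hj, h3, h4⟩ := h2 p hp
      exact ⟨j, by simp; omega, h3, by rw [List.getElem_append_left hj, h4]⟩
    · simp at hi
      have hi : i = L.length := by omega
      subst hi
      refine ⟨r, hr, v, by simp, fun p hp => ?_⟩
      obtain ⟨j, hj, h4⟩ := List.mem_iff_getElem.1 (h2 p hp)
      exact ⟨j, by simp; omega, hj, by rw [List.getElem_append_left hj, h4]⟩

/-- Gödel's β function with separate arguments. -/
def bt (a b i : ℕ) : ℕ := a % ((i + 1) * b + 1)

theorem dv_iff {R : List (List Ex × Ex)} {n : ℕ} : Dv R n ↔ ∃ a b l, bt a b l = n ∧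
    ∀ i < l + 1, ∃ r ∈ R, ∃ v : ℕ → ℕ, bt a b i = r.2.eval v ∧
      ∀ p ∈ r.1, ∃ j < i, bt a b j = p.eval v := by
  constructor
  · intro h
    obtain ⟨L, hL, hn⟩ := h.exists_good
    have hb : ∀ i (hi : i < L.length),
        bt (Nat.unbeta L).unpair.1 (Nat.unbeta L).unpair.2 i = L[i] := by
      intro i hi
      exact Nat.beta_unbeta_coe L ⟨i, hi⟩
    obtain ⟨l, hl, rfl⟩ := List.mem_iff_getElem.1 hn
    refine ⟨_, _, l, hb l hl, fun i hi => ?_⟩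
    obtain ⟨r, hr, v, h1, h2⟩ := hL i (by omega)
    refine ⟨r, hr, v, by rw [hb i (by omega), h1], fun p hp => ?_⟩
    obtain ⟨j, hj, h3, h4⟩ := h2 p hp
    exact ⟨j, h3, by rw [hb j hj, h4]⟩
  · rintro ⟨a, b, l, rfl, h⟩
    have : ∀ i, i < l + 1 → Dv R (bt a b i) := by
      intro i
      induction i using Nat.strong_induction_on with
      | _ i ih =>
        intro hi
        obtain ⟨r, hr, v, h1, h2⟩ := h i hi
        rw [h1]
        refine .mk r hr v fun p hp => ?_
        obtain ⟨j, hj, h3⟩ := h2 p hp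
        rw [← h3]
        exact ih j hj (by omega)
    exact this l (by omega)

/-! Building the formula. -/

/-- `x = pair y z`. -/
def pairF (x y z : ℕ) : Formula :=
  ((lt (.var y) (.var z)).and (.eq (.var x) (((Term.var z).mul (.var z)).add (.var y)))).or
  ((Formula.le (.var z) (.var y)).and
    (.eq (.var x) ((((Term.var y).mul (.var y)).add (.var y)).add (.var z))))

theorem pairF_val {x y z : ℕ} {v : ℕ → ℕ} : (pairF x y z).val v ↔ v x = Nat.pair (v y) (v z) := by
  simp only [pairF, val, lt, Term.val, Nat.pair]
  split_ifs with h <;> constructor <;> intro h1 <;> omega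

theorem pairF_delta0 {x y z : ℕ} : IsDelta0 (pairF x y z) :=
  .or (.and (.le _ _) (.eq _ _)) (.and (.le _ _) (.eq _ _))

/-- `x = e`, where the variables of `e` start at `d` and auxiliary variables at `k`. -/
def graphF (d : ℕ) : Ex → ℕ → ℕ → Formula
  | .v i, x, _ => .eq (.var x) (.var (d + i))
  | .c n, x, _ => .eq (.var x) (Term.numeral n)
  | .s e, x, k => .ex k ((graphF d e k (k + 1)).and (.eq (.var x) (Term.succ (.var k))))
  | .p e f, x, k => .ex k (.ex (k + 1) (((graphF d e k (k + 2)).and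
      (graphF d f (k + 1) (k + 2))).and (pairF x k (k + 1))))

theorem graphF_sigma1 (d : ℕ) (e : Ex) : ∀ x k, IsSigma1 (graphF d e x k) := by
  induction e with
  | v i => intro x k; exact .delta0 (.eq _ _)
  | c n => intro x k; exact .delta0 (.eq _ _)
  | s e ih => intro x k; exact .ex (.and (ih _ _) (.delta0 (.eq _ _)))
  | p e f ih1 ih2 =>
    intro x k
    exact .ex (.ex (.and (.and (ih1 _ _) (ih2 _ _)) (.delta0 pairF_delta0)))

theorem Ex.eval_congr {e : Ex} {v w : ℕ → ℕ} (h : ∀ i < e.bd, v i = w i) :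
    e.eval v = e.eval w := by
  induction e with
  | v i => exact h i (Nat.lt_succ_self i)
  | c n => rfl
  | s e ih => simp only [Ex.eval]; rw [ih h]
  | p e f ih1 ih2 =>
    simp only [Ex.eval]
    rw [ih1 fun i hi => h i (lt_of_lt_of_le hi (le_max_left _ _)),
      ih2 fun i hi => h i (lt_of_lt_of_le hi (le_max_right _ _))]

theorem graphF_val (d : ℕ) (e : Ex) : ∀ {x k : ℕ} {v : ℕ → ℕ}, x < k → d + e.bd ≤ k →
    ((graphF d e x k).val v ↔ v x = e.eval fun i => v (d + i)) := by
  induction e with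
  | v i => intros; exact Iff.rfl
  | c n => intros; simp [graphF, val, Term.val, Ex.eval]
  | s e ih =>
    intro x k v hx hk
    simp only [Ex.bd] at hk
    have h1 : ∀ n, (fun i => update v k n (d + i)) = fun i => if d + i = k then n else v (d + i) := by
      intro n; funext i; simp [update_apply]
    have h2 : ∀ n, (e.eval fun i => update v k n (d + i)) = e.eval fun i => v (d + i) := by
      intro n
      refine Ex.eval_congr fun i hi => ?_
      rw [update_of_ne (by omega)]
    simp only [graphF, val, Term.val, Ex.eval, ih (Nat.lt_succ_self k) (by omega : d + e.bd ≤ k + 1),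
      h2, update_self, update_of_ne (by omega : x ≠ k)]
    simp
  | p e f ih1 ih2 =>
    intro x k v hx hk
    simp only [Ex.bd] at hk
    have hk1 : d + e.bd ≤ k := le_trans (by have := le_max_left e.bd f.bd; omega) hk
    have hk2 : d + f.bd ≤ k := le_trans (by have := le_max_right e.bd f.bd; omega) hk
    have h2 : ∀ (e : Ex), d + e.bd ≤ k → ∀ n m,
        (e.eval fun i => update (update v k n) (k + 1) m (d + i)) = e.eval fun i => v (d + i) := by
      intro e he n m
      refine Ex.eval_congr fun i hi => ?_
      rw [update_of_ne (by omega), update_of_ne (by omega)]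
    simp only [graphF, val, Ex.eval, ih1 (by omega : k < k + 2) (by omega : d + e.bd ≤ k + 2),
      ih2 (by omega : k + 1 < k + 2) (by omega : d + f.bd ≤ k + 2), pairF_val,
      h2 e hk1, h2 f hk2, update_self, update_of_ne (by omega : x ≠ k),
      update_of_ne (by omega : x ≠ k + 1), update_of_ne (by omega : k ≠ k + 1)]
    constructor
    · rintro ⟨a, b, ⟨rfl, rfl⟩, h⟩; exact h
    · intro h; exact ⟨_, _, ⟨rfl, rfl⟩, h⟩

/-- Block of existential quantifiers. -/
def exN (s : ℕ) : ℕ → Formula → Formula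
  | 0, φ => φ
  | k + 1, φ => exN s k (.ex (s + k) φ)

theorem exN_sigma1 {s : ℕ} : ∀ {k : ℕ} {φ : Formula}, IsSigma1 φ → IsSigma1 (exN s k φ)
  | 0, _, h => h
  | k + 1, _, h => exN_sigma1 (k := k) (.ex h)

theorem exN_val {s : ℕ} : ∀ {k : ℕ} {φ : Formula} {v : ℕ → ℕ}, (exN s k φ).val v ↔
    ∃ u : ℕ → ℕ, (∀ x, x < s ∨ s + k ≤ x → u x = v x) ∧ φ.val u
  | 0, φ, v => by
    constructor
    · intro h; exact ⟨v, fun _ _ => rfl, h⟩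
    · rintro ⟨u, hu, h⟩
      have : u = v := funext fun x => hu x (by omega)
      rwa [← this]
  | k + 1, φ, v => by
    rw [exN, exN_val]
    constructor
    · rintro ⟨u, hu, n, h⟩
      refine ⟨_, fun x hx => ?_, h⟩
      rw [update_of_ne (by omega)]
      exact hu x (by omega)
    · rintro ⟨u, hu, h⟩
      refine ⟨update u (s + k) (v (s + k)), fun x hx => ?_, u (s + k), ?_⟩
      · by_cases hxs : x = s + k
        · subst hxs; simp
        · rw [update_of_ne hxs]; exact hu x (by omega)
      · simpa using h

/-- Disjunction of a list. -/
def disjF : List Formula → Formula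
  | [] => .falsum
  | φ :: L => φ.or (disjF L)

theorem disjF_val {L : List Formula} {v : ℕ → ℕ} : (disjF L).val v ↔ ∃ φ ∈ L, φ.val v := by
  induction L with
  | nil => simp [disjF, val]
  | cons φ L ih => simp [disjF, val, ih]

theorem disjF_sigma1 {L : List Formula} (h : ∀ φ ∈ L, IsSigma1 φ) : IsSigma1 (disjF L) := by
  induction L with
  | nil => exact .delta0 .falsum
  | cons φ L ih => exact .or (h φ (by simp)) (ih fun ψ hψ => h ψ (by simp [hψ]))

/-- Conjunction of a list. -/
def conjF : List Formula → Formula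
  | [] => .eq .zero .zero
  | φ :: L => φ.and (conjF L)

theorem conjF_val {L : List Formula} {v : ℕ → ℕ} : (conjF L).val v ↔ ∀ φ ∈ L, φ.val v := by
  induction L with
  | nil => simp [conjF, val]
  | cons φ L ih => simp [conjF, val, ih]

theorem conjF_sigma1 {L : List Formula} (h : ∀ φ ∈ L, IsSigma1 φ) : IsSigma1 (conjF L) := by
  induction L with
  | nil => exact .delta0 (.eq _ _)
  | cons φ L ih => exact .and (h φ (by simp)) (ih fun ψ hψ => h ψ (by simp [hψ]))

/-- `x = bt a b i`, with auxiliary variable `q`. -/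
def betaF (a b i x q : ℕ) : Formula :=
  .ex q ((Formula.eq (.var a) (((Term.var q).mul
    (Term.succ ((Term.succ (.var i)).mul (.var b)))).add (.var x))).and
    (lt (.var x) (Term.succ ((Term.succ (.var i)).mul (.var b)))))

theorem betaF_sigma1 {a b i x q : ℕ} : IsSigma1 (betaF a b i x q) :=
  .ex (.delta0 (.and (.eq _ _) (.le _ _)))

theorem betaF_val {a b i x q : ℕ} {v : ℕ → ℕ} (ha : a ≠ q) (hb : b ≠ q) (hi : i ≠ q) (hx : x ≠ q) :
    (betaF a b i x q).val v ↔ bt (v a) (v b) (v i) = v x := by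
  simp only [betaF, val, lt, Term.val, update_self, update_of_ne ha, update_of_ne hb,
    update_of_ne hi, update_of_ne hx, bt]
  set m := (v i + 1) * v b + 1 with hm
  have hpos : 0 < m := by omega
  constructor
  · rintro ⟨n, h1, h2⟩
    rw [h1, mul_comm, Nat.mul_add_mod, Nat.mod_eq_of_lt (by omega)]
  · intro h
    refine ⟨v a / m, ?_, ?_⟩
    · rw [← h, mul_comm]; exact (Nat.div_add_mod _ _).symm
    · rw [← h]; exact Nat.mod_lt _ hpos

/-- A clause applies at position `o + 3` with value `o + 4`. -/
def clauseF (o K : ℕ) (r : List Ex × Ex) : Formula :=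
  exN (o + 9) K ((graphF (o + 9) r.2 (o + 4) (o + 9 + K)).and
    (conjF (r.1.map fun p => .ex (o + 5) ((lt (.var (o + 5)) (.var (o + 3))).and
      (.ex (o + 6) ((betaF o (o + 1) (o + 5) (o + 6) (o + 7)).and
        (graphF (o + 9) p (o + 6) (o + 9 + K))))))))

theorem clauseF_sigma1 (o K : ℕ) (r : List Ex × Ex) : IsSigma1 (clauseF o K r) := by
  refine exN_sigma1 (.and (graphF_sigma1 _ _ _ _) (conjF_sigma1 ?_))
  intro φ hφ
  obtain ⟨p, -, rfl⟩ := List.mem_map.1 hφ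
  exact .ex (.and (.delta0 (.le _ _)) (.ex (.and betaF_sigma1 (graphF_sigma1 _ _ _ _))))

theorem clauseF_val {o K : ℕ} {r : List Ex × Ex} (h2 : r.2.bd ≤ K) (h1 : ∀ p ∈ r.1, p.bd ≤ K)
    {v : ℕ → ℕ} : (clauseF o K r).val v ↔ ∃ u : ℕ → ℕ, v (o + 4) = r.2.eval u ∧
      ∀ p ∈ r.1, ∃ j < v (o + 3), bt (v o) (v (o + 1)) j = p.eval u := by
  rw [clauseF, exN_val]
  have key : ∀ u : ℕ → ℕ, (((graphF (o + 9) r.2 (o + 4) (o + 9 + K)).and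
    (conjF (r.1.map fun p => .ex (o + 5) ((lt (.var (o + 5)) (.var (o + 3))).and
      (.ex (o + 6) ((betaF o (o + 1) (o + 5) (o + 6) (o + 7)).and
        (graphF (o + 9) p (o + 6) (o + 9 + K)))))))).val u ↔
      u (o + 4) = r.2.eval (fun i => u (o + 9 + i)) ∧ ∀ p ∈ r.1, ∃ j < u (o + 3),
        bt (u o) (u (o + 1)) j = p.eval (fun i => u (o + 9 + i))) := by
    intro u
    rw [val, graphF_val _ _ (by omega) (by omega), conjF_val]
    simp only [List.mem_map, forall_exists_index, and_imp, forall_apply_eq_imp_iff₂]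
    refine and_congr Iff.rfl (forall₂_congr fun p hp => ?_)
    have hp := h1 p hp
    simp only [val, lt, Term.val]
    refine exists_congr fun j => and_congr ?_ ?_
    · rw [update_self, update_of_ne (by omega)]; exact Iff.rfl
    · have : ∀ x, (p.eval fun i => update (update u (o + 5) j) (o + 6) x (o + 9 + i)) =
          p.eval fun i => u (o + 9 + i) := by
        intro x
        refine Ex.eval_congr fun i _ => ?_
        rw [update_of_ne (by omega), update_of_ne (by omega)]
      simp only [betaF_val (by omega : o ≠ o + 7) (by omega : o + 1 ≠ o + 7)
        (by omega : o + 5 ≠ o + 7) (by omega : o + 6 ≠ o + 7),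
        graphF_val _ _ (by omega : o + 6 < o + 9 + K) (by omega : o + 9 + p.bd ≤ o + 9 + K), this]
      simp
  constructor
  · rintro ⟨u, hu, h⟩
    have h := (key u).1 h
    rw [hu o (by omega), hu (o + 1) (by omega), hu (o + 3) (by omega), hu (o + 4) (by omega)] at h
    exact ⟨_, h⟩
  · rintro ⟨u, h⟩
    have e : ∀ i, i < K →
        (if o + 9 + i < o + 9 ∨ o + 9 + K ≤ o + 9 + i then v (o + 9 + i) else u i) = u i := by
      intro i hi
      rw [if_neg (by omega)]
    refine ⟨fun x => if x < o + 9 ∨ o + 9 + K ≤ x then v x else u (x - (o + 9)),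
      fun x hx => by simp only [if_pos hx], (key _).2 ?_⟩
    have e1 : ∀ p : Ex, p.bd ≤ K → (p.eval fun i => if o + 9 + i < o + 9 ∨ o + 9 + K ≤ o + 9 + i
        then v (o + 9 + i) else u (o + 9 + i - (o + 9))) = p.eval u := by
      intro p hp
      refine Ex.eval_congr fun i hi => ?_
      rw [if_neg (by omega)]
      congr 1
      omega
    rw [e1 _ h2, if_pos (by omega), if_pos (by omega), if_pos (by omega), if_pos (by omega)]
    refine ⟨h.1, fun p hp => ?_⟩
    rw [e1 _ (h1 p hp)]
    exact h.2 p hp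

/-- Bound on the variables in a program. -/
def progBd (R : List (List Ex × Ex)) : ℕ :=
  (R.map fun r => max r.2.bd (r.1.map Ex.bd).sum).sum

theorem progBd_spec {R : List (List Ex × Ex)} {r : List Ex × Ex} (hr : r ∈ R) :
    r.2.bd ≤ progBd R ∧ ∀ p ∈ r.1, p.bd ≤ progBd R := by
  have h1 : max r.2.bd (r.1.map Ex.bd).sum ≤ progBd R :=
    List.single_le_sum (by simp) _ (List.mem_map.2 ⟨r, hr, rfl⟩)
  refine ⟨le_trans (le_max_left _ _) h1, fun p hp => ?_⟩
  have : p.bd ≤ (r.1.map Ex.bd).sum :=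
    List.single_le_sum (by simp) _ (List.mem_map.2 ⟨p, hp, rfl⟩)
  exact this.trans ((le_max_right _ _).trans h1)

/-- The Σ₁ formula with free variable `o + 9` defining a predicate of the program. -/
def dvF (o : ℕ) (R : List (List Ex × Ex)) (tag : ℕ) : Formula :=
  .ex o (.ex (o + 1) (.ex (o + 2) (.ex (o + 4)
    (((betaF o (o + 1) (o + 2) (o + 4) (o + 7)).and
      (graphF (o + 9) (.p (.c tag) (.v 0)) (o + 4) (o + 10))).and
      (ball (o + 3) (Term.succ (.var (o + 2))) (.ex (o + 4)
        ((betaF o (o + 1) (o + 3) (o + 4) (o + 7)).and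
          (disjF (R.map (clauseF o (progBd R)))))))))))

theorem dvF_sigma1 (o : ℕ) (R : List (List Ex × Ex)) (tag : ℕ) : IsSigma1 (dvF o R tag) := by
  refine .ex (.ex (.ex (.ex (.and (.and betaF_sigma1 (graphF_sigma1 _ _ _ _))
    (.ball (by simp [Term.fv]) (.ex (.and betaF_sigma1 (disjF_sigma1 ?_))))))))
  intro φ hφ
  obtain ⟨r, -, rfl⟩ := List.mem_map.1 hφ
  exact clauseF_sigma1 _ _ _

theorem dvF_val {o : ℕ} {R : List (List Ex × Ex)} {tag : ℕ} {v : ℕ → ℕ} :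
    (dvF o R tag).val v ↔ Dv R (Nat.pair tag (v (o + 9))) := by
  rw [dv_iff]
  simp only [dvF, val, ball, lt, Term.val]
  refine exists_congr fun a => exists_congr fun b => exists_congr fun l => ?_
  have hb2 : ∀ u : ℕ → ℕ, (betaF o (o + 1) (o + 2) (o + 4) (o + 7)).val u ↔
      bt (u o) (u (o + 1)) (u (o + 2)) = u (o + 4) := fun u =>
    betaF_val (by omega) (by omega) (by omega) (by omega)
  have hb3 : ∀ u : ℕ → ℕ, (betaF o (o + 1) (o + 3) (o + 4) (o + 7)).val u ↔
      bt (u o) (u (o + 1)) (u (o + 3)) = u (o + 4) := fun u =>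
    betaF_val (by omega) (by omega) (by omega) (by omega)
  have hg : ∀ u : ℕ → ℕ, (graphF (o + 9) (.p (.c tag) (.v 0)) (o + 4) (o + 10)).val u ↔
      u (o + 4) = Nat.pair tag (u (o + 9)) := fun u =>
    graphF_val _ _ (by omega) (by simp [Ex.bd])
  have hd : ∀ u : ℕ → ℕ, (disjF (R.map (clauseF o (progBd R)))).val u ↔ ∃ r ∈ R, ∃ w : ℕ → ℕ,
      u (o + 4) = r.2.eval w ∧
      ∀ p ∈ r.1, ∃ j < u (o + 3), bt (u o) (u (o + 1)) j = p.eval w := by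
    intro u
    rw [disjF_val]
    simp only [List.mem_map, exists_exists_and_eq_and]
    refine exists_congr fun r => and_congr_right fun hr => ?_
    exact clauseF_val (progBd_spec hr).1 (progBd_spec hr).2
  simp only [hb2, hb3, hg, hd]
  simp [Nat.lt_succ_iff, update_apply]

end ModalArith


namespace ModalArith

open Function Formula

/-! ### Normal form for Σ₁ formulas -/

theorem sigma1_bound {φ : Formula} (h : IsSigma1 φ) : ∀ {z : ℕ}, z ∉ φ.vars →
    ∃ δ, IsDelta0 δ ∧ (∀ v m n, m ≤ n → δ.val (update v z m) → δ.val (update v z n)) ∧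
      ∀ v, φ.val v ↔ ∃ n, δ.val (update v z n) := by
  induction h with
  | @delta0 φ h =>
    intro z hz
    have hv : ∀ v n, φ.val (update v z n) ↔ φ.val v := by
      intro v n
      refine Formula.val_congr fun x hx => update_of_ne ?_ _ _
      rintro rfl
      exact hz (fv_subset_vars _ hx)
    refine ⟨φ, h, fun v m n _ h => ?_, fun v => ?_⟩
    · rw [hv] at h ⊢; exact h
    · simp [hv]
  | @and φ ψ h1 h2 ih1 ih2 =>
    intro z hz
    simp only [vars, Finset.mem_union, not_or] at hz
    obtain ⟨a, ha, hma, hva⟩ := ih1 hz.1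
    obtain ⟨b, hb, hmb, hvb⟩ := ih2 hz.2
    refine ⟨a.and b, .and ha hb, fun v m n hmn h => ⟨hma v m n hmn h.1, hmb v m n hmn h.2⟩,
      fun v => ?_⟩
    simp only [val, hva, hvb]
    constructor
    · rintro ⟨⟨m, hm⟩, n, hn⟩
      exact ⟨max m n, hma v _ _ (le_max_left _ _) hm, hmb v _ _ (le_max_right _ _) hn⟩
    · rintro ⟨n, h1, h2⟩; exact ⟨⟨n, h1⟩, n, h2⟩
  | @or φ ψ h1 h2 ih1 ih2 =>
    intro z hz
    simp only [vars, Finset.mem_union, not_or] at hz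
    obtain ⟨a, ha, hma, hva⟩ := ih1 hz.1
    obtain ⟨b, hb, hmb, hvb⟩ := ih2 hz.2
    refine ⟨a.or b, .or ha hb, fun v m n hmn h => h.imp (hma v m n hmn) (hmb v m n hmn),
      fun v => ?_⟩
    simp only [val, hva, hvb, exists_or]
  | @ex x φ h ih =>
    intro z hz
    simp only [vars, Finset.mem_insert, not_or] at hz
    obtain ⟨a, ha, hma, hva⟩ := ih hz.2
    have hc : ∀ (v : ℕ → ℕ) (k n : ℕ), update (update v z n) x k = update (update v x k) z n :=
      fun v k n => update_comm (β := fun _ => ℕ) hz.1 _ _ _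
    refine ⟨bex x (.var z) a, .bex (by simpa [Term.fv] using fun h => hz.1 h.symm) ha,
      fun v m n hmn h => ?_, fun v => ?_⟩
    · obtain ⟨k, h1, h2⟩ := h
      simp only [val, lt, Term.val, update_self, update_of_ne hz.1] at h1
      refine ⟨k, ?_, ?_⟩
      · simp only [val, lt, Term.val, update_self, update_of_ne hz.1]; omega
      · rw [hc] at h2 ⊢; exact hma _ _ _ hmn h2
    · simp only [val, hva, bex, lt, Term.val, update_self, update_of_ne hz.1, hc]
      constructor
      · rintro ⟨k, n, h⟩
        exact ⟨max (k + 1) n, k, le_max_left _ _, hma _ _ _ (le_max_right _ _) h⟩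
      · rintro ⟨n, k, _, h⟩; exact ⟨k, n, h⟩
  | @ball x t φ hx h ih =>
    intro z hz
    have hz' : z ≠ x ∧ z ∉ t.fv ∧ z ∉ φ.vars := by
      simp only [ball, lt, vars, Term.fv, Finset.mem_insert, Finset.mem_union, not_or] at hz
      tauto
    obtain ⟨a, ha, hma, hva⟩ := ih hz'.2.2
    have hc : ∀ (v : ℕ → ℕ) (k n : ℕ), update (update v z n) x k = update (update v x k) z n :=
      fun v k n => update_comm (β := fun _ => ℕ) hz'.1 _ _ _
    have ht : ∀ v k n, t.val (update (update v x k) z n) = t.val v := by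
      intro v k n
      refine Term.val_congr fun y hy => ?_
      rw [update_of_ne, update_of_ne]
      · rintro rfl; exact hx hy
      · rintro rfl; exact hz'.2.1 hy
    have ht' : ∀ v k, t.val (update v x k) = t.val v := by
      intro v k
      refine Term.val_congr fun y hy => ?_
      rw [update_of_ne]
      rintro rfl; exact hx hy
    refine ⟨Formula.ball x t a, .ball hx ha, fun v m n hmn h k hk => ?_, fun v => ?_⟩
    · have := h k
      simp only [val, lt, hc, ht, Term.val] at this hk ⊢
      refine hma _ _ _ hmn (this ?_)
      simpa [update_of_ne hz'.1.symm] using hk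
    · simp only [Formula.ball, val, hva, lt, Term.val, update_self, hc, ht, ht',
        update_of_ne hz'.1.symm]
      constructor
      · intro h
        have h' : ∀ k, ∃ n, k + 1 ≤ t.val v → a.val (update (update v x k) z n) := by
          intro k
          by_cases hk : k + 1 ≤ t.val v
          · obtain ⟨n, hn⟩ := h k hk
            exact ⟨n, fun _ => hn⟩
          · exact ⟨0, fun h => absurd h hk⟩
        choose f hf using h'
        refine ⟨(Finset.range (t.val v)).sup f, fun k hk => hma _ _ _ ?_ (hf k hk)⟩
        exact Finset.le_sup (f := f) (by simpa using hk)
      · rintro ⟨n, h⟩ k hk; exact ⟨n, h k hk⟩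

/-- Derivability is `∃ z δ(w, z)` with `δ` bounded. -/
theorem dv_delta0 (R : List (List Ex × Ex)) (tag o : ℕ) : ∃ z > o + 9, ∃ δ, IsDelta0 δ ∧
    (∀ y ∈ δ.fv, y = o + 9 ∨ y = z) ∧ ∀ v : ℕ → ℕ, Dv R (Nat.pair tag (v (o + 9))) ↔
      ∃ m, δ.val (update v z m) := by
  obtain ⟨N, hN⟩ := exists_bound (dvF o R tag).vars
  set z := max N (o + 10) with hz
  have hz1 : z ∉ (dvF o R tag).vars := fun h => by have := hN z h; omega
  obtain ⟨δ, h1, -, h3⟩ := sigma1_bound (dvF_sigma1 o R tag) hz1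
  set σ : ℕ → Term := fun y => if y = o + 9 ∨ y = z then .var y else .zero with hσ
  have hs : Safe σ := by
    intro x
    by_cases h : x = o + 9 ∨ x = z <;> simp [hσ, h, Term.fv]
  refine ⟨z, by omega, δ.substAll σ, h1.substAll hs, fun y hy => ?_, fun v => ?_⟩
  · rw [fv_substAll hs] at hy
    by_contra h
    simp [hσ, h, Term.fv] at hy
  · set u : ℕ → ℕ := fun y => if y = o + 9 then v y else 0 with hu
    have : u (o + 9) = v (o + 9) := by simp [hu]
    rw [← this, ← dvF_val, h3]
    refine exists_congr fun m => ?_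
    rw [Formula.val_substAll hs]
    refine Formula.val_congr fun y _ => ?_
    by_cases h1 : y = z
    · simp [h1, hσ, Term.val]
    · by_cases h2 : y = o + 9
      · simp [h1, h2, hσ, Term.val, hu]
        rw [update_of_ne (by omega), update_of_ne (by omega), if_pos rfl]
      · simp [h1, h2, hσ, Term.val, hu]

end ModalArith


namespace ModalArith

open Function Formula

/-! ### A Horn program for provability -/

/-- Unary atom. -/
def at1 (k : ℕ) (a : Ex) : Ex := .p (.c k) a
/-- Binary atom. -/
def at2 (k : ℕ) (a b : Ex) : Ex := .p (.c k) (.p a b)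
/-- Ternary atom. -/
def at3 (k : ℕ) (a b c : Ex) : Ex := .p (.c k) (.p a (.p b c))
/-- Quaternary atom. -/
def at4 (k : ℕ) (a b c d : Ex) : Ex := .p (.c k) (.p a (.p b (.p c d)))

/-- A numbering of codes of partial recursive functions. -/
def cc : Nat.Partrec.Code → ℕ
  | .zero => Nat.pair 0 0
  | .succ => Nat.pair 1 0
  | .left => Nat.pair 2 0
  | .right => Nat.pair 3 0
  | .pair a b => Nat.pair 4 (Nat.pair (cc a) (cc b))
  | .comp a b => Nat.pair 5 (Nat.pair (cc a) (cc b))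
  | .prec a b => Nat.pair 6 (Nat.pair (cc a) (cc b))
  | .rfind' a => Nat.pair 7 (cc a)

/-- Intended meaning of atoms. -/
def Sem (T : Set Formula) (w : ℕ) (n : ℕ) : Prop :=
  match n.unpair.1 with
  | 0 => n.unpair.2.unpair.1 ≠ n.unpair.2.unpair.2
  | 1 => ∃ t : Term, t.code = n.unpair.2.unpair.2 ∧ n.unpair.2.unpair.1 ∉ t.fv
  | 2 => ∃ φ : Formula, φ.code = n.unpair.2.unpair.2 ∧ n.unpair.2.unpair.1 ∉ φ.fv
  | 3 => ∃ t : Term, t.code = n.unpair.2.unpair.2.unpair.2.unpair.1 ∧ ∀ s : Term,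
      s.code = n.unpair.2.unpair.2.unpair.1 →
      (t.substAll (update Term.var n.unpair.2.unpair.1 s)).code =
        n.unpair.2.unpair.2.unpair.2.unpair.2
  | 4 => ∃ φ : Formula, φ.code = n.unpair.2.unpair.2.unpair.2.unpair.1 ∧ ∀ s : Term,
      s.code = n.unpair.2.unpair.2.unpair.1 → φ.freeFor s n.unpair.2.unpair.1 ∧
      (φ.subst n.unpair.2.unpair.1 s).code = n.unpair.2.unpair.2.unpair.2.unpair.2
  | 5 => ∀ c, cc c = n.unpair.2.unpair.1 →
      n.unpair.2.unpair.2.unpair.2 ∈ c.eval n.unpair.2.unpair.2.unpair.1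
  | 6 => ∃ φ : Formula, φ.code = n.unpair.2 ∧ Provable T φ
  | 7 => (Term.numeral n.unpair.2.unpair.1).code = n.unpair.2.unpair.2
  | 8 => ∀ A B : Formula, (A.and B).code = n.unpair.2 →
      Provable T ((Formula.eq (.var w) (Term.numeral n.unpair.2)).imp A)
  | 9 => ∀ A B : Formula, (A.and B).code = n.unpair.2 →
      Provable T ((Formula.eq (.var w) (Term.numeral n.unpair.2)).imp B)
  | 10 => ∃ t : Term, t.code = n.unpair.2
  | 11 => ∃ φ : Formula, φ.code = n.unpair.2
  | _ => True

section
variable {T : Set Formula} {w : ℕ}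

theorem sem0 {x y : ℕ} : Sem T w (Nat.pair 0 (Nat.pair x y)) ↔ x ≠ y := by simp [Sem]
theorem sem1 {x y : ℕ} : Sem T w (Nat.pair 1 (Nat.pair x y)) ↔
    ∃ t : Term, t.code = y ∧ x ∉ t.fv := by simp [Sem]
theorem sem2 {x y : ℕ} : Sem T w (Nat.pair 2 (Nat.pair x y)) ↔
    ∃ φ : Formula, φ.code = y ∧ x ∉ φ.fv := by simp [Sem]
theorem sem3 {x s m m' : ℕ} : Sem T w (Nat.pair 3 (Nat.pair x (Nat.pair s (Nat.pair m m')))) ↔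
    ∃ t : Term, t.code = m ∧ ∀ u : Term, u.code = s →
      (t.substAll (update Term.var x u)).code = m' := by simp [Sem]
theorem sem4 {x s m m' : ℕ} : Sem T w (Nat.pair 4 (Nat.pair x (Nat.pair s (Nat.pair m m')))) ↔
    ∃ φ : Formula, φ.code = m ∧ ∀ u : Term, u.code = s →
      φ.freeFor u x ∧ (φ.subst x u).code = m' := by simp [Sem]
theorem sem5 {x n m : ℕ} : Sem T w (Nat.pair 5 (Nat.pair x (Nat.pair n m))) ↔
    ∀ c, cc c = x → m ∈ c.eval n := by simp [Sem]
theorem sem6 {n : ℕ} : Sem T w (Nat.pair 6 n) ↔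
    ∃ φ : Formula, φ.code = n ∧ Provable T φ := by simp [Sem]
theorem sem7 {x y : ℕ} : Sem T w (Nat.pair 7 (Nat.pair x y)) ↔
    (Term.numeral x).code = y := by simp [Sem]
theorem sem8 {n : ℕ} : Sem T w (Nat.pair 8 n) ↔ ∀ A B : Formula, (A.and B).code = n →
    Provable T ((Formula.eq (.var w) (Term.numeral n)).imp A) := by simp [Sem]
theorem sem9 {n : ℕ} : Sem T w (Nat.pair 9 n) ↔ ∀ A B : Formula, (A.and B).code = n →
    Provable T ((Formula.eq (.var w) (Term.numeral n)).imp B) := by simp [Sem]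
theorem sem10 {n : ℕ} : Sem T w (Nat.pair 10 n) ↔ ∃ t : Term, t.code = n := by simp [Sem]
theorem sem11 {n : ℕ} : Sem T w (Nat.pair 11 n) ↔ ∃ φ : Formula, φ.code = n := by simp [Sem]

end

/-- Rules for inequality. -/
def rNE : List (List Ex × Ex) :=
  [([], at2 0 (.c 0) (.s (.v 0))),
   ([], at2 0 (.s (.v 0)) (.c 0)),
   ([at2 0 (.v 0) (.v 1)], at2 0 (.s (.v 0)) (.s (.v 1)))]

/-- Rules for terms not containing a variable. -/
def rTNF : List (List Ex × Ex) :=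
  [([at2 0 (.v 0) (.v 1)], at2 1 (.v 0) (.p (.c 0) (.v 1))),
   ([], at2 1 (.v 0) (.p (.c 1) (.c 0))),
   ([at2 1 (.v 0) (.v 1)], at2 1 (.v 0) (.p (.c 2) (.v 1))),
   ([at2 1 (.v 0) (.v 1), at2 1 (.v 0) (.v 2)], at2 1 (.v 0) (.p (.c 3) (.p (.v 1) (.v 2)))),
   ([at2 1 (.v 0) (.v 1), at2 1 (.v 0) (.v 2)], at2 1 (.v 0) (.p (.c 4) (.p (.v 1) (.v 2)))),
   ([at2 1 (.v 0) (.v 1)], at1 10 (.v 1))]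

/-- Rules for formulas not containing a variable free. -/
def rFNF : List (List Ex × Ex) :=
  [([], at2 2 (.v 0) (.p (.c 0) (.c 0))),
   ([at2 1 (.v 0) (.v 1), at2 1 (.v 0) (.v 2)], at2 2 (.v 0) (.p (.c 1) (.p (.v 1) (.v 2)))),
   ([at2 1 (.v 0) (.v 1), at2 1 (.v 0) (.v 2)], at2 2 (.v 0) (.p (.c 2) (.p (.v 1) (.v 2)))),
   ([at2 2 (.v 0) (.v 1), at2 2 (.v 0) (.v 2)], at2 2 (.v 0) (.p (.c 3) (.p (.v 1) (.v 2)))),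
   ([at2 2 (.v 0) (.v 1), at2 2 (.v 0) (.v 2)], at2 2 (.v 0) (.p (.c 4) (.p (.v 1) (.v 2)))),
   ([at2 2 (.v 0) (.v 1), at2 2 (.v 0) (.v 2)], at2 2 (.v 0) (.p (.c 5) (.p (.v 1) (.v 2)))),
   ([at2 2 (.v 0) (.v 1)], at2 2 (.v 0) (.p (.c 6) (.v 1))),
   ([at2 2 (.v 0) (.v 1)], at2 2 (.v 0) (.p (.c 9) (.v 1))),
   ([at2 2 (.v 0) (.v 1)], at2 2 (.v 0) (.p (.c 7) (.p (.v 2) (.v 1)))),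
   ([at2 2 (.v 0) (.v 1)], at2 2 (.v 0) (.p (.c 8) (.p (.v 2) (.v 1)))),
   ([at2 2 (.v 2) (.v 1)], at2 2 (.v 0) (.p (.c 7) (.p (.v 0) (.v 1)))),
   ([at2 2 (.v 2) (.v 1)], at2 2 (.v 0) (.p (.c 8) (.p (.v 0) (.v 1)))),
   ([at2 2 (.v 0) (.v 1)], at1 11 (.v 1))]

/-- Rules for substitution in terms. -/
def rTSub : List (List Ex × Ex) :=
  [([], at4 3 (.v 0) (.v 1) (.p (.c 0) (.v 0)) (.v 1)),
   ([at2 1 (.v 0) (.v 2)], at4 3 (.v 0) (.v 1) (.v 2) (.v 2)),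
   ([at4 3 (.v 0) (.v 1) (.v 2) (.v 3)],
    at4 3 (.v 0) (.v 1) (.p (.c 2) (.v 2)) (.p (.c 2) (.v 3))),
   ([at4 3 (.v 0) (.v 1) (.v 2) (.v 3), at4 3 (.v 0) (.v 1) (.v 4) (.v 5)],
    at4 3 (.v 0) (.v 1) (.p (.c 3) (.p (.v 2) (.v 4))) (.p (.c 3) (.p (.v 3) (.v 5)))),
   ([at4 3 (.v 0) (.v 1) (.v 2) (.v 3), at4 3 (.v 0) (.v 1) (.v 4) (.v 5)],
    at4 3 (.v 0) (.v 1) (.p (.c 4) (.p (.v 2) (.v 4))) (.p (.c 4) (.p (.v 3) (.v 5))))]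

/-- Rules for substitution in formulas. -/
def rFSub : List (List Ex × Ex) :=
  [([at2 2 (.v 0) (.v 2)], at4 4 (.v 0) (.v 1) (.v 2) (.v 2)),
   ([at4 3 (.v 0) (.v 1) (.v 2) (.v 3), at4 3 (.v 0) (.v 1) (.v 4) (.v 5)],
    at4 4 (.v 0) (.v 1) (.p (.c 1) (.p (.v 2) (.v 4))) (.p (.c 1) (.p (.v 3) (.v 5)))),
   ([at4 3 (.v 0) (.v 1) (.v 2) (.v 3), at4 3 (.v 0) (.v 1) (.v 4) (.v 5)],
    at4 4 (.v 0) (.v 1) (.p (.c 2) (.p (.v 2) (.v 4))) (.p (.c 2) (.p (.v 3) (.v 5)))),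
   ([at4 4 (.v 0) (.v 1) (.v 2) (.v 3), at4 4 (.v 0) (.v 1) (.v 4) (.v 5)],
    at4 4 (.v 0) (.v 1) (.p (.c 3) (.p (.v 2) (.v 4))) (.p (.c 3) (.p (.v 3) (.v 5)))),
   ([at4 4 (.v 0) (.v 1) (.v 2) (.v 3), at4 4 (.v 0) (.v 1) (.v 4) (.v 5)],
    at4 4 (.v 0) (.v 1) (.p (.c 4) (.p (.v 2) (.v 4))) (.p (.c 4) (.p (.v 3) (.v 5)))),
   ([at4 4 (.v 0) (.v 1) (.v 2) (.v 3), at4 4 (.v 0) (.v 1) (.v 4) (.v 5)],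
    at4 4 (.v 0) (.v 1) (.p (.c 5) (.p (.v 2) (.v 4))) (.p (.c 5) (.p (.v 3) (.v 5)))),
   ([at4 4 (.v 0) (.v 1) (.v 2) (.v 3)],
    at4 4 (.v 0) (.v 1) (.p (.c 6) (.v 2)) (.p (.c 6) (.v 3))),
   ([at4 4 (.v 0) (.v 1) (.v 2) (.v 3)],
    at4 4 (.v 0) (.v 1) (.p (.c 9) (.v 2)) (.p (.c 9) (.v 3))),
   ([at2 0 (.v 0) (.v 4), at2 1 (.v 4) (.v 1), at4 4 (.v 0) (.v 1) (.v 2) (.v 3)],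
    at4 4 (.v 0) (.v 1) (.p (.c 7) (.p (.v 4) (.v 2))) (.p (.c 7) (.p (.v 4) (.v 3)))),
   ([at2 0 (.v 0) (.v 4), at2 1 (.v 4) (.v 1), at4 4 (.v 0) (.v 1) (.v 2) (.v 3)],
    at4 4 (.v 0) (.v 1) (.p (.c 8) (.p (.v 4) (.v 2))) (.p (.c 8) (.p (.v 4) (.v 3))))]

/-- Rules for evaluation of partial recursive functions. -/
def rEv : List (List Ex × Ex) :=
  [([], at3 5 (.p (.c 0) (.c 0)) (.v 0) (.c 0)),
   ([], at3 5 (.p (.c 1) (.c 0)) (.v 0) (.s (.v 0))),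
   ([], at3 5 (.p (.c 2) (.c 0)) (.p (.v 0) (.v 1)) (.v 0)),
   ([], at3 5 (.p (.c 3) (.c 0)) (.p (.v 0) (.v 1)) (.v 1)),
   ([at3 5 (.v 0) (.v 2) (.v 3), at3 5 (.v 1) (.v 2) (.v 4)],
    at3 5 (.p (.c 4) (.p (.v 0) (.v 1))) (.v 2) (.p (.v 3) (.v 4))),
   ([at3 5 (.v 1) (.v 2) (.v 3), at3 5 (.v 0) (.v 3) (.v 4)],
    at3 5 (.p (.c 5) (.p (.v 0) (.v 1))) (.v 2) (.v 4)),
   ([at3 5 (.v 0) (.v 2) (.v 3)],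
    at3 5 (.p (.c 6) (.p (.v 0) (.v 1))) (.p (.v 2) (.c 0)) (.v 3)),
   ([at3 5 (.p (.c 6) (.p (.v 0) (.v 1))) (.p (.v 2) (.v 3)) (.v 4),
     at3 5 (.v 1) (.p (.v 2) (.p (.v 3) (.v 4))) (.v 5)],
    at3 5 (.p (.c 6) (.p (.v 0) (.v 1))) (.p (.v 2) (.s (.v 3))) (.v 5)),
   ([at3 5 (.v 0) (.p (.v 1) (.v 2)) (.c 0)],
    at3 5 (.p (.c 7) (.v 0)) (.p (.v 1) (.v 2)) (.v 2)),
   ([at3 5 (.v 0) (.p (.v 1) (.v 2)) (.s (.v 3)),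
     at3 5 (.p (.c 7) (.v 0)) (.p (.v 1) (.s (.v 2))) (.v 4)],
    at3 5 (.p (.c 7) (.v 0)) (.p (.v 1) (.v 2)) (.v 4))]

/-- Code of an implication. -/
def im (a b : Ex) : Ex := .p (.c 5) (.p a b)
/-- Code of an equation. -/
def eqq (a b : Ex) : Ex := .p (.c 1) (.p a b)
/-- Code of a negation. -/
def ng (a : Ex) : Ex := .p (.c 6) a
/-- Code of falsum. -/
def fls : Ex := .p (.c 0) (.c 0)
/-- Code of a conjunction. -/
def an (a b : Ex) : Ex := .p (.c 3) (.p a b)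
/-- Code of a disjunction. -/
def orr (a b : Ex) : Ex := .p (.c 4) (.p a b)

/-- Rules for propositional logical axioms. -/
def rLog : List (List Ex × Ex) :=
  [([at1 11 (.v 0), at1 11 (.v 1)], at1 6 (im (.v 0) (im (.v 1) (.v 0)))),
   ([at1 11 (.v 0), at1 11 (.v 1), at1 11 (.v 2)],
    at1 6 (im (im (.v 0) (im (.v 1) (.v 2))) (im (im (.v 0) (.v 1)) (im (.v 0) (.v 2))))),
   ([at1 11 (.v 0)], at1 6 (im (ng (ng (.v 0))) (.v 0))),
   ([at1 11 (.v 0), at1 11 (.v 1)],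
    at1 6 (im (im (.v 0) (.v 1)) (im (im (.v 0) (ng (.v 1))) (ng (.v 0))))),
   ([at1 11 (.v 0), at1 11 (.v 1)], at1 6 (im (ng (.v 0)) (im (.v 0) (.v 1)))),
   ([at1 11 (.v 0)], at1 6 (im fls (.v 0))),
   ([at1 11 (.v 0)], at1 6 (im (im (.v 0) fls) (ng (.v 0)))),
   ([at1 11 (.v 0)], at1 6 (im (ng (.v 0)) (im (.v 0) fls))),
   ([at1 11 (.v 0), at1 11 (.v 1)], at1 6 (im (.v 0) (im (.v 1) (an (.v 0) (.v 1))))),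
   ([at1 11 (.v 0), at1 11 (.v 1)], at1 6 (im (an (.v 0) (.v 1)) (.v 0))),
   ([at1 11 (.v 0), at1 11 (.v 1)], at1 6 (im (an (.v 0) (.v 1)) (.v 1))),
   ([at1 11 (.v 0), at1 11 (.v 1)], at1 6 (im (.v 0) (orr (.v 0) (.v 1)))),
   ([at1 11 (.v 0), at1 11 (.v 1)], at1 6 (im (.v 1) (orr (.v 0) (.v 1)))),
   ([at1 11 (.v 0), at1 11 (.v 1), at1 11 (.v 2)],
    at1 6 (im (im (.v 0) (.v 2)) (im (im (.v 1) (.v 2)) (im (orr (.v 0) (.v 1)) (.v 2)))))]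

/-- Rules for quantifier and equality axioms. -/
def rQ : List (List Ex × Ex) :=
  [([at1 10 (.v 1), at4 4 (.v 0) (.v 1) (.v 2) (.v 3)],
    at1 6 (im (.p (.c 7) (.p (.v 0) (.v 2))) (.v 3))),
   ([at2 2 (.v 0) (.v 1), at1 11 (.v 2)],
    at1 6 (im (.p (.c 7) (.p (.v 0) (im (.v 1) (.v 2))))
      (im (.v 1) (.p (.c 7) (.p (.v 0) (.v 2)))))),
   ([at1 10 (.v 1), at4 4 (.v 0) (.v 1) (.v 2) (.v 3)],
    at1 6 (im (.v 3) (.p (.c 8) (.p (.v 0) (.v 2))))),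
   ([at1 11 (.v 1), at2 2 (.v 0) (.v 2)],
    at1 6 (im (.p (.c 7) (.p (.v 0) (im (.v 1) (.v 2))))
      (im (.p (.c 8) (.p (.v 0) (.v 1))) (.v 2)))),
   ([at1 10 (.v 0)], at1 6 (eqq (.v 0) (.v 0))),
   ([at1 10 (.v 0), at1 10 (.v 1)], at1 6 (im (eqq (.v 0) (.v 1)) (eqq (.v 1) (.v 0)))),
   ([at1 10 (.v 0), at1 10 (.v 1), at1 10 (.v 2)],
    at1 6 (im (eqq (.v 0) (.v 1)) (im (eqq (.v 1) (.v 2)) (eqq (.v 0) (.v 2))))),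
   ([at1 10 (.v 0), at1 10 (.v 1)],
    at1 6 (im (eqq (.v 0) (.v 1)) (eqq (.p (.c 2) (.v 0)) (.p (.c 2) (.v 1))))),
   ([at1 10 (.v 0), at1 10 (.v 1), at1 10 (.v 2), at1 10 (.v 3)],
    at1 6 (im (eqq (.v 0) (.v 1)) (im (eqq (.v 2) (.v 3))
      (eqq (.p (.c 3) (.p (.v 0) (.v 2))) (.p (.c 3) (.p (.v 1) (.v 3))))))),
   ([at1 10 (.v 0), at1 10 (.v 1), at1 10 (.v 2), at1 10 (.v 3)],
    at1 6 (im (eqq (.v 0) (.v 1)) (im (eqq (.v 2) (.v 3))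
      (eqq (.p (.c 4) (.p (.v 0) (.v 2))) (.p (.c 4) (.p (.v 1) (.v 3))))))),
   ([at1 10 (.v 0), at1 10 (.v 1), at1 10 (.v 2), at1 10 (.v 3)],
    at1 6 (im (eqq (.v 0) (.v 1)) (im (eqq (.v 2) (.v 3))
      (im (.p (.c 2) (.p (.v 0) (.v 2))) (.p (.c 2) (.p (.v 1) (.v 3)))))))]

/-- Rules for proofs and the diagonal predicates. -/
def rPr (cT w : ℕ) : List (List Ex × Ex) :=
  [([at3 5 (.c cT) (.v 0) (.c 0)], at1 6 (.v 0)),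
   ([at1 6 (im (.v 0) (.v 1)), at1 6 (.v 0)], at1 6 (.v 1)),
   ([at1 6 (.v 0)], at1 6 (.p (.c 7) (.p (.v 1) (.v 0)))),
   ([at1 6 (.v 0)], at1 6 (.p (.c 9) (.v 0))),
   ([], at2 7 (.c 0) (.p (.c 1) (.c 0))),
   ([at2 7 (.v 0) (.v 1)], at2 7 (.s (.v 0)) (.p (.c 2) (.v 1))),
   ([at2 7 (an (.v 0) (.v 1)) (.v 2),
     at1 6 (im (eqq (.p (.c 0) (.c w)) (.v 2)) (.v 0))], at1 8 (an (.v 0) (.v 1))),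
   ([at2 7 (an (.v 0) (.v 1)) (.v 2),
     at1 6 (im (eqq (.p (.c 0) (.c w)) (.v 2)) (.v 1))], at1 9 (an (.v 0) (.v 1)))]

/-- The whole program. -/
def prog (cT w : ℕ) : List (List Ex × Ex) :=
  rNE ++ (rTNF ++ (rFNF ++ (rTSub ++ (rFSub ++ (rEv ++ (rLog ++ (rQ ++ rPr cT w)))))))

/-! Soundness. -/
section
variable (T : Set Formula) (w : ℕ)

theorem sound_NE : Holds (Sem T w) rNE := by
  simp only [rNE, Holds, Imps, at1, at2, Ex.eval, sem0]
  refine ⟨?_, ?_, ?_, trivial⟩ <;> intro v <;> omega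

theorem sound_TNF : Holds (Sem T w) rTNF := by
  simp only [rTNF, Holds, Imps, at1, at2, Ex.eval, sem0, sem1, sem10]
  refine ⟨?_, ?_, ?_, ?_, ?_, ?_, trivial⟩
  · intro v h; exact ⟨.var (v 1), rfl, by simpa [Term.fv] using h⟩
  · intro v; exact ⟨.zero, rfl, by simp [Term.fv]⟩
  · rintro v ⟨t, ht, hx⟩; exact ⟨.succ t, by rw [← ht]; rfl, hx⟩
  · rintro v ⟨t, ht, hx⟩ ⟨u, hu, hy⟩
    exact ⟨.add t u, by rw [← ht, ← hu]; rfl, by simp [Term.fv, hx, hy]⟩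
  · rintro v ⟨t, ht, hx⟩ ⟨u, hu, hy⟩
    exact ⟨.mul t u, by rw [← ht, ← hu]; rfl, by simp [Term.fv, hx, hy]⟩
  · rintro v ⟨t, ht, -⟩; exact ⟨t, ht⟩

theorem sound_FNF : Holds (Sem T w) rFNF := by
  simp only [rFNF, Holds, Imps, at1, at2, Ex.eval, sem1, sem2, sem11]
  refine ⟨?_, ?_, ?_, ?_, ?_, ?_, ?_, ?_, ?_, ?_, ?_, ?_, ?_, trivial⟩
  · intro v; exact ⟨.falsum, rfl, by simp [Formula.fv]⟩
  · rintro v ⟨t, ht, hx⟩ ⟨u, hu, hy⟩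
    exact ⟨.eq t u, by rw [← ht, ← hu]; rfl, by simp [Formula.fv, hx, hy]⟩
  · rintro v ⟨t, ht, hx⟩ ⟨u, hu, hy⟩
    exact ⟨.le t u, by rw [← ht, ← hu]; rfl, by simp [Formula.fv, hx, hy]⟩
  · rintro v ⟨t, ht, hx⟩ ⟨u, hu, hy⟩
    exact ⟨.and t u, by rw [← ht, ← hu]; rfl, by simp [Formula.fv, hx, hy]⟩
  · rintro v ⟨t, ht, hx⟩ ⟨u, hu, hy⟩
    exact ⟨.or t u, by rw [← ht, ← hu]; rfl, by simp [Formula.fv, hx, hy]⟩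
  · rintro v ⟨t, ht, hx⟩ ⟨u, hu, hy⟩
    exact ⟨.imp t u, by rw [← ht, ← hu]; rfl, by simp [Formula.fv, hx, hy]⟩
  · rintro v ⟨t, ht, hx⟩; exact ⟨.neg t, by rw [← ht]; rfl, hx⟩
  · rintro v ⟨t, ht, hx⟩; exact ⟨.box t, by rw [← ht]; rfl, hx⟩
  · rintro v ⟨t, ht, hx⟩; exact ⟨.all (v 2) t, by rw [← ht]; rfl, by simp [Formula.fv, hx]⟩
  · rintro v ⟨t, ht, hx⟩; exact ⟨.ex (v 2) t, by rw [← ht]; rfl, by simp [Formula.fv, hx]⟩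
  · rintro v ⟨t, ht, hx⟩; exact ⟨.all (v 0) t, by rw [← ht]; rfl, by simp [Formula.fv]⟩
  · rintro v ⟨t, ht, hx⟩; exact ⟨.ex (v 0) t, by rw [← ht]; rfl, by simp [Formula.fv]⟩
  · rintro v ⟨t, ht, -⟩; exact ⟨t, ht⟩

theorem Term.subst_not_mem {t s : Term} {x : ℕ} (h : x ∉ t.fv) :
    t.substAll (update Term.var x s) = t := by
  apply Term.substAll_id
  intro y hy
  rw [update_of_ne]
  rintro rfl; exact h hy

theorem sound_TSub : Holds (Sem T w) rTSub := by
  simp only [rTSub, Holds, Imps, at1, at2, at4, Ex.eval, sem1, sem3]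
  refine ⟨?_, ?_, ?_, ?_, ?_, trivial⟩
  · intro v; exact ⟨.var (v 0), rfl, fun s hs => by simpa [Term.substAll] using hs⟩
  · rintro v ⟨t, ht, hx⟩
    exact ⟨t, ht, fun s hs => by rw [Term.subst_not_mem hx, ht]⟩
  · rintro v ⟨t, ht, hx⟩
    exact ⟨.succ t, by rw [← ht]; rfl, fun s hs => by rw [← hx s hs]; rfl⟩
  · rintro v ⟨t, ht, hx⟩ ⟨u, hu, hy⟩
    exact ⟨.add t u, by rw [← ht, ← hu]; rfl, fun s hs => by rw [← hx s hs, ← hy s hs]; rfl⟩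
  · rintro v ⟨t, ht, hx⟩ ⟨u, hu, hy⟩
    exact ⟨.mul t u, by rw [← ht, ← hu]; rfl, fun s hs => by rw [← hx s hs, ← hy s hs]; rfl⟩

theorem sound_FSub : Holds (Sem T w) rFSub := by
  simp only [rFSub, Holds, Imps, at1, at2, at4, Ex.eval, sem0, sem1, sem2, sem3, sem4]
  refine ⟨?_, ?_, ?_, ?_, ?_, ?_, ?_, ?_, ?_, ?_, trivial⟩
  · rintro v ⟨t, ht, hx⟩
    exact ⟨t, ht, fun s hs => ⟨freeFor_of_not_mem hx, by rw [subst_of_not_mem hx, ht]⟩⟩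
  · rintro v ⟨t, ht, hx⟩ ⟨u, hu, hy⟩
    exact ⟨.eq t u, by rw [← ht, ← hu]; rfl,
      fun s hs => ⟨trivial, by rw [← hx s hs, ← hy s hs]; rfl⟩⟩
  · rintro v ⟨t, ht, hx⟩ ⟨u, hu, hy⟩
    exact ⟨.le t u, by rw [← ht, ← hu]; rfl,
      fun s hs => ⟨trivial, by rw [← hx s hs, ← hy s hs]; rfl⟩⟩
  · rintro v ⟨t, ht, hx⟩ ⟨u, hu, hy⟩
    exact ⟨.and t u, by rw [← ht, ← hu]; rfl,
      fun s hs => ⟨⟨(hx s hs).1, (hy s hs).1⟩, by rw [← (hx s hs).2, ← (hy s hs).2]; rfl⟩⟩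
  · rintro v ⟨t, ht, hx⟩ ⟨u, hu, hy⟩
    exact ⟨.or t u, by rw [← ht, ← hu]; rfl,
      fun s hs => ⟨⟨(hx s hs).1, (hy s hs).1⟩, by rw [← (hx s hs).2, ← (hy s hs).2]; rfl⟩⟩
  · rintro v ⟨t, ht, hx⟩ ⟨u, hu, hy⟩
    exact ⟨.imp t u, by rw [← ht, ← hu]; rfl,
      fun s hs => ⟨⟨(hx s hs).1, (hy s hs).1⟩, by rw [← (hx s hs).2, ← (hy s hs).2]; rfl⟩⟩
  · rintro v ⟨t, ht, hx⟩
    exact ⟨.neg t, by rw [← ht]; rfl, fun s hs => ⟨(hx s hs).1, by rw [← (hx s hs).2]; rfl⟩⟩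
  · rintro v ⟨t, ht, hx⟩
    exact ⟨.box t, by rw [← ht]; rfl, fun s hs => ⟨(hx s hs).1, by rw [← (hx s hs).2]; rfl⟩⟩
  · rintro v hne ⟨r, hr, hy⟩ ⟨t, ht, hx⟩
    refine ⟨.all (v 4) t, by rw [← ht]; rfl, fun s hs => ?_⟩
    obtain rfl : r = s := Term.code_inj (hr.trans hs.symm)
    refine ⟨Or.inr (Or.inr ⟨hy, (hx r hs).1⟩), ?_⟩
    rw [← (hx r hs).2, subst_all_ne (Ne.symm hne)]; rfl
  · rintro v hne ⟨r, hr, hy⟩ ⟨t, ht, hx⟩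
    refine ⟨.ex (v 4) t, by rw [← ht]; rfl, fun s hs => ?_⟩
    obtain rfl : r = s := Term.code_inj (hr.trans hs.symm)
    refine ⟨Or.inr (Or.inr ⟨hy, (hx r hs).1⟩), ?_⟩
    rw [← (hx r hs).2, subst_ex_ne (Ne.symm hne)]; rfl

end

end ModalArith


namespace ModalArith

open Function Formula

section
variable (T : Set Formula) (w : ℕ)

theorem mem_prec_succ {f g : Nat.Partrec.Code} {a y m : ℕ} :
    m ∈ (f.prec g).eval (Nat.pair a (y + 1)) ↔
      ∃ i ∈ (f.prec g).eval (Nat.pair a y), m ∈ g.eval (Nat.pair a (Nat.pair y i)) := by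
  rw [Nat.Partrec.Code.eval_prec_succ]
  simp

theorem mem_rfind' {f : Nat.Partrec.Code} {a m r : ℕ} :
    r ∈ f.rfind'.eval (Nat.pair a m) ↔ ∃ k, r = k + m ∧ 0 ∈ f.eval (Nat.pair a (k + m)) ∧
      ∀ j < k, ∃ i, i + 1 ∈ f.eval (Nat.pair a (j + m)) := by
  rw [Nat.Partrec.Code.eval, Nat.unpaired, Nat.unpair_pair]
  rw [Part.mem_map_iff]
  constructor
  · rintro ⟨k, hk, rfl⟩
    obtain ⟨h1, h⟩ := Nat.mem_rfind.1 hk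
    obtain ⟨x, hx, hx0⟩ := (Part.mem_map_iff _).1 h1
    have hx0 : x = 0 := of_decide_eq_true hx0
    subst hx0
    refine ⟨k, rfl, hx, fun j hj => ?_⟩
    obtain ⟨x, hx, hx0⟩ := (Part.mem_map_iff _).1 (h hj)
    obtain ⟨i, rfl⟩ := Nat.exists_eq_succ_of_ne_zero (of_decide_eq_false hx0)
    exact ⟨i, hx⟩
  · rintro ⟨k, rfl, h0, h⟩
    refine ⟨k, Nat.mem_rfind.2 ⟨(Part.mem_map_iff _).2 ⟨0, h0, rfl⟩, fun {j} hj => ?_⟩, rfl⟩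
    obtain ⟨i, hi⟩ := h j hj
    exact (Part.mem_map_iff _).2 ⟨i + 1, hi, by simp⟩

theorem cc_inv (c : Nat.Partrec.Code) : ∀ a b, cc c = Nat.pair a b →
    (a = 0 → c = .zero) ∧ (a = 1 → c = .succ) ∧ (a = 2 → c = .left) ∧ (a = 3 → c = .right) ∧
    (a = 4 → ∃ f g, c = .pair f g ∧ b = Nat.pair (cc f) (cc g)) ∧
    (a = 5 → ∃ f g, c = .comp f g ∧ b = Nat.pair (cc f) (cc g)) ∧
    (a = 6 → ∃ f g, c = .prec f g ∧ b = Nat.pair (cc f) (cc g)) ∧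
    (a = 7 → ∃ f, c = .rfind' f ∧ b = cc f) := by
  intro a b h
  cases c <;> simp only [cc, Nat.pair_eq_pair] at h <;> obtain ⟨rfl, rfl⟩ := h <;> simp

theorem sound_Ev : Holds (Sem T w) rEv := by
  simp only [rEv, Holds, Imps, at3, Ex.eval, sem5]
  refine ⟨?_, ?_, ?_, ?_, ?_, ?_, ?_, ?_, ?_, ?_, trivial⟩
  · intro v c hc
    rw [(cc_inv c _ _ hc).1 rfl]
    exact Part.mem_some _
  · intro v c hc
    rw [(cc_inv c _ _ hc).2.1 rfl]
    simp [Nat.Partrec.Code.eval]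
  · intro v c hc
    rw [(cc_inv c _ _ hc).2.2.1 rfl]
    simp [Nat.Partrec.Code.eval]
  · intro v c hc
    rw [(cc_inv c _ _ hc).2.2.2.1 rfl]
    simp [Nat.Partrec.Code.eval]
  · intro v h1 h2 c hc
    obtain ⟨f, g, rfl, hb⟩ := (cc_inv c _ _ hc).2.2.2.2.1 rfl
    rw [Nat.pair_eq_pair] at hb
    have h1 := h1 f hb.1.symm
    have h2 := h2 g hb.2.symm
    simp only [Nat.Partrec.Code.eval, Seq.seq, Part.map_eq_map, Part.mem_bind_iff,
      Part.mem_map_iff]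
    exact ⟨_, ⟨_, h1, rfl⟩, _, h2, rfl⟩
  · intro v h1 h2 c hc
    obtain ⟨f, g, rfl, hb⟩ := (cc_inv c _ _ hc).2.2.2.2.2.1 rfl
    rw [Nat.pair_eq_pair] at hb
    have h1 := h1 g hb.2.symm
    have h2 := h2 f hb.1.symm
    rw [Nat.Partrec.Code.eval]
    exact Part.mem_bind h1 h2
  · intro v h1 c hc
    obtain ⟨f, g, rfl, hb⟩ := (cc_inv c _ _ hc).2.2.2.2.2.2.1 rfl
    rw [Nat.pair_eq_pair] at hb
    rw [Nat.Partrec.Code.eval_prec_zero]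
    exact h1 f hb.1.symm
  · intro v h1 h2 c hc
    have h1 := h1 c hc
    obtain ⟨f, g, rfl, hb⟩ := (cc_inv c _ _ hc).2.2.2.2.2.2.1 rfl
    rw [Nat.pair_eq_pair] at hb
    exact mem_prec_succ.2 ⟨_, h1, h2 g hb.2.symm⟩
  · intro v h1 c hc
    obtain ⟨f, rfl, hb⟩ := (cc_inv c _ _ hc).2.2.2.2.2.2.2 rfl
    exact mem_rfind'.2 ⟨0, by simp, by simpa using h1 f hb.symm, fun j hj => by omega⟩
  · intro v h1 h2 c hc
    have h2 := h2 c hc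
    obtain ⟨f, rfl, hb⟩ := (cc_inv c _ _ hc).2.2.2.2.2.2.2 rfl
    have h1 := h1 f hb.symm
    obtain ⟨k, e1, e2, e3⟩ := mem_rfind'.1 h2
    refine mem_rfind'.2 ⟨k + 1, by omega, ?_, fun j hj => ?_⟩
    · rwa [show k + 1 + v 2 = k + (v 2 + 1) by omega]
    · rcases j with _ | j
      · exact ⟨v 3, by simpa using h1⟩
      · obtain ⟨i, hi⟩ := e3 j (by omega)
        exact ⟨i, by rwa [show j + 1 + v 2 = j + (v 2 + 1) by omega]⟩

theorem sound_Log : Holds (Sem T w) rLog := by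
  simp only [rLog, Holds, Imps, at1, im, ng, fls, an, orr, Ex.eval, sem6, sem11]
  refine ⟨?_, ?_, ?_, ?_, ?_, ?_, ?_, ?_, ?_, ?_, ?_, ?_, ?_, ?_, trivial⟩
  · rintro v ⟨φ, h⟩ ⟨ψ, h'⟩
    exact ⟨_, by rw [← h, ← h']; rfl, .logic (.imp1 φ ψ)⟩
  · rintro v ⟨φ, h⟩ ⟨ψ, h'⟩ ⟨χ, hh2⟩
    exact ⟨_, by rw [← h, ← h', ← hh2]; rfl, .logic (.imp2 φ ψ χ)⟩
  · rintro v ⟨φ, h⟩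
    exact ⟨_, by rw [← h]; rfl, .logic (.dne φ)⟩
  · rintro v ⟨φ, h⟩ ⟨ψ, h'⟩
    exact ⟨_, by rw [← h, ← h']; rfl, .logic (.negI φ ψ)⟩
  · rintro v ⟨φ, h⟩ ⟨ψ, h'⟩
    exact ⟨_, by rw [← h, ← h']; rfl, .logic (.negE φ ψ)⟩
  · rintro v ⟨φ, h⟩
    exact ⟨_, by rw [← h]; rfl, .logic (.falsumE φ)⟩
  · rintro v ⟨φ, h⟩
    exact ⟨_, by rw [← h]; rfl, .logic (.negIntro φ)⟩
  · rintro v ⟨φ, h⟩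
    exact ⟨_, by rw [← h]; rfl, .logic (.negElimFalsum φ)⟩
  · rintro v ⟨φ, h⟩ ⟨ψ, h'⟩
    exact ⟨_, by rw [← h, ← h']; rfl, .logic (.andI φ ψ)⟩
  · rintro v ⟨φ, h⟩ ⟨ψ, h'⟩
    exact ⟨_, by rw [← h, ← h']; rfl, .logic (.andE1 φ ψ)⟩
  · rintro v ⟨φ, h⟩ ⟨ψ, h'⟩
    exact ⟨_, by rw [← h, ← h']; rfl, .logic (.andE2 φ ψ)⟩
  · rintro v ⟨φ, h⟩ ⟨ψ, h'⟩
    exact ⟨_, by rw [← h, ← h']; rfl, .logic (.orI1 φ ψ)⟩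
  · rintro v ⟨φ, h⟩ ⟨ψ, h'⟩
    exact ⟨_, by rw [← h, ← h']; rfl, .logic (.orI2 φ ψ)⟩
  · rintro v ⟨φ, h⟩ ⟨ψ, h'⟩ ⟨χ, hh2⟩
    exact ⟨_, by rw [← h, ← h', ← hh2]; rfl, .logic (.orE φ ψ χ)⟩

theorem sound_Q : Holds (Sem T w) rQ := by
  simp only [rQ, Holds, Imps, at1, at2, at4, im, eqq, Ex.eval, sem2, sem4, sem6, sem10, sem11]
  refine ⟨?_, ?_, ?_, ?_, ?_, ?_, ?_, ?_, ?_, ?_, ?_, trivial⟩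
  · rintro v ⟨s, hs⟩ ⟨φ, h, h'⟩
    exact ⟨_, by rw [← h, ← (h' s hs).2]; rfl, .logic (.allE (v 0) s φ (h' s hs).1)⟩
  · rintro v ⟨φ, h, hx⟩ ⟨ψ, h'⟩
    exact ⟨_, by rw [← h, ← h']; rfl, .logic (.allImp (v 0) φ ψ hx)⟩
  · rintro v ⟨s, hs⟩ ⟨φ, h, h'⟩
    exact ⟨_, by rw [← h, ← (h' s hs).2]; rfl, .logic (.exI (v 0) s φ (h' s hs).1)⟩
  · rintro v ⟨φ, h⟩ ⟨ψ, h', hx⟩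
    exact ⟨_, by rw [← h, ← h']; rfl, .logic (.exE (v 0) φ ψ hx)⟩
  · rintro v ⟨t, h⟩
    exact ⟨_, by rw [← h]; rfl, .logic (.eqRefl t)⟩
  · rintro v ⟨t, h⟩ ⟨u, h'⟩
    exact ⟨_, by rw [← h, ← h']; rfl, .logic (.eqSymm t u)⟩
  · rintro v ⟨t, h⟩ ⟨u, h'⟩ ⟨s, hh2⟩
    exact ⟨_, by rw [← h, ← h', ← hh2]; rfl, .logic (.eqTrans t u s)⟩
  · rintro v ⟨t, h⟩ ⟨u, h'⟩
    exact ⟨_, by rw [← h, ← h']; rfl, .logic (.eqSucc t u)⟩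
  · rintro v ⟨t, h⟩ ⟨u, h'⟩ ⟨s, hh2⟩ ⟨r, hh3⟩
    exact ⟨_, by rw [← h, ← h', ← hh2, ← hh3]; rfl, .logic (.eqAdd t u s r)⟩
  · rintro v ⟨t, h⟩ ⟨u, h'⟩ ⟨s, hh2⟩ ⟨r, hh3⟩
    exact ⟨_, by rw [← h, ← h', ← hh2, ← hh3]; rfl, .logic (.eqMul t u s r)⟩
  · rintro v ⟨t, h⟩ ⟨u, h'⟩ ⟨s, hh2⟩ ⟨r, hh3⟩
    exact ⟨_, by rw [← h, ← h', ← hh2, ← hh3]; rfl, .logic (.eqLe t u s r)⟩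

theorem sound_Pr (c : Nat.Partrec.Code) (hc : ∀ n, 0 ∈ c.eval n → ∃ φ ∈ T, φ.code = n) :
    Holds (Sem T w) (rPr (cc c) w) := by
  simp only [rPr, Holds, Imps, at1, at2, at3, im, an, eqq, Ex.eval, sem5, sem6, sem7, sem8, sem9]
  refine ⟨?_, ?_, ?_, ?_, ?_, ?_, ?_, ?_, trivial⟩
  · intro v h
    obtain ⟨φ, hφ, h⟩ := hc _ (h c rfl)
    exact ⟨φ, h, .ax hφ⟩
  · rintro v ⟨χ, h1, h2⟩ ⟨φ, h3, h4⟩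
    cases χ <;> simp only [Formula.code, Nat.pair_eq_pair] at h1 <;> try omega
    rename_i a b
    obtain rfl : a = φ := Formula.code_inj (h1.2.1.trans h3.symm)
    exact ⟨b, h1.2.2, h2.mp h4⟩
  · rintro v ⟨φ, h1, h2⟩
    exact ⟨_, by rw [← h1]; rfl, h2.gen (v 1)⟩
  · rintro v ⟨φ, h1, h2⟩
    exact ⟨_, by rw [← h1]; rfl, h2.nec⟩
  · intro v; rfl
  · intro v h; rw [← h]; rfl
  · rintro v h1 ⟨φ, h3, h4⟩ A B hAB
    rw [← hAB] at h1 ⊢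
    simp only [Formula.code, Nat.pair_eq_pair] at hAB
    rw [← h1, ← hAB.2.1] at h3
    have : φ = (Formula.eq (.var w) (Term.numeral (A.and B).code)).imp A := Formula.code_inj h3
    rwa [← this]
  · rintro v h1 ⟨φ, h3, h4⟩ A B hAB
    rw [← hAB] at h1 ⊢
    simp only [Formula.code, Nat.pair_eq_pair] at hAB
    rw [← h1, ← hAB.2.2] at h3
    have : φ = (Formula.eq (.var w) (Term.numeral (A.and B).code)).imp B := Formula.code_inj h3
    rwa [← this]

theorem sound_prog (c : Nat.Partrec.Code) (hc : ∀ n, 0 ∈ c.eval n → ∃ φ ∈ T, φ.code = n) :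
    Holds (Sem T w) (prog (cc c) w) := by
  simp only [prog, holds_append]
  exact ⟨sound_NE T w, sound_TNF T w, sound_FNF T w, sound_TSub T w, sound_FSub T w,
    sound_Ev T w, sound_Log T w, sound_Q T w, sound_Pr T w c hc⟩

end

end ModalArith


namespace ModalArith

open Function Formula

/-- Valuation from a list. -/
def vec (l : List ℕ) : ℕ → ℕ := fun i => l.getD i 0

section
variable {X : ℕ → Prop}

theorem comp_NE (h : Holds X rNE) : ∀ x y : ℕ, x ≠ y → X (Nat.pair 0 (Nat.pair x y)) := by
  obtain ⟨h1, h2, h3, -⟩ := h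
  intro x
  induction x with
  | zero =>
    intro y hy
    obtain ⟨y, rfl⟩ := Nat.exists_eq_succ_of_ne_zero (Ne.symm hy)
    exact h1 (vec [y])
  | succ x ih =>
    intro y hy
    rcases y with _ | y
    · exact h2 (vec [x])
    · exact h3 (vec [x, y]) (ih y (by omega))

theorem comp_TNF (hNE : Holds X rNE) (h : Holds X rTNF) (x : ℕ) (t : Term) (ht : x ∉ t.fv) :
    X (Nat.pair 1 (Nat.pair x t.code)) := by
  obtain ⟨h1, h2, h3, h4, h5, -⟩ := h
  induction t with
  | var y =>
    exact h1 (vec [x, y]) (comp_NE hNE x y (by simpa [Term.fv] using ht))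
  | zero => exact h2 (vec [x])
  | succ t ih => exact h3 (vec [x, t.code]) (ih ht)
  | add t u ih1 ih2 =>
    simp only [Term.fv, Finset.mem_union, not_or] at ht
    exact h4 (vec [x, t.code, u.code]) (ih1 ht.1) (ih2 ht.2)
  | mul t u ih1 ih2 =>
    simp only [Term.fv, Finset.mem_union, not_or] at ht
    exact h5 (vec [x, t.code, u.code]) (ih1 ht.1) (ih2 ht.2)

theorem exists_not_mem (s : Finset ℕ) : ∃ x, x ∉ s := by
  obtain ⟨N, hN⟩ := exists_bound s
  exact ⟨N, fun h => lt_irrefl _ (hN N h)⟩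

theorem comp_Trm (hNE : Holds X rNE) (h : Holds X rTNF) (t : Term) :
    X (Nat.pair 10 t.code) := by
  obtain ⟨x, hx⟩ := exists_not_mem t.fv
  have := comp_TNF hNE h x t hx
  obtain ⟨-, -, -, -, -, h6, -⟩ := h
  exact h6 (vec [x, t.code]) this

theorem comp_FNF (hNE : Holds X rNE) (hT : Holds X rTNF) (h : Holds X rFNF) (φ : Formula) :
    ∀ x, x ∉ φ.fv → X (Nat.pair 2 (Nat.pair x φ.code)) := by
  obtain ⟨h1, h2, h3, h4, h5, h6, h7, h8, h9, h10, h11, h12, -⟩ := h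
  have ht := comp_TNF hNE hT
  induction φ with
  | falsum => intro x hx; exact h1 (vec [x])
  | eq t u =>
    intro x hx
    simp only [fv, Finset.mem_union, not_or] at hx
    exact h2 (vec [x, t.code, u.code]) (ht x t hx.1) (ht x u hx.2)
  | le t u =>
    intro x hx
    simp only [fv, Finset.mem_union, not_or] at hx
    exact h3 (vec [x, t.code, u.code]) (ht x t hx.1) (ht x u hx.2)
  | and t u ih1 ih2 =>
    intro x hx
    simp only [fv, Finset.mem_union, not_or] at hx
    exact h4 (vec [x, t.code, u.code]) (ih1 x hx.1) (ih2 x hx.2)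
  | or t u ih1 ih2 =>
    intro x hx
    simp only [fv, Finset.mem_union, not_or] at hx
    exact h5 (vec [x, t.code, u.code]) (ih1 x hx.1) (ih2 x hx.2)
  | imp t u ih1 ih2 =>
    intro x hx
    simp only [fv, Finset.mem_union, not_or] at hx
    exact h6 (vec [x, t.code, u.code]) (ih1 x hx.1) (ih2 x hx.2)
  | neg t ih => intro x hx; exact h7 (vec [x, t.code]) (ih x hx)
  | box t ih => intro x hx; exact h8 (vec [x, t.code]) (ih x hx)
  | all y t ih =>
    intro x hx
    by_cases hxy : x = y
    · subst hxy
      obtain ⟨z, hz⟩ := exists_not_mem t.fv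
      exact h11 (vec [x, t.code, z]) (ih z hz)
    · exact h9 (vec [x, t.code, y]) (ih x fun h => hx (by simp [fv, h, hxy]))
  | ex y t ih =>
    intro x hx
    by_cases hxy : x = y
    · subst hxy
      obtain ⟨z, hz⟩ := exists_not_mem t.fv
      exact h12 (vec [x, t.code, z]) (ih z hz)
    · exact h10 (vec [x, t.code, y]) (ih x fun h => hx (by simp [fv, h, hxy]))

theorem comp_Form (hNE : Holds X rNE) (hT : Holds X rTNF) (h : Holds X rFNF) (φ : Formula) :
    X (Nat.pair 11 φ.code) := by
  obtain ⟨x, hx⟩ := exists_not_mem φ.fv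
  have := comp_FNF hNE hT h φ x hx
  obtain ⟨-, -, -, -, -, -, -, -, -, -, -, -, h13, -⟩ := h
  exact h13 (vec [x, φ.code]) this

theorem comp_TSub (hNE : Holds X rNE) (hT : Holds X rTNF) (h : Holds X rTSub) (x : ℕ) (s t : Term) :
    X (Nat.pair 3 (Nat.pair x (Nat.pair s.code
      (Nat.pair t.code (t.substAll (update Term.var x s)).code)))) := by
  obtain ⟨h1, h2, h3, h4, h5, -⟩ := h
  induction t with
  | var y =>
    by_cases hxy : y = x
    · subst hxy
      rw [Term.substAll, update_self]
      exact h1 (vec [y, s.code])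
    · rw [Term.substAll, update_of_ne hxy]
      exact h2 (vec [x, s.code, (Term.var y).code])
        (comp_TNF hNE hT x _ (by simpa [Term.fv] using Ne.symm hxy))
  | zero => exact h2 (vec [x, s.code, Term.zero.code]) (comp_TNF hNE hT x _ (by simp [Term.fv]))
  | succ t ih => exact h3 (vec [x, s.code, t.code, _]) ih
  | add t u ih1 ih2 => exact h4 (vec [x, s.code, t.code, _, u.code, _]) ih1 ih2
  | mul t u ih1 ih2 => exact h5 (vec [x, s.code, t.code, _, u.code, _]) ih1 ih2

theorem comp_FSub (hNE : Holds X rNE) (hT : Holds X rTNF) (hF : Holds X rFNF)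
    (hTS : Holds X rTSub) (h : Holds X rFSub) (x : ℕ) (s : Term) (φ : Formula)
    (hf : φ.freeFor s x) :
    X (Nat.pair 4 (Nat.pair x (Nat.pair s.code (Nat.pair φ.code (φ.subst x s).code)))) := by
  obtain ⟨h1, h2, h3, h4, h5, h6, h7, h8, h9, h10, -⟩ := h
  have htriv : ∀ ψ : Formula, x ∉ ψ.fv →
      X (Nat.pair 4 (Nat.pair x (Nat.pair s.code (Nat.pair ψ.code (ψ.subst x s).code)))) := by
    intro ψ hx
    rw [subst_of_not_mem hx]
    exact h1 (vec [x, s.code, ψ.code]) (comp_FNF hNE hT hF ψ x hx)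
  have ht := comp_TSub hNE hT hTS x s
  induction φ with
  | falsum => exact htriv _ (by simp [fv])
  | eq t u => exact h2 (vec [x, s.code, t.code, _, u.code, _]) (ht t) (ht u)
  | le t u => exact h3 (vec [x, s.code, t.code, _, u.code, _]) (ht t) (ht u)
  | and t u ih1 ih2 => exact h4 (vec [x, s.code, t.code, _, u.code, _]) (ih1 hf.1) (ih2 hf.2)
  | or t u ih1 ih2 => exact h5 (vec [x, s.code, t.code, _, u.code, _]) (ih1 hf.1) (ih2 hf.2)
  | imp t u ih1 ih2 => exact h6 (vec [x, s.code, t.code, _, u.code, _]) (ih1 hf.1) (ih2 hf.2)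
  | neg t ih => exact h7 (vec [x, s.code, t.code, _]) (ih hf)
  | box t ih => exact h8 (vec [x, s.code, t.code, _]) (ih hf)
  | all y t ih =>
    by_cases hxy : x = y
    · exact htriv _ (by simp [fv, hxy])
    · rcases hf with hf | hf | hf
      · exact absurd hf hxy
      · exact htriv _ (by simp [fv, hf])
      · rw [subst_all_ne (Ne.symm hxy)]
        exact h9 (vec [x, s.code, t.code, _, y]) (comp_NE hNE x y hxy) (comp_TNF hNE hT y s hf.1)
          (ih hf.2)
  | ex y t ih =>
    by_cases hxy : x = y
    · exact htriv _ (by simp [fv, hxy])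
    · rcases hf with hf | hf | hf
      · exact absurd hf hxy
      · exact htriv _ (by simp [fv, hf])
      · rw [subst_ex_ne (Ne.symm hxy)]
        exact h10 (vec [x, s.code, t.code, _, y]) (comp_NE hNE x y hxy) (comp_TNF hNE hT y s hf.1)
          (ih hf.2)

theorem comp_Ev (h : Holds X rEv) (c : Nat.Partrec.Code) : ∀ n m, m ∈ c.eval n →
    X (Nat.pair 5 (Nat.pair (cc c) (Nat.pair n m))) := by
  obtain ⟨h1, h2, h3, h4, h5, h6, h7, h8, h9, h10, -⟩ := h
  induction c with
  | zero =>
    intro n m hm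
    obtain rfl : m = 0 := Part.mem_some_iff.1 hm
    exact h1 (vec [n])
  | succ =>
    intro n m hm
    obtain rfl : m = n + 1 := by simpa [Nat.Partrec.Code.eval] using hm
    exact h2 (vec [n])
  | left =>
    intro n m hm
    obtain ⟨a, b, rfl⟩ : ∃ a b, n = Nat.pair a b := ⟨_, _, (Nat.pair_unpair n).symm⟩
    obtain rfl : m = a := by simpa [Nat.Partrec.Code.eval] using hm
    exact h3 (vec [m, b])
  | right =>
    intro n m hm
    obtain ⟨a, b, rfl⟩ : ∃ a b, n = Nat.pair a b := ⟨_, _, (Nat.pair_unpair n).symm⟩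
    obtain rfl : m = b := by simpa [Nat.Partrec.Code.eval] using hm
    exact h4 (vec [a, m])
  | pair f g ih1 ih2 =>
    intro n m hm
    simp only [Nat.Partrec.Code.eval, Seq.seq, Part.map_eq_map, Part.mem_bind_iff,
      Part.mem_map_iff] at hm
    obtain ⟨_, ⟨a, ha, rfl⟩, b, hb, rfl⟩ := hm
    exact h5 (vec [cc f, cc g, n, a, b]) (ih1 n a ha) (ih2 n b hb)
  | comp f g ih1 ih2 =>
    intro n m hm
    rw [Nat.Partrec.Code.eval] at hm
    obtain ⟨a, ha, hb⟩ := Part.mem_bind_iff.1 hm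
    exact h6 (vec [cc f, cc g, n, a, m]) (ih2 n a ha) (ih1 a m hb)
  | prec f g ih1 ih2 =>
    intro n
    obtain ⟨a, k, rfl⟩ : ∃ a k, n = Nat.pair a k := ⟨_, _, (Nat.pair_unpair n).symm⟩
    induction k with
    | zero =>
      intro m hm
      rw [Nat.Partrec.Code.eval_prec_zero] at hm
      exact h7 (vec [cc f, cc g, a, m]) (ih1 a m hm)
    | succ k ih =>
      intro m hm
      obtain ⟨i, hi, hm⟩ := mem_prec_succ.1 hm
      exact h8 (vec [cc f, cc g, a, k, i, m]) (ih i hi) (ih2 _ _ hm)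
  | rfind' f ih =>
    intro n m hm
    obtain ⟨a, k, rfl⟩ : ∃ a k, n = Nat.pair a k := ⟨_, _, (Nat.pair_unpair n).symm⟩
    obtain ⟨j, rfl, hz, hj⟩ := mem_rfind'.1 hm
    clear hm
    induction j generalizing k with
    | zero =>
      rw [Nat.zero_add] at hz ⊢
      exact h9 (vec [cc f, a, k]) (ih _ _ hz)
    | succ j ih2 =>
      obtain ⟨i, hi⟩ := hj 0 (by omega)
      rw [Nat.zero_add] at hi
      have e : j + 1 + k = j + (k + 1) := by omega
      rw [e] at hz ⊢
      refine h10 (vec [cc f, a, k, i, j + (k + 1)]) (ih _ _ hi) (ih2 (k + 1) hz fun l hl => ?_)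
      have := hj (l + 1) (by omega)
      rwa [show l + 1 + k = l + (k + 1) by omega] at this

theorem comp_Num (c w : ℕ) (h : Holds X (rPr c w)) (n : ℕ) :
    X (Nat.pair 7 (Nat.pair n (Term.numeral n).code)) := by
  obtain ⟨-, -, -, -, h5, h6, -⟩ := h
  induction n with
  | zero => exact h5 (vec [])
  | succ n ih => exact h6 (vec [n, _]) ih

theorem comp_Log {c w : ℕ} (hp : Holds X (prog c w)) {φ : Formula} (h : LogicalAxiom φ) :
    X (Nat.pair 6 φ.code) := by
  simp only [prog, holds_append] at hp
  obtain ⟨hNE, hT, hF, hTS, hFS, hE, ⟨a1, a2, a3, a4, a5, a6, a7, a8, a9, a10, a11, a12, a13, a14, -⟩,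
    ⟨b1, b2, b3, b4, b5, b6, b7, b8, b9, b10, b11, -⟩, -⟩ := hp
  have hf := comp_Form hNE hT hF
  have ht := comp_Trm hNE hT
  have hs := comp_FSub hNE hT hF hTS hFS
  have hx := comp_FNF hNE hT hF
  cases h with
  | imp1 φ ψ => exact a1 (vec [φ.code, ψ.code]) (hf φ) (hf ψ)
  | imp2 φ ψ χ => exact a2 (vec [φ.code, ψ.code, χ.code]) (hf φ) (hf ψ) (hf χ)
  | dne φ => exact a3 (vec [φ.code]) (hf φ)
  | negI φ ψ => exact a4 (vec [φ.code, ψ.code]) (hf φ) (hf ψ)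
  | negE φ ψ => exact a5 (vec [φ.code, ψ.code]) (hf φ) (hf ψ)
  | falsumE φ => exact a6 (vec [φ.code]) (hf φ)
  | negIntro φ => exact a7 (vec [φ.code]) (hf φ)
  | negElimFalsum φ => exact a8 (vec [φ.code]) (hf φ)
  | andI φ ψ => exact a9 (vec [φ.code, ψ.code]) (hf φ) (hf ψ)
  | andE1 φ ψ => exact a10 (vec [φ.code, ψ.code]) (hf φ) (hf ψ)
  | andE2 φ ψ => exact a11 (vec [φ.code, ψ.code]) (hf φ) (hf ψ)
  | orI1 φ ψ => exact a12 (vec [φ.code, ψ.code]) (hf φ) (hf ψ)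
  | orI2 φ ψ => exact a13 (vec [φ.code, ψ.code]) (hf φ) (hf ψ)
  | orE φ ψ χ => exact a14 (vec [φ.code, ψ.code, χ.code]) (hf φ) (hf ψ) (hf χ)
  | allE x t φ h => exact b1 (vec [x, t.code, φ.code, _]) (ht t) (hs x t φ h)
  | allImp x φ ψ h => exact b2 (vec [x, φ.code, ψ.code]) (hx φ x h) (hf ψ)
  | exI x t φ h => exact b3 (vec [x, t.code, φ.code, _]) (ht t) (hs x t φ h)
  | exE x φ ψ h => exact b4 (vec [x, φ.code, ψ.code]) (hf φ) (hx ψ x h)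
  | eqRefl t => exact b5 (vec [t.code]) (ht t)
  | eqSymm t u => exact b6 (vec [t.code, u.code]) (ht t) (ht u)
  | eqTrans t u s => exact b7 (vec [t.code, u.code, s.code]) (ht t) (ht u) (ht s)
  | eqSucc t u => exact b8 (vec [t.code, u.code]) (ht t) (ht u)
  | eqAdd t u s r =>
    exact b9 (vec [t.code, u.code, s.code, r.code]) (ht t) (ht u) (ht s) (ht r)
  | eqMul t u s r =>
    exact b10 (vec [t.code, u.code, s.code, r.code]) (ht t) (ht u) (ht s) (ht r)
  | eqLe t u s r =>
    exact b11 (vec [t.code, u.code, s.code, r.code]) (ht t) (ht u) (ht s) (ht r)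

theorem comp_Prov {T : Set Formula} {w : ℕ} {c : Nat.Partrec.Code}
    (hc : ∀ φ ∈ T, 0 ∈ c.eval φ.code) (hp : Holds X (prog (cc c) w)) {φ : Formula}
    (h : Provable T φ) : X (Nat.pair 6 φ.code) := by
  have hp' := hp
  simp only [prog, holds_append] at hp'
  obtain ⟨-, -, -, -, -, hE, -, -, ⟨h1, h2, h3, h4, -⟩⟩ := hp'
  induction h with
  | @ax φ h => exact h1 (vec [φ.code]) (comp_Ev hE c _ _ (hc φ h))
  | logic h => exact comp_Log hp h
  | @mp φ ψ _ _ ih1 ih2 => exact h2 (vec [φ.code, ψ.code]) ih1 ih2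
  | @gen φ x _ ih => exact h3 (vec [φ.code, x]) ih
  | @nec φ _ ih => exact h4 (vec [φ.code]) ih

end

/-- The program represents the diagonal provability predicates. -/
theorem prog_spec {T : Set Formula} (hre : RE T) (w : ℕ) : ∃ R, ∀ A B : Formula,
    (Dv R (Nat.pair 8 (A.and B).code) ↔
      Provable T ((Formula.eq (.var w) (Term.numeral (A.and B).code)).imp A)) ∧
    (Dv R (Nat.pair 9 (A.and B).code) ↔
      Provable T ((Formula.eq (.var w) (Term.numeral (A.and B).code)).imp B)) := by
  obtain ⟨c, hc⟩ := Nat.Partrec.Code.exists_code.1 hre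
  have hc' : ∀ n, 0 ∈ c.eval n ↔ ∃ φ ∈ T, φ.code = n := by
    intro n
    rw [hc]
    simp
  have hs := sound_prog T w c fun n hn => (hc' n).1 hn
  have hp := Dv.holds (prog (cc c) w)
  have hp' := hp
  simp only [prog, holds_append] at hp'
  have hPr := hp'.2.2.2.2.2.2.2.2
  have hn := comp_Num _ _ hPr
  obtain ⟨-, -, -, -, -, -, h7, h8, -⟩ := hPr
  have hprov := fun {φ : Formula} => comp_Prov (T := T) (w := w) (X := Dv (prog (cc c) w))
    (fun φ h => (hc' _).2 ⟨φ, h, rfl⟩) hp (φ := φ)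
  refine ⟨prog (cc c) w, fun A B => ⟨⟨fun h => ?_, fun h => ?_⟩, ⟨fun h => ?_, fun h => ?_⟩⟩⟩
  · exact sem8.1 (Dv.sound hs h) A B rfl
  · exact h7 (vec [A.code, B.code, _]) (hn (A.and B).code) (hprov h)
  · exact sem9.1 (Dv.sound hs h) A B rfl
  · exact h8 (vec [A.code, B.code, _]) (hn (A.and B).code) (hprov h)

end ModalArith


namespace ModalArith

open Function Formula

/-! ### The main argument -/

section
variable {T : Set Formula}

theorem or_prop (h4 : Extends T PAK4) (hm : HasMDP T) {φ χ : Formula} (h1 : IsSB φ) (h2 : IsSB χ)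
    (s1 : φ.fv = ∅) (s2 : χ.fv = ∅) (h : Provable T (φ.or χ)) : Provable T φ ∨ Provable T χ := by
  refine hm φ χ s1 s2 (Provable.taut fun b hb => ?_)
  have h := hb.thm h
  have h3 := hb.thm (box_sigmaB h4 h1)
  have h5 := hb.thm (box_sigmaB h4 h2)
  simp only [hb.or, hb.imp] at *
  tauto

theorem subst_eq_numeralSubst {φ : Formula} {x : ℕ} (hfv : φ.fv ⊆ {x}) (v : ℕ → ℕ) :
    φ.substAll (numeralSubst v) = φ.subst x (Term.numeral (v x)) := by
  refine Formula.substAll_congr fun y hy => ?_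
  have := hfv hy
  rw [Finset.mem_singleton] at this
  subst this
  simp [numeralSubst]

theorem delta0_one (h4 : Extends T PAK4) {δ : Formula} (h : IsDelta0 δ) {x : ℕ}
    (hfv : δ.fv ⊆ {x}) (v : ℕ → ℕ) (n : ℕ) :
    (δ.val (update v x n) → Provable T (δ.subst x (Term.numeral n))) ∧
    (¬ δ.val (update v x n) → Provable T (δ.subst x (Term.numeral n)).neg) := by
  have := delta0_complete h4 h (update v x n)
  rwa [subst_eq_numeralSubst hfv, update_self] at this

theorem bex_facts (h4 : Extends T PAK4) {d : Formula} (hd : IsDelta0 d) {x z : ℕ} (hzx : z ≠ x)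
    (hfv : d.fv ⊆ {z}) (v : ℕ → ℕ) :
    IsDelta0 (bex z (.var x) d) ∧ (bex z (.var x) d).fv ⊆ {x} ∧
    (∀ k, (∃ j < k, d.val (update v z j)) →
      Provable T ((bex z (.var x) d).subst x (Term.numeral k))) ∧
    (∀ k, (¬ ∃ j < k, d.val (update v z j)) →
      Provable T ((bex z (.var x) d).subst x (Term.numeral k)).neg) ∧
    ∀ q, d.val (update v z q) →
      Provable T ((lt (Term.numeral q) (.var x)).imp (bex z (.var x) d)) := by
  have hz : z ∉ (Term.var x).fv := by simpa [Term.fv] using hzx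
  have h1 : IsDelta0 (bex z (.var x) d) := .bex hz hd
  have h2 : (bex z (.var x) d).fv ⊆ {x} := by
    intro y hy
    simp only [bex, lt, fv, Term.fv, Finset.mem_erase, Finset.mem_union, Finset.mem_singleton] at hy
    rcases hy with ⟨h, (h' | h') | h'⟩
    · exact (h h').elim
    · simpa using h'
    · exact (h (by simpa using hfv h')).elim
  have hval : ∀ k, (bex z (.var x) d).val (update v x k) ↔ ∃ j < k, d.val (update v z j) := by
    intro k
    simp only [bex, lt, val, Term.val, update_self]
    refine exists_congr fun j => ?_
    rw [update_of_ne hzx.symm, update_self]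
    refine and_congr Iff.rfl (Formula.val_congr fun y hy => ?_)
    have := hfv hy
    rw [Finset.mem_singleton] at this
    subst this
    simp
  refine ⟨h1, h2, fun k hk => (delta0_one h4 h1 h2 v k).1 ((hval k).2 hk),
    fun k hk => (delta0_one h4 h1 h2 v k).2 (mt (hval k).1 hk), fun q hq => ?_⟩
  have h3 := (delta0_one h4 hd hfv v q).1 hq
  have h5 := bex_inst (T := T) hz d q
  refine Provable.taut fun b hb => ?_
  have h3 := hb.thm h3
  have h5 := hb.thm h5
  simp only [hb.imp] at *
  tauto

theorem bounded_ep (h4 : Extends T PAK4) (hc : Consistent T) (hm : HasMDP T) {ψ : Formula} {x : ℕ}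
    (hψ : IsSB ψ) (hfv : ψ.fv ⊆ {x}) (N : ℕ)
    (h : Provable T (ex x ((lt (.var x) (Term.numeral N)).and ψ))) :
    ∃ n, Provable T (ψ.subst x (Term.numeral n)) := by
  have hT := h4.paBox
  have hx : ∀ N, (ex x ((lt (.var x) (Term.numeral N)).and ψ)).fv = ∅ := by
    intro N
    rw [Finset.eq_empty_iff_forall_notMem]
    intro y hy
    simp only [lt, fv, Term.fv, Finset.mem_erase, Finset.mem_union, Finset.mem_singleton,
      Term.fv_numeral] at hy
    rcases hy with ⟨h, (h' | h') | h'⟩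
    · exact h h'
    · simp at h'
    · exact h (by simpa using hfv h')
  have hs : ∀ N, (ψ.subst x (Term.numeral N)).fv = ∅ := by
    intro N
    rw [fv_subst_numeral, Finset.eq_empty_iff_forall_notMem]
    intro y hy
    rw [Finset.mem_erase] at hy
    exact hy.1 (by simpa using hfv hy.2)
  induction N with
  | zero =>
    refine (hc ((Provable.ex_elim x (by simp [fv]) (Provable.taut fun b hb => ?_)).mp h)).elim
    rw [hb.imp, hb.and]
    exact fun h => (hb.not_lt_zero hT h.1).elim
  | succ N ih =>
    have key : Provable T ((ex x ((lt (.var x) (Term.numeral N)).and ψ)).or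
        (ψ.subst x (Term.numeral N))) := by
      refine (Provable.ex_elim x ?_ (Provable.taut fun b hb => ?_)).mp h
      · simp only [fv, Finset.mem_union, not_or]
        constructor
        · have := hx N
          simp only [fv] at this
          rw [this]; simp
        · rw [hs]; simp
      · have h1 := hb.thm (Provable.ex_self (T := T) x ((lt (.var x) (Term.numeral N)).and ψ))
        have h2 := hb.thm (leibniz h4 (freeFor_of_fv (s := Term.numeral N) (x := x) (by simp) ψ))
        have h3 := fun h => hb.lt_cases hT (a := .var x) (c := Term.numeral N) h
        simp only [hb.imp, hb.and, hb.or, hb.iff] at *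
        rintro ⟨h5, h6⟩
        rcases h3 h5 with h7 | h7
        · exact Or.inl (h1 ⟨h7, h6⟩)
        · exact Or.inr ((h2 h7).1 h6)
    rcases or_prop h4 hm (.ex (.and (.delta0 (.le _ _)) hψ)) (hψ.substAll (safe_update_var x N))
        (hx N) (hs N) key with h1 | h1
    · exact ih h1
    · exact ⟨N, h1⟩

theorem abstract_ep (h4 : Extends T PAK4) (hc : Consistent T) (hm : HasMDP T)
    {ψ AF BF : Formula} {x : ℕ} (hψ : IsSB ψ) (hfv : ψ.fv ⊆ {x}) {a b : ℕ → Prop}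
    (hA : IsDelta0 AF) (fA : AF.fv ⊆ {x}) (hB : IsDelta0 BF) (fB : BF.fv ⊆ {x})
    (A1 : ∀ k, (∃ j < k, a j) → Provable T (AF.subst x (Term.numeral k)))
    (A2 : ∀ k, (¬ ∃ j < k, a j) → Provable T (AF.subst x (Term.numeral k)).neg)
    (A3 : ∀ q, a q → Provable T ((lt (Term.numeral q) (.var x)).imp AF))
    (B2 : ∀ k, (¬ ∃ j < k, b j) → Provable T (BF.subst x (Term.numeral k)).neg)
    (B3 : ∀ q, b q → Provable T ((lt (Term.numeral q) (.var x)).imp BF))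
    (hα : Provable T (ex x ((ψ.or AF).and BF.neg)) ↔ ∃ m, b m)
    (hβ : Provable T (ex x ((BF.subst x (.succ (.var x))).and AF.neg)) ↔ ∃ m, a m)
    (h : Provable T (ex x ψ)) : ∃ n, Provable T (ψ.subst x (Term.numeral n)) := by
  have hT := h4.paBox
  have hsafe : Safe (update Term.var x (.succ (.var x))) := by
    intro y
    by_cases hy : y = x
    · subst hy; simp [Term.fv]
    · simp [update_of_ne hy, Term.fv]
  have hsub : ∀ k, (BF.subst x (.succ (.var x))).subst x (Term.numeral k) =
      BF.subst x (Term.numeral (k + 1)) := by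
    intro k
    unfold Formula.subst
    rw [Formula.substAll_comp _ hsafe]
    congr 1
    funext y
    by_cases hy : y = x
    · subst hy; simp [Term.substAll, Term.numeral]
    · simp [update_of_ne hy, Term.substAll]
  have hB' : IsDelta0 (BF.subst x (.succ (.var x))) := hB.substAll hsafe
  have fB' : (BF.subst x (.succ (.var x))).fv ⊆ {x} := by
    intro y hy
    unfold Formula.subst at hy
    rw [Formula.fv_substAll hsafe] at hy
    exact fB hy.1
  obtain ⟨α, hαd⟩ : ∃ α, α = ex x ((ψ.or AF).and BF.neg) := ⟨_, rfl⟩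
  obtain ⟨β, hβd⟩ : ∃ β, β = ex x ((BF.subst x (.succ (.var x))).and AF.neg) := ⟨_, rfl⟩
  rw [← hαd] at hα
  rw [← hβd] at hβ
  have closed : ∀ {χ : Formula}, χ.fv ⊆ {x} → (ex x χ).fv = ∅ := by
    intro χ hχ
    rw [Finset.eq_empty_iff_forall_notMem]
    intro y hy
    simp only [fv, Finset.mem_erase] at hy
    exact hy.1 (by simpa using hχ hy.2)
  have cα : α.fv = ∅ := hαd ▸ closed (by
    simp only [fv]
    exact Finset.union_subset (Finset.union_subset hfv fA) fB)
  have cβ : β.fv = ∅ := hβd ▸ closed (by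
    simp only [fv]
    exact Finset.union_subset fB' fA)
  have sα : IsSB α := hαd ▸ .ex (.and (.or hψ (.delta0 hA)) (.delta0 (.neg hB)))
  have sβ : IsSB β := hβd ▸ .ex (.delta0 (.and hB' (.neg hA)))
  have wα : Provable T (((ψ.or AF).and BF.neg).imp α) := hαd ▸ Provable.ex_self _ _
  have wβ : Provable T (((BF.subst x (.succ (.var x))).and AF.neg).imp β) := hβd ▸ Provable.ex_self _ _
  -- (i)
  have step1 : Provable T (BF.imp (α.or β)) := by
    have hs : ∀ s : Term, (BF.imp (α.or β)).subst x s = (BF.subst x s).imp (α.or β) := by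
      intro s
      have h1 : α.subst x s = α := subst_of_not_mem (by rw [cα]; simp)
      have h2 : β.subst x s = β := subst_of_not_mem (by rw [cβ]; simp)
      change (BF.subst x s).imp ((α.subst x s).or (β.subst x s)) = _
      rw [h1, h2]
    refine ind hT x _ ?_ ?_
    · rw [hs]
      have := B2 0 (by simp)
      refine Provable.taut fun b hb => ?_
      have h1 := hb.thm this
      simp only [hb.imp, hb.neg] at *
      exact fun h => (h1 h).elim
    · rw [hs]
      refine Provable.taut fun b hb => ?_
      have h1 := hb.thm wα
      have h2 := hb.thm wβ
      rw [hb.imp, hb.and, hb.or, hb.neg] at h1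
      rw [hb.imp, hb.and, hb.neg] at h2
      rw [hb.imp, hb.imp, hb.imp, hb.or]
      intro h3 h5
      by_cases h6 : b BF
      · exact h3 h6
      · by_cases h7 : b AF
        · exact Or.inl (h1 ⟨Or.inr h7, h6⟩)
        · exact Or.inr (h2 ⟨h5, h7⟩)
  have step1' : Provable T (α.or β) := by
    refine (Provable.ex_elim x (by simp [fv, cα, cβ]) (Provable.taut fun b hb => ?_)).mp h
    have h1 := hb.thm wα
    have h2 := hb.thm step1
    rw [hb.imp, hb.and, hb.or, hb.neg] at h1
    rw [hb.imp] at h2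
    rw [hb.imp]
    intro h3
    by_cases h6 : b BF
    · exact h2 h6
    · rw [hb.or]
      exact Or.inl (h1 ⟨Or.inl h3, h6⟩)
  -- (ii)
  have step2 : Provable T α := by
    rcases or_prop h4 hm sα sβ cα cβ step1' with h1 | h1
    · exact h1
    · obtain ⟨m, hma⟩ := hβ.1 h1
      by_contra hn
      have hnb : ∀ j, ¬ b j := fun j hj => hn (hα.2 ⟨j, hj⟩)
      refine hn (hαd ▸ (Provable.ex_numeral x (m + 1) ((ψ.or AF).and BF.neg)).mp ?_)
      have h2 := A1 (m + 1) ⟨m, by omega, hma⟩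
      have h3 := B2 (m + 1) (fun ⟨j, _, hj⟩ => hnb j hj)
      change Provable T (((ψ.subst x (Term.numeral (m + 1))).or
        (AF.subst x (Term.numeral (m + 1)))).and (BF.subst x (Term.numeral (m + 1))).neg)
      refine Provable.taut fun b hb => ?_
      have h2 := hb.thm h2
      have h3 := hb.thm h3
      rw [hb.neg] at h3
      rw [hb.and, hb.or, hb.neg]
      exact ⟨Or.inr h2, h3⟩
  -- (iii)
  classical
  have hex := hα.1 step2
  obtain ⟨p, hp, hmin⟩ : ∃ p, b p ∧ ∀ j < p, ¬ b j :=
    ⟨Nat.find hex, Nat.find_spec hex, fun j hj => Nat.find_min hex hj⟩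
  by_cases hq : ∃ q < p, a q
  · obtain ⟨q, hqp, hq⟩ := hq
    exfalso
    have h1 : Provable T β := hβ.2 ⟨q, hq⟩
    have h2 := A3 q hq
    have h3 := bounded_all h4 (x := x) (n := q + 1) (φ := (BF.subst x (.succ (.var x))).neg) (by
      intro k hk
      change Provable T ((BF.subst x (.succ (.var x))).subst x (Term.numeral k)).neg
      rw [hsub]
      exact B2 _ fun ⟨j, hj, hbj⟩ => hmin j (by omega) hbj)
    rw [hβd] at h1
    refine hc ((Provable.ex_elim x (by simp [fv]) (Provable.taut fun b hb => ?_)).mp h1)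
    have h2 := hb.thm h2
    have h3 := hb.thm h3
    have h5 := hb.not_le hT (a := (Term.numeral q).succ) (c := .var x)
    rw [hb.imp] at h2 h3
    rw [hb.neg] at h3
    rw [hb.imp, hb.and, hb.neg]
    rintro ⟨h6, h7⟩
    exact (h3 ((hb.succ_le_succ hT).2 ((hb.succ_le_succ hT).1 (h5.1 fun h => h7 (h2 h)))) h6).elim
  · have h2 := B3 p hp
    have h3 := bounded_all h4 (x := x) (n := p + 1) (φ := AF.neg) (by
      intro k hk
      exact A2 k fun ⟨j, hj, haj⟩ => hq ⟨j, by omega, haj⟩)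
    refine bounded_ep h4 hc hm hψ hfv (p + 1) ?_
    rw [hαd] at step2
    refine (Provable.ex_elim x (by simp [fv]) (Provable.taut fun b hb => ?_)).mp step2
    have h1 := hb.thm (Provable.ex_self (T := T) x ((lt (.var x) (Term.numeral (p + 1))).and ψ))
    have h2 := hb.thm h2
    have h3 := hb.thm h3
    have h5 := hb.not_le hT (a := (Term.numeral p).succ) (c := .var x)
    rw [hb.imp] at h2 h3
    rw [hb.neg] at h3
    rw [hb.imp, hb.and] at h1
    rw [hb.imp, hb.and, hb.neg, hb.or]
    rintro ⟨h6, h7⟩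
    have h8 := h5.1 fun h => h7 (h2 h)
    exact h1 ⟨h8, h6.resolve_right (h3 h8)⟩

theorem ep (hre : RE T) (h4 : Extends T PAK4) (hc : Consistent T) (hm : HasMDP T)
    {ψ : Formula} {x : ℕ} (hψ : IsSB ψ) (hfv : ψ.fv ⊆ {x})
    (h : Provable T (ex x ψ)) : ∃ n, Provable T (ψ.subst x (Term.numeral n)) := by
  obtain ⟨w, hw⟩ : ∃ w, w = x + 1 + 9 := ⟨_, rfl⟩
  have hwx : x ≠ w := by omega
  obtain ⟨R, hR⟩ := prog_spec hre w
  obtain ⟨zB, hzB, δB, dB, fB, vB⟩ := dv_delta0 R 8 (x + 1)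
  obtain ⟨zA, hzA, δA, dA, fA, vA⟩ := dv_delta0 R 9 (x + 1)
  rw [← hw] at hzA hzB
  simp only [← hw] at fA fB vA vB
  have hψw : w ∉ ψ.fv := fun hh => hwx (Finset.mem_singleton.1 (hfv hh)).symm
  let α : Formula := ex x ((ψ.or (bex zA (.var x) δA)).and (bex zB (.var x) δB).neg)
  let β : Formula := ex x ((bex zB (.succ (.var x)) δB).and (bex zA (.var x) δA).neg)
  obtain ⟨n, hn⟩ : ∃ n, n = (α.and β).code := ⟨_, rfl⟩
  have hbex : ∀ (z : ℕ) (t : Term) (δ : Formula), z > w → (∀ y ∈ t.fv, y = x) →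
      (bex z t δ).subst w (Term.numeral n) = bex z t (δ.subst w (Term.numeral n)) := by
    intro z t δ hz ht
    have hzt : z ∉ t.fv := fun hh => by have := ht z hh; omega
    unfold Formula.subst
    rw [bex_substAll hzt]
    congr 1
    · refine Term.substAll_id fun y hy => ?_
      rw [update_of_ne (by rw [ht y hy]; exact hwx)]
    · congr 1
      funext y
      by_cases hy : y = z
      · subst hy
        simp [update_of_ne (show y ≠ w by omega)]
      · rw [update_of_ne hy]
  have e1 : α.subst w (Term.numeral n) = ex x ((ψ.or (bex zA (.var x)
      (δA.subst w (Term.numeral n)))).and (bex zB (.var x) (δB.subst w (Term.numeral n))).neg) := by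
    rw [subst_ex_ne hwx]
    change ex x (((ψ.subst w _).or ((bex zA (.var x) δA).subst w _)).and
      ((bex zB (.var x) δB).subst w _).neg) = _
    rw [hbex _ _ _ hzA (by simp [Term.fv]), hbex _ _ _ hzB (by simp [Term.fv]),
      subst_of_not_mem hψw]
  have e2 : β.subst w (Term.numeral n) = ex x ((bex zB (.succ (.var x))
      (δB.subst w (Term.numeral n))).and (bex zA (.var x) (δA.subst w (Term.numeral n))).neg) := by
    rw [subst_ex_ne hwx]
    change ex x (((bex zB (.succ (.var x)) δB).subst w _).and
      ((bex zA (.var x) δA).subst w _).neg) = _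
    rw [hbex _ _ _ hzA (by simp [Term.fv]), hbex _ _ _ hzB (by simp [Term.fv])]
  have pr : ∀ χ : Formula, Provable T ((Formula.eq (.var w) (Term.numeral n)).imp χ) ↔
      Provable T (χ.subst w (Term.numeral n)) := by
    intro χ
    have hl := leibniz h4 (freeFor_of_fv (s := Term.numeral n) (x := w) (by simp) χ)
    constructor
    · intro h1
      have h2 := h1.inst_numeral w n
      have h3 : (Formula.eq (.var w) (Term.numeral n)).subst w (Term.numeral n) =
          .eq (Term.numeral n) (Term.numeral n) := by
        simp [Formula.subst, Formula.substAll, Term.substAll]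
      change Provable T (((Formula.eq (.var w) (Term.numeral n)).subst w (Term.numeral n)).imp
        (χ.subst w (Term.numeral n))) at h2
      rw [h3] at h2
      exact h2.mp (.logic (.eqRefl _))
    · intro h1
      refine Provable.taut fun b hb => ?_
      have h1 := hb.thm h1
      have h2 := hb.thm hl
      simp only [hb.imp, hb.iff] at *
      tauto
  have fd : ∀ (δ : Formula) (z : ℕ), (∀ y ∈ δ.fv, y = w ∨ y = z) →
      (δ.subst w (Term.numeral n)).fv ⊆ {z} := by
    intro δ z hδ y hy
    rw [fv_subst_numeral, Finset.mem_erase] at hy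
    rcases hδ y hy.2 with h1 | h1
    · exact (hy.1 h1).elim
    · simpa using h1
  have vd : ∀ (δ : Formula) (z : ℕ), z > w → ∀ m,
      (δ.subst w (Term.numeral n)).val (update (fun _ => 0) z m) ↔
      δ.val (update (update (fun _ => 0) w n) z m) := by
    intro δ z hz m
    rw [val_subst_numeral, update_comm (β := fun _ => ℕ) (show w ≠ z by omega)]
  obtain ⟨A0, A0', A1, A2, A3⟩ := bex_facts h4 (dA.substAll (safe_update_var w n))
    (x := x) (z := zA) (by omega) (fd _ _ fA) (fun _ => 0)
  obtain ⟨B0, B0', B1, B2, B3⟩ := bex_facts h4 (dB.substAll (safe_update_var w n))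
    (x := x) (z := zB) (by omega) (fd _ _ fB) (fun _ => 0)
  have hR := hR α β
  rw [← hn, pr, pr, e1, e2] at hR
  have e3 : (bex zB (.var x) (δB.subst w (Term.numeral n))).subst x (.succ (.var x)) =
      bex zB (.succ (.var x)) (δB.subst w (Term.numeral n)) := by
    have hzx : zB ≠ x := by omega
    have : (δB.subst w (Term.numeral n)).subst x (.succ (.var x)) =
        δB.subst w (Term.numeral n) := subst_of_not_mem fun hh => by
      have := fd _ _ fB hh
      simp at this; omega
    rw [bex, subst_ex_ne hzx]
    change ex zB (((lt (.var zB) (.var x)).subst x _).and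
      ((δB.subst w (Term.numeral n)).subst x _)) = _
    rw [this]
    simp [bex, lt, Formula.subst, Formula.substAll, Term.substAll, update_of_ne hzx]
  refine abstract_ep h4 hc hm hψ hfv A0 A0' B0 B0' A1 A2 A3 B2 B3 ?_ ?_ h
  · refine hR.1.symm.trans ?_
    have := vB (update (fun _ => 0) w n)
    rw [update_self] at this
    rw [this]
    exact exists_congr fun m => (vd _ _ hzB m).symm
  · refine (Iff.of_eq (congrArg (fun χ => Provable T (ex x (χ.and
      (bex zA (.var x) (δA.subst w (Term.numeral n))).neg))) e3)).trans ?_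
    refine hR.2.symm.trans ?_
    have := vA (update (fun _ => 0) w n)
    rw [update_self] at this
    rw [this]
    exact exists_congr fun m => (vd _ _ hzA m).symm

theorem sb_sound (hre : RE T) (h4 : Extends T PAK4) (hc : Consistent T) (hm : HasMDP T)
    {φ : Formula} (hφ : IsSB φ) : ∀ v : ℕ → ℕ, Provable T (φ.substAll (numeralSubst v)) →
      PiSat T φ v := by
  have hT := h4.paBox
  have closed : ∀ (t : Term) (v : ℕ → ℕ) (x : ℕ), x ∉ (t.substAll (numeralSubst v)).fv := by
    intro t v x
    rw [Term.mem_fv_substAll]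
    rintro ⟨z, -, h2⟩
    simp [numeralSubst] at h2
  induction hφ with
  | @delta0 φ h =>
    intro v hp
    rw [PiSat_delta0 h]
    by_contra hn
    have h2 := (delta0_complete h4 h v).2 hn
    refine hc (Provable.taut fun b hb => ?_)
    have h1 := hb.thm hp
    have h2 := hb.thm h2
    rw [hb.neg] at h2
    exact (h2 h1).elim
  | b ψ =>
    intro v hp
    change Provable T (.box (ψ.substAll (numeralSubst v))) at hp
    change Provable T (ψ.substAll (numeralSubst v))
    have := hm _ _ (sentence_numeralSubst ψ v) (sentence_numeralSubst ψ v)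
      ((Provable.logic (.orI1 _ _)).mp hp)
    tauto
  | @and φ ψ _ _ ih1 ih2 =>
    intro v hp
    change Provable T ((φ.substAll (numeralSubst v)).and (ψ.substAll (numeralSubst v))) at hp
    refine ⟨ih1 v (Provable.taut fun b hb => ?_), ih2 v (Provable.taut fun b hb => ?_)⟩
    · exact ((hb.and _ _).1 (hb.thm hp)).1
    · exact ((hb.and _ _).1 (hb.thm hp)).2
  | @or φ ψ s1 s2 ih1 ih2 =>
    intro v hp
    rcases or_prop h4 hm (s1.substAll (safe_numeralSubst v)) (s2.substAll (safe_numeralSubst v))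
      (sentence_numeralSubst φ v) (sentence_numeralSubst ψ v) hp with h | h
    · exact Or.inl (ih1 v h)
    · exact Or.inr (ih2 v h)
  | @ex x φ s ih =>
    intro v hp
    have hfv : (φ.substAll (update (numeralSubst v) x (.var x))).fv ⊆ {x} := by
      intro y hy
      rw [Formula.fv_substAll ((safe_numeralSubst v).update x)] at hy
      by_cases hyx : y = x
      · simpa using hyx
      · have := hy.2
        simp [update_of_ne hyx, numeralSubst] at this
    obtain ⟨n, hn⟩ := ep hre h4 hc hm
      (s.substAll ((safe_numeralSubst v).update x)) hfv hp
    rw [substAll_numeral_update] at hn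
    exact ⟨n, ih _ hn⟩
  | @ball x t φ hx s ih =>
    intro v hp
    rw [ball_substAll hx] at hp
    intro n
    change PiSat T (lt (.var x) t) (update v x n) → PiSat T φ (update v x n)
    intro hn
    refine ih _ ?_
    have h1 := (ball_inst (closed t v x) _ n).mp hp
    rw [substAll_numeral_update] at h1
    refine h1.mp ?_
    have hv : t.val (update v x n) = t.val v := Term.val_congr fun y hy => by
      rw [update_of_ne]
      rintro rfl
      exact hx hy
    have hn' : n < t.val v := by
      rw [← hv]; have : (update v x n) x + 1 ≤ t.val (update v x n) := hn
      rwa [update_self] at this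
    exact Provable.taut fun b hb => hb.le (hb.refl _) (hb.symm (hb.thm (term_eval hT t v)))
      (hb.thm (num_lt hT hn'))

theorem main1 (hre : RE T) (h4 : Extends T PAK4) (hc : Consistent T) (hm : HasMDP T) :
    SigmaBSound T := by
  intro φ hφ hs hp
  refine sb_sound hre h4 hc hm hφ.isSB _ ?_
  rwa [Formula.substAll_id]
  intro y hy
  rw [Sentence] at hs
  rw [hs] at hy
  simp at hy

theorem main2 (hs : SigmaBSound T) : HasMEP T := by
  intro x φ hfv hp
  have hsent : Sentence (ex x (box φ)) := by
    rw [Sentence, Finset.eq_empty_iff_forall_notMem]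
    intro y hy
    simp only [fv, Finset.mem_erase] at hy
    exact hy.1 (by simpa using hfv hy.2)
  obtain ⟨n, hn⟩ := hs _ (.ex (.b φ)) hsent hp
  refine ⟨n, ?_⟩
  change Provable T (φ.substAll (numeralSubst (update (fun _ => 0) x n))) at hn
  rwa [subst_eq_numeralSubst hfv, update_self] at hn

theorem main3 (hs : SigmaBSound T) : HasMDP T := by
  intro φ ψ h1 h2 hp
  have hid : ∀ χ : Formula, Sentence χ → χ.substAll (numeralSubst fun _ => 0) = χ := by
    intro χ hχ
    refine Formula.substAll_id fun y hy => ?_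
    rw [Sentence] at hχ
    rw [hχ] at hy
    simp at hy
  have := hs _ (.or (.b φ) (.b ψ)) (by
    rw [Sentence] at *
    simp [fv, h1, h2]) hp
  rcases this with h | h
  · left
    change Provable T (φ.substAll (numeralSubst fun _ => 0)) at h
    rwa [hid φ h1] at h
  · right
    change Provable T (ψ.substAll (numeralSubst fun _ => 0)) at h
    rwa [hid ψ h2] at h

end

end ModalArith


namespace ModalArith

/-- For an r.e. extension T of PA_□:
(1) if T contains PA(K4), T is consistent and T has MDP, then T is ΣB-sound;
(2) if T is ΣB-sound, then T has MEP.
Consequently, for consistent r.e. extensions of PA(K4), MDP ↔ ΣB-soundness. -/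
theorem statement19 (T : Set Formula) (hre : RE T) (hT : Extends T PABox) :
    (Extends T PAK4 → Consistent T → HasMDP T → SigmaBSound T) ∧
    (SigmaBSound T → HasMEP T) ∧
    (Extends T PAK4 → Consistent T → (HasMDP T ↔ SigmaBSound T)) := by
  refine ⟨main1 hre, main2, fun h4 hc => ⟨main1 hre h4 hc, main3⟩⟩

end ModalArith
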